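/- arXiv:2605.27623 — 3 statements merged into one kernel-verified Lean document; each statement's English description precedes it below -/
import Mathlib

section
/- Let d ≥ 2 be an integer. For a general pencil of plane curves of degree d over ℂ, a general point x ∈ ℙ², and a general line H ⊂ ℙ², the number of points p ∈ H such that the unique member C of the pencil passing through p is smooth at p and the tangent line to C at p passes through x is exactly 2d − 1. -/
noncomputable section

/-- The restriction of the form `F` to the line through `[v]` and `[w]`,
parametrized by `t ↦ v + t • w`, as a polynomial in `t`. -/
def linePoly (F : MvPolynomial (Fin 3) ℂ) (v w : Fin 3 → ℂ) : Polynomial ℂ :=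
  MvPolynomial.aeval (fun i => Polynomial.C (v i) + Polynomial.X * Polynomial.C (w i)) F

/-- The line through the two (projectively distinct) points `[v]`, `[w]` has contact
order at least `m` with the curve `{F = 0}` at the point `[v]`. -/
def ContactLE (F : MvPolynomial (Fin 3) ℂ) (v w : Fin 3 → ℂ) (m : ℕ) : Prop :=
  (Polynomial.X : Polynomial ℂ) ^ m ∣ linePoly F v w

/-- The member of the pencil spanned by `F` and `G` corresponding to `c ∈ ℙ¹`. -/
def pencilMember (F G : MvPolynomial (Fin 3) ℂ) (c : Projectivization ℂ (Fin 2 → ℂ)) :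
    MvPolynomial (Fin 3) ℂ :=
  c.rep 0 • F + c.rep 1 • G

/-- The coefficient vector of a pair of forms. -/
def coeffs2 (F G : MvPolynomial (Fin 3) ℂ) : (Fin 3 →₀ ℕ) ⊕ (Fin 3 →₀ ℕ) → ℂ :=
  Sum.elim (fun m => MvPolynomial.coeff m F) (fun m => MvPolynomial.coeff m G)

/-- The set of points `p` of `ℙ²` lying on the line `{h·y = 0}` such that the unique
member `C` of the pencil spanned by `F` and `G` passing through `p` is smooth at `p`
and the tangent line to `C` at `p` passes through the point `[x]`. -/
def contactPointsOnLineThrough (F G : MvPolynomial (Fin 3) ℂ) (x h : Fin 3 → ℂ) :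
    Set (Projectivization ℂ (Fin 3 → ℂ)) :=
  {p | (∑ i, h i * p.rep i) = 0 ∧
    ∃ c : Projectivization ℂ (Fin 2 → ℂ),
      MvPolynomial.eval p.rep (pencilMember F G c) = 0 ∧
      (∀ c' : Projectivization ℂ (Fin 2 → ℂ),
        MvPolynomial.eval p.rep (pencilMember F G c') = 0 → c' = c) ∧
      (∃ i : Fin 3, MvPolynomial.eval p.rep (MvPolynomial.pderiv i (pencilMember F G c)) ≠ 0) ∧
      (∑ i, MvPolynomial.eval p.rep (MvPolynomial.pderiv i (pencilMember F G c)) * x i) = 0}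


section Aux

open MvPolynomial

/-- `F` restricted to the parametrized line `a + t b`, over any ring. -/
def auxLine {A : Type*} [CommRing A] (F : MvPolynomial (Fin 3) A) (a b : Fin 3 → A) :
    Polynomial A :=
  aeval (fun i => Polynomial.C (a i) + Polynomial.X * Polynomial.C (b i)) F

/-- The form `G · D_y F − F · D_y G`. -/
def auxW {A : Type*} [CommRing A] (F G : MvPolynomial (Fin 3) A) (y : Fin 3 → A) :
    MvPolynomial (Fin 3) A :=
  G * (∑ i, C (y i) * pderiv i F) - F * (∑ i, C (y i) * pderiv i G)

/-- First point of the line `h`. -/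
def auxA {A : Type*} [CommRing A] (h : Fin 3 → A) : Fin 3 → A := ![h 2, 0, -h 0]

/-- Second point of the line `h`. -/
def auxB {A : Type*} [CommRing A] (h : Fin 3 → A) : Fin 3 → A := ![0, h 2, -h 1]

/-- The polynomial whose roots are the contact points. -/
def auxw {A : Type*} [CommRing A] (F G : MvPolynomial (Fin 3) A) (x h : Fin 3 → A) :
    Polynomial A := auxLine (auxW F G x) (auxA h) (auxB h)

/-- The polynomial that should not vanish at the contact points. -/
def auxu {A : Type*} [CommRing A] (F G : MvPolynomial (Fin 3) A) (x h : Fin 3 → A) :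
    Polynomial A :=
  Polynomial.derivative (auxw F G x h) * auxLine (auxW F G (auxB h)) (auxA h) (auxB h)

theorem auxLine_map {A B : Type*} [CommRing A] [CommRing B] (φ : A →+* B)
    (F : MvPolynomial (Fin 3) A) (a b : Fin 3 → A) :
    (auxLine F a b).map φ = auxLine (map φ F) (φ ∘ a) (φ ∘ b) := by
  unfold auxLine
  induction F using MvPolynomial.induction_on with
  | C r => simp
  | add p q hp hq => simp only [map_add, Polynomial.map_add, hp, hq]
  | mul_X p i hp =>
    simp only [map_mul, Polynomial.map_mul, hp, aeval_X, map_X, Polynomial.map_add,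
      Polynomial.map_C, Polynomial.map_X, Function.comp_apply]

theorem auxW_map {A B : Type*} [CommRing A] [CommRing B] (φ : A →+* B)
    (F G : MvPolynomial (Fin 3) A) (y : Fin 3 → A) :
    map φ (auxW F G y) = auxW (map φ F) (map φ G) (φ ∘ y) := by
  simp [auxW, pderiv_map]

theorem auxA_map {A B : Type*} [CommRing A] [CommRing B] (φ : A →+* B) (h : Fin 3 → A) :
    φ ∘ auxA h = auxA (φ ∘ h) := by
  funext i; fin_cases i <;> simp [auxA]

theorem auxB_map {A B : Type*} [CommRing A] [CommRing B] (φ : A →+* B) (h : Fin 3 → A) :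
    φ ∘ auxB h = auxB (φ ∘ h) := by
  funext i; fin_cases i <;> simp [auxB]

theorem auxw_map {A B : Type*} [CommRing A] [CommRing B] (φ : A →+* B)
    (F G : MvPolynomial (Fin 3) A) (x h : Fin 3 → A) :
    (auxw F G x h).map φ = auxw (map φ F) (map φ G) (φ ∘ x) (φ ∘ h) := by
  simp only [auxw, auxLine_map, auxW_map, auxA_map, auxB_map]

theorem auxu_map {A B : Type*} [CommRing A] [CommRing B] (φ : A →+* B)
    (F G : MvPolynomial (Fin 3) A) (x h : Fin 3 → A) :
    (auxu F G x h).map φ = auxu (map φ F) (map φ G) (φ ∘ x) (φ ∘ h) := by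
  simp only [auxu, Polynomial.map_mul, ← Polynomial.derivative_map, auxw_map, auxLine_map,
    auxW_map, auxA_map, auxB_map]

theorem auxLine_eval (F : MvPolynomial (Fin 3) ℂ) (a b : Fin 3 → ℂ) (t : ℂ) :
    (auxLine F a b).eval t = eval (a + t • b) F := by
  unfold auxLine
  induction F using MvPolynomial.induction_on with
  | C r => simp
  | add p q hp hq => simp only [map_add, Polynomial.eval_add, hp, hq]
  | mul_X p i hp =>
    simp only [map_mul, Polynomial.eval_mul, hp, aeval_X]
    simp
    left
    ring

theorem auxLine_deg (F : MvPolynomial (Fin 3) ℂ) (a b : Fin 3 → ℂ) (n : ℕ)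
    (hF : F.IsHomogeneous n) :
    (auxLine F a b).natDegree ≤ n ∧ (auxLine F a b).coeff n = eval b F := by
  have key : ∀ m : Fin 3 →₀ ℕ, m.degree = n →
      (∏ i, (Polynomial.C (a i) + Polynomial.X * Polynomial.C (b i)) ^ m i).natDegree ≤ n ∧
      (∏ i, (Polynomial.C (a i) + Polynomial.X * Polynomial.C (b i)) ^ m i).coeff n
        = ∏ i, b i ^ m i := by
    intro m hm
    have h1 : ∀ i, (Polynomial.C (a i) + Polynomial.X * Polynomial.C (b i)).natDegree ≤ 1 := by
      intro i; compute_degree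
    have h2 : ∀ i, ((Polynomial.C (a i) + Polynomial.X * Polynomial.C (b i)) ^ m i).natDegree
        ≤ m i := by
      intro i
      exact (Polynomial.natDegree_pow_le_of_le (m i) (h1 i)).trans (by simp)
    have h3 : ∀ i, ((Polynomial.C (a i) + Polynomial.X * Polynomial.C (b i)) ^ m i).coeff (m i)
        = b i ^ m i := by
      intro i
      have := Polynomial.coeff_pow_of_natDegree_le (m := m i) (h1 i)
      simpa using this
    have hn : n = m 0 + m 1 + m 2 := by
      rw [← hm, Finsupp.degree_eq_sum, Fin.sum_univ_three]
    simp only [Fin.prod_univ_three]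
    rw [hn]
    have h4 := Polynomial.natDegree_mul_le_of_le (h2 0) (h2 1)
    refine ⟨Polynomial.natDegree_mul_le_of_le h4 (h2 2), ?_⟩
    rw [Polynomial.coeff_mul_add_eq_of_natDegree_le h4 (h2 2),
      Polynomial.coeff_mul_add_eq_of_natDegree_le (h2 0) (h2 1), h3, h3, h3]
  have hs : auxLine F a b = ∑ m ∈ F.support, Polynomial.C (coeff m F) *
      ∏ i, (Polynomial.C (a i) + Polynomial.X * Polynomial.C (b i)) ^ m i := by
    unfold auxLine
    rw [aeval_def, eval₂_eq']
    rfl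
  have hdeg : ∀ m ∈ F.support, m.degree = n := by
    intro m hm
    by_contra hne
    exact (mem_support_iff.mp hm) (hF.coeff_eq_zero hne)
  constructor
  · rw [hs]
    refine Polynomial.natDegree_sum_le_of_forall_le _ _ fun m hm => ?_
    exact (Polynomial.natDegree_C_mul_le _ _).trans (key m (hdeg m hm)).1
  · rw [hs, Polynomial.finsetSum_coeff, eval_eq']
    refine Finset.sum_congr rfl fun m hm => ?_
    rw [Polynomial.coeff_C_mul, (key m (hdeg m hm)).2]

theorem auxW_hom (F G : MvPolynomial (Fin 3) ℂ) (y : Fin 3 → ℂ) (d : ℕ) (hd : 2 ≤ d)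
    (hF : F.IsHomogeneous d) (hG : G.IsHomogeneous d) :
    (auxW F G y).IsHomogeneous (2 * d - 1) := by
  have e : 2 * d - 1 = d + (d - 1) := by omega
  rw [e]
  refine IsHomogeneous.sub ?_ ?_
  · exact hG.mul (IsHomogeneous.sum _ _ _ fun i _ => (hF.pderiv).C_mul _)
  · exact hF.mul (IsHomogeneous.sum _ _ _ fun i _ => (hG.pderiv).C_mul _)

theorem aux_hom_smul (F : MvPolynomial (Fin 3) ℂ) (n : ℕ) (hF : F.IsHomogeneous n)
    (r : ℂ) (v : Fin 3 → ℂ) : eval (r • v) F = r ^ n * eval v F := by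
  rw [eval_eq', eval_eq', Finset.mul_sum]
  refine Finset.sum_congr rfl fun m hm => ?_
  have hn : n = m 0 + m 1 + m 2 := by
    have : m.degree = n := by
      by_contra hne
      exact (mem_support_iff.mp hm) (hF.coeff_eq_zero hne)
    rw [← this, Finsupp.degree_eq_sum, Fin.sum_univ_three]
  simp only [Fin.prod_univ_three, Pi.smul_apply, smul_eq_mul, hn]
  ring

/-- The finite set of exponents of degree `d`. -/
def auxExps (d : ℕ) : Finset (Fin 3 →₀ ℕ) := Finset.finsuppAntidiag Finset.univ d

theorem aux_univ {A : Type*} [CommRing A] (d : ℕ) (Y : (Fin 3 →₀ ℕ) → A) (φ : A →+* ℂ)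
    (F : MvPolynomial (Fin 3) ℂ) (hF : F.IsHomogeneous d) (hX : ∀ m, φ (Y m) = coeff m F) :
    map φ (∑ m ∈ auxExps d, monomial m (Y m)) = F := by
  ext m
  simp only [map_sum, map_monomial, hX, coeff_sum, coeff_monomial, Finset.sum_ite_eq']
  split_ifs with h
  · rfl
  · symm
    apply hF.coeff_eq_zero
    intro hm
    apply h
    simp only [auxExps, Finset.mem_finsuppAntidiag]
    exact ⟨by rw [← hm, Finsupp.degree_eq_sum], by simp⟩

theorem auxW_eval (F G : MvPolynomial (Fin 3) ℂ) (y v : Fin 3 → ℂ) :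
    eval v (auxW F G y) = eval v G * (∑ i, eval v (pderiv i F) * y i)
      - eval v F * (∑ i, eval v (pderiv i G) * y i) := by
  simp [auxW, mul_comm]

theorem aux_pencil (F G : MvPolynomial (Fin 3) ℂ) (c : Projectivization ℂ (Fin 2 → ℂ))
    (v : Fin 3 → ℂ) (i : Fin 3) : eval v (pderiv i (pencilMember F G c)) =
      c.rep 0 * eval v (pderiv i F) + c.rep 1 * eval v (pderiv i G) := by
  simp only [pencilMember, map_add, Derivation.map_smul, smul_eval]

/-- Main geometric step. -/
theorem aux_count (d : ℕ) (hd : 2 ≤ d) (F G : MvPolynomial (Fin 3) ℂ) (x h : Fin 3 → ℂ)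
    (hF : F.IsHomogeneous d) (hG : G.IsHomogeneous d) (h2 : h 2 ≠ 0)
    (hw : (auxw F G x h).coeff (2 * d - 1) ≠ 0)
    (hu : ∀ t, (auxw F G x h).eval t = 0 → (auxu F G x h).eval t ≠ 0) :
    (contactPointsOnLineThrough F G x h).Finite ∧
      ((contactPointsOnLineThrough F G x h).ncard : ℤ) = 2 * (d : ℤ) - 1 := by
  set w := auxw F G x h with hwdef
  set a := auxA h with ha
  set b := auxB h with hb
  have hWh := fun y => auxW_hom F G y d hd hF hG
  have hdeg := auxLine_deg (auxW F G x) a b _ (hWh x)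
  have hwdeg : w.natDegree = 2 * d - 1 :=
    le_antisymm hdeg.1 (Polynomial.le_natDegree_of_ne_zero hw)
  have hWb : eval b (auxW F G x) ≠ 0 := by rw [← hdeg.2]; exact hw
  have hw0 : w ≠ 0 := by rintro e; rw [e] at hw; simp at hw
  have hnz : ∀ t : ℂ, a + t • b ≠ 0 := by
    intro t e
    have := congrFun e 0
    simp [ha, hb, auxA, auxB, h2] at this
  have hnodup : w.roots.Nodup := by
    refine Polynomial.nodup_roots ?_
    rw [Polynomial.separable_def]
    rw [Polynomial.isCoprime_iff_aeval_ne_zero_of_isAlgClosed ℂ ℂ]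
    intro t
    by_contra! hzz
    obtain ⟨ht, hzd⟩ := hzz
    rw [Polynomial.coe_aeval_eq_eval] at ht hzd
    refine hu t ht ?_
    rw [auxu, Polynomial.eval_mul]
    have : Polynomial.eval t (Polynomial.derivative w) = 0 := hzd
    rw [this, zero_mul]
  have hcard : w.roots.toFinset.card = 2 * d - 1 := by
    rw [Multiset.toFinset_card_of_nodup hnodup, ← hwdeg]
    exact (IsAlgClosed.splits w).natDegree_eq_card_roots.symm
  let P : ℂ → Projectivization ℂ (Fin 3 → ℂ) := fun t => Projectivization.mk ℂ (a + t • b) (hnz t)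
  have hPinj : Function.Injective P := by
    intro s t hst
    rw [Projectivization.mk_eq_mk_iff'] at hst
    obtain ⟨r, hr⟩ := hst
    have e0 := congrFun hr 0
    have e1 := congrFun hr 1
    simp [ha, hb, auxA, auxB, h2] at e0 e1
    subst e0
    simpa [h2] using e1.symm
  have hset : contactPointsOnLineThrough F G x h = P '' (w.roots.toFinset : Set ℂ) := by
    ext p
    constructor
    · rintro ⟨hp, c, hc, -, -, hct⟩
      have hcnz := c.rep_nonzero
      have hW : eval p.rep (auxW F G x) = 0 := by
        rw [auxW_eval]
        simp only [aux_pencil, Fin.sum_univ_three] at hct ⊢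
        simp only [pencilMember, map_add, smul_eval] at hc
        by_cases hc0 : c.rep 0 = 0
        · have hc1 : c.rep 1 ≠ 0 := by
            intro hc1
            apply hcnz
            funext i; fin_cases i <;> simp [hc0, hc1]
          apply mul_left_cancel₀ hc1
          rw [hc0] at hc hct
          linear_combination (eval p.rep (pderiv 0 F) * x 0 + eval p.rep (pderiv 1 F) * x 1 +
            eval p.rep (pderiv 2 F) * x 2) * hc - eval p.rep F * hct
        · apply mul_left_cancel₀ hc0
          linear_combination eval p.rep G * hct - (eval p.rep (pderiv 0 G) * x 0 +
            eval p.rep (pderiv 1 G) * x 1 + eval p.rep (pderiv 2 G) * x 2) * hc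
      have hrep : (h 2) • p.rep = p.rep 0 • a + p.rep 1 • b := by
        rw [Fin.sum_univ_three] at hp
        funext i
        fin_cases i
        · simp [ha, hb, auxA, auxB, mul_comm]
        · simp [ha, hb, auxA, auxB, mul_comm]
        · simp [ha, hb, auxA, auxB]
          linear_combination hp
      have hp0 : p.rep 0 ≠ 0 := by
        intro e
        rw [e, zero_smul, zero_add] at hrep
        have h3 : eval (h 2 • p.rep) (auxW F G x) = 0 := by
          rw [aux_hom_smul _ _ (hWh x), hW, mul_zero]
        rw [hrep, aux_hom_smul _ _ (hWh x)] at h3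
        rcases mul_eq_zero.mp h3 with h4 | h4
        · have h5 : p.rep 1 = 0 := pow_eq_zero_iff (by omega) |>.mp h4
          rw [h5, zero_smul] at hrep
          exact p.rep_nonzero ((smul_eq_zero.mp hrep).resolve_left h2)
        · exact hWb h4
      have hrep2 : a + (p.rep 1 / p.rep 0) • b = (h 2 / p.rep 0) • p.rep := by
        have : (h 2 / p.rep 0) • p.rep = (p.rep 0)⁻¹ • (h 2 • p.rep) := by
          rw [smul_smul]; congr 1; field_simp
        rw [this, hrep, smul_add, smul_smul, smul_smul, inv_mul_cancel₀ hp0, one_smul]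
        congr 2; field_simp
      refine ⟨p.rep 1 / p.rep 0, ?_, ?_⟩
      · simp only [Finset.mem_coe, Multiset.mem_toFinset]
        rw [Polynomial.mem_roots hw0, Polynomial.IsRoot, hwdef, auxw, auxLine_eval, hrep2,
          aux_hom_smul _ _ (hWh x), hW, mul_zero]
      · conv_rhs => rw [← p.mk_rep]
        rw [Projectivization.mk_eq_mk_iff']
        exact ⟨_, hrep2.symm⟩
    · rintro ⟨t, ht, rfl⟩
      simp only [Finset.mem_coe, Multiset.mem_toFinset] at ht
      have ht0 : w.eval t = 0 := Polynomial.isRoot_of_mem_roots ht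
      have hut := hu t ht0
      rw [auxu, Polynomial.eval_mul] at hut
      have hub := right_ne_zero_of_mul hut
      rw [auxLine_eval] at hub
      rw [hwdef, auxw, auxLine_eval] at ht0
      obtain ⟨r, hr⟩ := Projectivization.exists_smul_eq_mk_rep ℂ (a + t • b) (hnz t)
      set v := (P t).rep with hv
      have hvr : v = (r : ℂ) • (a + t • b) := hr.symm
      have hWx : eval v (auxW F G x) = 0 := by
        rw [hvr, aux_hom_smul _ _ (hWh x), ht0, mul_zero]
      have hWbv : eval v (auxW F G b) ≠ 0 := by
        rw [hvr, aux_hom_smul _ _ (hWh b)]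
        exact mul_ne_zero (pow_ne_zero _ r.ne_zero) hub
      rw [auxW_eval] at hWx hWbv
      have hFG : (![eval v G, -eval v F] : Fin 2 → ℂ) ≠ 0 := by
        intro e
        have e0 := congrFun e 0
        have e1 := congrFun e 1
        simp at e0 e1
        apply hWbv
        rw [e0, e1]; ring
      obtain ⟨q, hq⟩ := Projectivization.exists_smul_eq_mk_rep ℂ _ hFG
      set c := Projectivization.mk ℂ _ hFG with hc
      have hq0 : c.rep 0 = q * eval v G := by rw [← hq]; simp [Units.smul_def]
      have hq1 : c.rep 1 = q * -eval v F := by rw [← hq]; simp [Units.smul_def]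
      refine ⟨?_, c, ?_, ?_, ?_, ?_⟩
      · change ∑ i, h i * v i = 0
        rw [hvr, Fin.sum_univ_three]
        simp [ha, hb, auxA, auxB]
        ring
      · change eval v _ = 0
        simp only [pencilMember, map_add, smul_eval, hq0, hq1]
        ring
      · intro cc hcc
        change eval v _ = 0 at hcc
        simp only [pencilMember, map_add, smul_eval] at hcc
        rw [← cc.mk_rep, hc, Projectivization.mk_eq_mk_iff']
        by_cases hG0 : eval v G = 0
        · have hF0 : eval v F ≠ 0 := by
            intro hF0
            apply hFG
            funext i; fin_cases i <;> simp [hF0, hG0]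
          refine ⟨- cc.rep 1 / eval v F, ?_⟩
          have : cc.rep 0 = 0 := by
            rw [hG0, mul_zero, add_zero] at hcc
            exact (mul_eq_zero.mp hcc).resolve_right hF0
          funext i; fin_cases i
          · simp [hG0, this]
          · simp; field_simp
        · refine ⟨cc.rep 0 / eval v G, ?_⟩
          funext i; fin_cases i
          · simp; field_simp
          · simp; field_simp; linear_combination -hcc
      · change ∃ i, eval v _ ≠ 0
        by_contra! hall
        have h0 : ∀ i, eval v G * eval v (pderiv i F) - eval v F * eval v (pderiv i G) = 0 := by
          intro i
          have := hall i
          rw [aux_pencil, hq0, hq1] at this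
          apply mul_left_cancel₀ q.ne_zero
          linear_combination this
        apply hWbv
        simp only [Fin.sum_univ_three]
        linear_combination b 0 * h0 0 + b 1 * h0 1 + b 2 * h0 2
      · change ∑ i, eval v _ * x i = 0
        simp only [aux_pencil, hq0, hq1, Fin.sum_univ_three] at hWx ⊢
        linear_combination (q : ℂ) * hWx
  rw [hset]
  refine ⟨(Finset.finite_toSet _).image _, ?_⟩
  rw [Set.ncard_image_of_injective _ hPinj, Set.ncard_coe_finset, hcard]
  omega

theorem aux_witness (d : ℕ) (hd : 2 ≤ d) :
    ∃ (F G : MvPolynomial (Fin 3) ℂ) (x h : Fin 3 → ℂ),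
      F.IsHomogeneous d ∧ G.IsHomogeneous d ∧ LinearIndependent ℂ ![F, G] ∧
      x ≠ 0 ∧ h ≠ 0 ∧ h 2 ≠ 0 ∧ (auxw F G x h).coeff (2 * d - 1) ≠ 0 ∧
      ∀ t, (auxw F G x h).eval t = 0 → (auxu F G x h).eval t ≠ 0 := by
  obtain ⟨k, rfl⟩ : ∃ k, d = k + 1 := ⟨d - 1, by omega⟩
  have hk : k ≠ 0 := by omega
  have hx : (![0, 0, 1] : Fin 3 → ℂ) ≠ 0 := fun e => by simpa using congrFun e 2
  have hFh : (X 0 ^ (k + 1) + X 2 * X 1 ^ k : MvPolynomial (Fin 3) ℂ).IsHomogeneous (k + 1) := by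
    refine (isHomogeneous_X_pow _ _).add ?_
    rw [add_comm]
    exact (isHomogeneous_X _ _).mul (isHomogeneous_X_pow _ _)
  have hGh : (X 1 ^ (k + 1) + X 2 * X 0 ^ k : MvPolynomial (Fin 3) ℂ).IsHomogeneous (k + 1) := by
    refine (isHomogeneous_X_pow _ _).add ?_
    rw [add_comm]
    exact (isHomogeneous_X _ _).mul (isHomogeneous_X_pow _ _)
  have hw : auxw (X 0 ^ (k + 1) + X 2 * X 1 ^ k) (X 1 ^ (k + 1) + X 2 * X 0 ^ k)
      (![0, 0, 1] : Fin 3 → ℂ) ![0, 0, 1] = Polynomial.X ^ (2 * k + 1) - 1 := by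
    simp [auxw, auxW, auxLine, auxA, auxB, Fin.sum_univ_three, pderiv_X, Pi.single_apply]
    ring
  have hu : auxLine (auxW (X 0 ^ (k + 1) + X 2 * X 1 ^ k) (X 1 ^ (k + 1) + X 2 * X 0 ^ k)
      (auxB ![0, 0, 1])) (auxA (![0, 0, 1] : Fin 3 → ℂ)) (auxB ![0, 0, 1])
      = - (Polynomial.C ((k : ℂ) + 1) * Polynomial.X ^ k) := by
    simp [auxW, auxLine, auxA, auxB, Fin.sum_univ_three, pderiv_X, Pi.single_apply]
  refine ⟨X 0 ^ (k + 1) + X 2 * X 1 ^ k, X 1 ^ (k + 1) + X 2 * X 0 ^ k, ![0, 0, 1], ![0, 0, 1],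
    hFh, hGh, ?_, hx, hx, by simp, ?_, ?_⟩
  · rw [LinearIndependent.pair_iff]
    intro s t hst
    have h1 := congrArg (eval ![1, 0, 0]) hst
    have h2 := congrArg (eval ![0, 1, 0]) hst
    simp [smul_eval] at h1 h2
    exact ⟨h1, h2⟩
  · rw [hw]
    have : 2 * (k + 1) - 1 = 2 * k + 1 := by omega
    rw [this]
    simp [Polynomial.coeff_one]
  · intro t ht
    rw [auxu, hu, hw]
    rw [hw] at ht
    have ht0 : t ≠ 0 := by
      rintro rfl
      simp at ht
    have hk1 : (k : ℂ) + 1 ≠ 0 := by exact_mod_cast Nat.succ_ne_zero k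
    have hk2 : 2 * (k : ℂ) + 1 ≠ 0 := by exact_mod_cast Nat.succ_ne_zero (2 * k)
    simp [Polynomial.derivative_X_pow, ht0, hk1, hk2]

theorem aux_res (w u : Polynomial ℂ) (n N : ℕ) (hn : w.natDegree ≤ n) (hc : w.coeff n ≠ 0)
    (hN : u.natDegree ≤ N) :
    Polynomial.resultant w u n N ≠ 0 ↔ ∀ t, w.eval t = 0 → u.eval t ≠ 0 := by
  have hw0 : w ≠ 0 := by rintro e; rw [e] at hc; simp at hc
  have e : n = w.natDegree := le_antisymm (Polynomial.le_natDegree_of_ne_zero hc) hn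
  rw [e, Polynomial.resultant_eq_prod_eval w u N hN (IsAlgClosed.splits w)]
  have : w.leadingCoeff ^ N ≠ 0 := pow_ne_zero _ (by simpa using hw0)
  simp only [ne_eq, mul_eq_zero, this, false_or, Multiset.prod_eq_zero_iff, Multiset.mem_map,
    Polynomial.mem_roots hw0, Polynomial.IsRoot, not_exists, not_and]

end Aux

/-- For a general pencil of degree-`d` plane curves, a general point `[x] ∈ ℙ²` and a
general line `H = {h·y = 0} ⊂ ℙ²`, the number of points `p ∈ H` such that the unique
member of the pencil through `p` is smooth at `p` with tangent line at `p` passing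
through `[x]` is exactly `2d − 1`. -/
theorem contact_points_on_line_count (d : ℕ) (hd : 2 ≤ d) :
    ∃ Q : MvPolynomial (((Fin 3 →₀ ℕ) ⊕ (Fin 3 →₀ ℕ)) ⊕ (Fin 3 ⊕ Fin 3)) ℂ,
      (∃ (F G : MvPolynomial (Fin 3) ℂ) (x h : Fin 3 → ℂ),
          F.IsHomogeneous d ∧ G.IsHomogeneous d ∧ LinearIndependent ℂ ![F, G] ∧
          x ≠ 0 ∧ h ≠ 0 ∧
          MvPolynomial.eval (Sum.elim (coeffs2 F G) (Sum.elim x h)) Q ≠ 0) ∧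
      ∀ (F G : MvPolynomial (Fin 3) ℂ) (x h : Fin 3 → ℂ),
        F.IsHomogeneous d → G.IsHomogeneous d → LinearIndependent ℂ ![F, G] →
        x ≠ 0 → h ≠ 0 →
        MvPolynomial.eval (Sum.elim (coeffs2 F G) (Sum.elim x h)) Q ≠ 0 →
          (contactPointsOnLineThrough F G x h).Finite ∧
            ((contactPointsOnLineThrough F G x h).ncard : ℤ) = 2 * (d : ℤ) - 1 := by
  classical
  let V := ((Fin 3 →₀ ℕ) ⊕ (Fin 3 →₀ ℕ)) ⊕ (Fin 3 ⊕ Fin 3)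
  let R := MvPolynomial V ℂ
  let uF : MvPolynomial (Fin 3) R := ∑ m ∈ auxExps d,
    MvPolynomial.monomial m (MvPolynomial.X (Sum.inl (Sum.inl m)) : R)
  let uG : MvPolynomial (Fin 3) R := ∑ m ∈ auxExps d,
    MvPolynomial.monomial m (MvPolynomial.X (Sum.inl (Sum.inr m)) : R)
  let ux : Fin 3 → R := fun i => MvPolynomial.X (Sum.inr (Sum.inl i))
  let uh : Fin 3 → R := fun i => MvPolynomial.X (Sum.inr (Sum.inr i))
  let N := (auxu uF uG ux uh).natDegree
  let Q : R := uh 2 * (auxw uF uG ux uh).coeff (2 * d - 1) *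
    Polynomial.resultant (auxw uF uG ux uh) (auxu uF uG ux uh) (2 * d - 1) N
  have key : ∀ (F G : MvPolynomial (Fin 3) ℂ) (x h : Fin 3 → ℂ),
      F.IsHomogeneous d → G.IsHomogeneous d →
      (MvPolynomial.eval (Sum.elim (coeffs2 F G) (Sum.elim x h)) Q ≠ 0 ↔
        h 2 ≠ 0 ∧ (auxw F G x h).coeff (2 * d - 1) ≠ 0 ∧
        ∀ t, (auxw F G x h).eval t = 0 → (auxu F G x h).eval t ≠ 0) := by
    intro F G x h hF hG
    let φ : R →+* ℂ := MvPolynomial.eval (Sum.elim (coeffs2 F G) (Sum.elim x h))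
    have eF : MvPolynomial.map φ uF = F :=
      aux_univ d _ φ F hF (fun m => MvPolynomial.eval_X _)
    have eG : MvPolynomial.map φ uG = G :=
      aux_univ d _ φ G hG (fun m => MvPolynomial.eval_X _)
    have ex : φ ∘ ux = x := by funext i; exact MvPolynomial.eval_X _
    have eh : φ ∘ uh = h := by funext i; exact MvPolynomial.eval_X _
    have ew : (auxw uF uG ux uh).map φ = auxw F G x h := by rw [auxw_map, eF, eG, ex, eh]
    have eu : (auxu uF uG ux uh).map φ = auxu F G x h := by rw [auxu_map, eF, eG, ex, eh]
    have hN : (auxu F G x h).natDegree ≤ N := by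
      rw [← eu]; exact Polynomial.natDegree_map_le
    have hQ : φ Q = h 2 * (auxw F G x h).coeff (2 * d - 1) *
        Polynomial.resultant (auxw F G x h) (auxu F G x h) (2 * d - 1) N := by
      simp only [Q, map_mul]
      rw [← Polynomial.resultant_map_map, ← Polynomial.coeff_map, ew, eu]
      congr 2
      exact congrFun eh 2
    change φ Q ≠ 0 ↔ _
    rw [hQ, mul_ne_zero_iff, mul_ne_zero_iff, and_assoc]
    refine and_congr_right fun _ => and_congr_right fun hc => ?_
    exact aux_res _ _ _ _ (auxLine_deg _ _ _ _ (auxW_hom F G x d hd hF hG)).1 hc hN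
  refine ⟨Q, ?_, ?_⟩
  · obtain ⟨F, G, x, h, hF, hG, hli, hx, hh, hrest⟩ := aux_witness d hd
    exact ⟨F, G, x, h, hF, hG, hli, hx, hh, (key F G x h hF hG).2 hrest⟩
  · intro F G x h hF hG _ _ _ hQ
    obtain ⟨h2, hw, hu⟩ := (key F G x h hF hG).1 hQ
    exact aux_count d hd F G x h hF hG h2 hw hu
end
end

section
/- Fix a point q ∈ ℙ²(ℂ). For a general quartic plane curve C singular at q (i.e., C = {F = 0} with F a general member of the linear space of degree-4 forms all of whose first partial derivatives vanish at q), the number of lines that are tangent to C at two distinct points, both different from q, is exactly 16. -/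
noncomputable section

/-- The coefficient vector of a single form. -/
def coeffs1 (F : MvPolynomial (Fin 3) ℂ) : (Fin 3 →₀ ℕ) → ℂ :=
  fun m => MvPolynomial.coeff m F

/-- The set of proper bitangent lines of the curve `{F = 0}` relative to the point `[q]`:
lines (2-dimensional linear subspaces of `ℂ³`) tangent to the curve at two distinct
points, both different from `[q]`. -/
def properBitangentLines (F : MvPolynomial (Fin 3) ℂ) (q : Fin 3 → ℂ) :
    Set (Submodule ℂ (Fin 3 → ℂ)) :=
  {W | Module.finrank ℂ ↥W = 2 ∧
    ∃ v w : Fin 3 → ℂ, v ∈ W ∧ w ∈ W ∧ LinearIndependent ℂ ![v, w] ∧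
      LinearIndependent ℂ ![v, q] ∧ LinearIndependent ℂ ![w, q] ∧
      ContactLE F v w 2 ∧ ContactLE F w v 2}

section helpers

open Polynomial

theorem alg_dep (φ : Fin 12 → MvPolynomial (Fin 11) ℂ) :
    ∃ P : MvPolynomial (Fin 12) ℂ, P ≠ 0 ∧
      ∀ p, MvPolynomial.eval (fun i => MvPolynomial.eval p (φ i)) P = 0 := by
  have h : ¬ AlgebraicIndependent ℂ φ := by
    intro h
    have h1 := h.lift_cardinalMk_le_trdeg
    rw [MvPolynomial.trdeg_of_isDomain] at h1
    simp at h1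
    norm_num at h1
  rw [algebraicIndependent_iff] at h
  push Not at h
  obtain ⟨P, hP, hne⟩ := h
  refine ⟨P, hne, fun p => ?_⟩
  have := congrArg (MvPolynomial.eval p) hP
  rw [map_zero] at this
  rw [← this, MvPolynomial.aeval_def, MvPolynomial.eval₂_eq', MvPolynomial.eval_eq', map_sum]
  refine Finset.sum_congr rfl fun d _ => ?_
  rw [map_mul, map_prod, MvPolynomial.algebraMap_eq, MvPolynomial.eval_C]
  simp only [map_pow]

/-- if the polynomials agree -/
theorem signs {g : ℂ[X]} (hdeg : g.natDegree ≤ 6) {b : ℂ} (hlead : g.coeff 6 = b) (r : Fin 6 → ℂ)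
    (hr : Function.Injective r) (h : ∀ i, g.eval (r i) = 0) :
    g = C b * ∏ i, (X - C (r i)) := by
  have hP : (C b * ∏ i, (X - C (r i))).natDegree ≤ 6 := by
    refine natDegree_C_mul_le _ _ |>.trans ?_
    rw [natDegree_prod_of_monic _ _ (fun i _ => monic_X_sub_C _)]
    simp
  have hc : (∏ i, (X - C (r i))).coeff 6 = 1 := by
    have hm : (∏ i, (X - C (r i))).Monic := monic_prod_of_monic _ _ (fun i _ => monic_X_sub_C _)
    have h2 : (∏ i, (X - C (r i))).natDegree = 6 := by
      rw [natDegree_prod_of_monic _ _ (fun i _ => monic_X_sub_C _)]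
      simp
    have h3 := hm.coeff_natDegree
    rwa [h2] at h3
  rw [← sub_eq_zero]
  set d := g - C b * ∏ i, (X - C (r i)) with hd
  have hdd : d.natDegree ≤ 6 := (natDegree_sub_le _ _).trans (max_le hdeg hP)
  have hd6 : d.coeff 6 = 0 := by rw [hd, coeff_sub, coeff_C_mul, hc, hlead]; ring
  have hdlt : d.degree < (Finset.univ : Finset (Fin 6)).card := by
    rw [degree_lt_iff_coeff_zero]
    intro m hm
    simp at hm
    rcases hm.eq_or_lt with rfl | hm
    · exact hd6
    · exact coeff_eq_zero_of_natDegree_lt (by omega)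
  refine eq_zero_of_degree_lt_of_eval_index_eq_zero Finset.univ hr.injOn hdlt ?_
  intro i _
  rw [hd, eval_sub, h i, eval_mul, eval_prod, Finset.prod_eq_zero (Finset.mem_univ i)]
  all_goals simp

def Bf (b0 b1 b2 b3 x y : ℂ) : ℂ := b0 * x ^ 3 + b1 * x ^ 2 * y + b2 * x * y ^ 2 + b3 * y ^ 3

def Cf (c0 c1 c2 c3 c4 x y : ℂ) : ℂ :=
  c0 * x ^ 4 + c1 * x ^ 3 * y + c2 * x ^ 2 * y ^ 2 + c3 * x * y ^ 3 + c4 * y ^ 4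

/-- Lines `z = a x + b y` on which the form restricts to a square. -/
def Sol (b0 b1 b2 b3 c0 c1 c2 c3 c4 : ℂ) : Set (ℂ × ℂ) :=
  {p | ∃ s0 s1 s2 : ℂ, ∀ x y : ℂ,
    x * y * (p.1 * x + p.2 * y) ^ 2 + Bf b0 b1 b2 b3 x y * (p.1 * x + p.2 * y)
      + Cf c0 c1 c2 c3 c4 x y = (s0 * x ^ 2 + s1 * x * y + s2 * y ^ 2) ^ 2}

/-- admissible sign vectors -/
def SignSet : Finset (Fin 6 → ℤˣ) := Finset.univ.filter fun e => e 0 = 1 ∧ ∏ i, e i = 1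

set_option maxRecDepth 100000 in
theorem card_SignSet : SignSet.card = 16 := by decide

def Ge (b3 : ℂ) (σ : Fin 6 → ℂ) (e : Fin 6 → ℤˣ) : ℂ[X] :=
  C b3 * ∏ i, (X - C (((e i : ℤ) : ℂ) * σ i))

theorem Ge_natDegree (b3 : ℂ) (σ : Fin 6 → ℂ) (e : Fin 6 → ℤˣ) : (Ge b3 σ e).natDegree ≤ 6 := by
  refine natDegree_C_mul_le _ _ |>.trans ?_
  rw [natDegree_prod_of_monic _ _ (fun i _ => monic_X_sub_C _)]
  simp only [natDegree_X_sub_C]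
  simp

theorem Ge_coeff6 (b3 : ℂ) (σ : Fin 6 → ℂ) (e : Fin 6 → ℤˣ) : (Ge b3 σ e).coeff 6 = b3 := by
  have hm : (∏ i, (X - C (((e i : ℤ) : ℂ) * σ i))).Monic :=
    monic_prod_of_monic _ _ (fun i _ => monic_X_sub_C _)
  have h2 : (∏ i, (X - C (((e i : ℤ) : ℂ) * σ i))).natDegree = 6 := by
    rw [natDegree_prod_of_monic _ _ (fun i _ => monic_X_sub_C _)]
    simp only [natDegree_X_sub_C]
    simp
  have h3 := hm.coeff_natDegree
  rw [h2] at h3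
  rw [Ge, coeff_C_mul, h3, mul_one]

theorem unit_cast (u : ℤˣ) : ((u : ℤ) : ℂ) = 1 ∨ ((u : ℤ) : ℂ) = -1 := by
  rcases Int.units_eq_one_or u with rfl | rfl <;> simp

theorem Ge_coeff0 {b0 b3 : ℂ} {σ : Fin 6 → ℂ} (hp : b3 * ∏ i, σ i = b0) (e : Fin 6 → ℤˣ) :
    (Ge b3 σ e).coeff 0 = ((∏ i, e i : ℤˣ) : ℤ) * b0 := by
  rw [coeff_zero_eq_eval_zero, Ge, eval_mul, eval_prod, ← hp]
  simp [Fin.prod_univ_six]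
  ring

theorem Ge_eval (b3 : ℂ) (σ : Fin 6 → ℂ) (e : Fin 6 → ℤˣ) (τ : ℂ) :
    (Ge b3 σ e).eval τ * (Ge b3 σ e).eval (-τ) = b3 ^ 2 * ∏ i, (τ ^ 2 - σ i ^ 2) := by
  have h : ∀ i, ((e i : ℤ) : ℂ) ^ 2 = 1 := fun i => by
    rcases unit_cast (e i) with h | h <;> rw [h] <;> norm_num
  have h' : ∀ i, τ ^ 2 - σ i ^ 2 =
      -((τ - ((e i : ℤ) : ℂ) * σ i) * (-τ - ((e i : ℤ) : ℂ) * σ i)) := fun i => by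
    linear_combination (σ i ^ 2) * h i
  simp only [h', Ge, eval_mul, eval_prod, eval_C, eval_sub, eval_X]
  rw [Finset.prod_neg, Finset.prod_mul_distrib]
  simp
  ring

theorem eval_seven {g : ℂ[X]} (hdeg : g.natDegree ≤ 6) (τ : ℂ) :
    g.eval τ = g.coeff 0 + g.coeff 1 * τ + g.coeff 2 * τ ^ 2 + g.coeff 3 * τ ^ 3
      + g.coeff 4 * τ ^ 4 + g.coeff 5 * τ ^ 5 + g.coeff 6 * τ ^ 6 := by
  rw [eval_eq_sum_range' (n := 7) (by omega)]
  simp [Finset.sum_range_succ]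

theorem five_zero {p0 p1 p2 p3 p4 : ℂ}
    (h : ∀ T : ℂ, T * (p0 + p1 * T + p2 * T ^ 2 + p3 * T ^ 3 + p4 * T ^ 4) = 0) :
    p0 = 0 ∧ p1 = 0 ∧ p2 = 0 ∧ p3 = 0 ∧ p4 = 0 := by
  have : X * (C p0 + C p1 * X + C p2 * X ^ 2 + C p3 * X ^ 3 + C p4 * X ^ 4) = (0 : ℂ[X]) := by
    apply Polynomial.funext
    intro T
    simpa using h T
  have h2 := (mul_eq_zero.1 this).resolve_left X_ne_zero
  have hc := fun n => congrArg (fun q => coeff q n) h2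
  refine ⟨?_, ?_, ?_, ?_, ?_⟩
  · simpa [coeff_X, coeff_C, coeff_X_pow] using hc 0
  · simpa [coeff_X, coeff_C, coeff_X_pow] using hc 1
  · simpa [coeff_X, coeff_C, coeff_X_pow] using hc 2
  · simpa [coeff_X, coeff_C, coeff_X_pow] using hc 3
  · simpa [coeff_X, coeff_C, coeff_X_pow] using hc 4

section core
variable {b0 b1 b2 b3 c0 c1 c2 c3 c4 : ℂ} {σ : Fin 6 → ℂ}

theorem sol_mem (hp : b3 * ∏ i, σ i = b0)
    (hD : ∀ T, Bf b0 b1 b2 b3 1 T ^ 2 - 4 * T * Cf c0 c1 c2 c3 c4 1 T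
      = b3 ^ 2 * ∏ i, (T - σ i ^ 2)) {e : Fin 6 → ℤˣ} (he : e ∈ SignSet) :
    (((Ge b3 σ e).coeff 2 - b1) / 2, ((Ge b3 σ e).coeff 4 - b2) / 2)
      ∈ Sol b0 b1 b2 b3 c0 c1 c2 c3 c4 := by
  have he' : ∏ i, e i = 1 := (Finset.mem_filter.1 he).2.2
  have g0 := Ge_coeff0 hp e
  rw [he'] at g0
  have g6 := Ge_coeff6 b3 σ e
  have hev := fun τ => Ge_eval b3 σ e τ
  simp only [eval_seven (Ge_natDegree b3 σ e), ← hD] at hev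
  rw [g0, g6] at hev
  generalize (Ge b3 σ e).coeff 1 = g1 at *
  generalize (Ge b3 σ e).coeff 2 = g2 at *
  generalize (Ge b3 σ e).coeff 3 = g3 at *
  generalize (Ge b3 σ e).coeff 4 = g4 at *
  generalize (Ge b3 σ e).coeff 5 = g5 at *
  simp only [Units.val_one, Int.cast_one, one_mul] at hev
  refine ⟨-g1 / 2, -g3 / 2, -g5 / 2, ?_⟩
  obtain ⟨a, rfl⟩ : ∃ a, g2 = b1 + 2 * a := ⟨(g2 - b1) / 2, by ring⟩
  obtain ⟨b, rfl⟩ : ∃ b, g4 = b2 + 2 * b := ⟨(g4 - b2) / 2, by ring⟩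
  have key : ∀ T : ℂ, T * ((b0 * a + c0 - (g1 / 2) ^ 2)
      + (a ^ 2 + b1 * a + b0 * b + c1 - g1 * g3 / 2) * T
      + (2 * a * b + b2 * a + b1 * b + c2 - (g3 / 2) ^ 2 - g1 * g5 / 2) * T ^ 2
      + (b ^ 2 + b2 * b + b3 * a + c3 - g3 * g5 / 2) * T ^ 3
      + (b3 * b + c4 - (g5 / 2) ^ 2) * T ^ 4) = 0 := by
    intro T
    obtain ⟨τ, rfl⟩ : ∃ τ, T = τ ^ 2 := by
      obtain ⟨τ, hτ⟩ := IsAlgClosed.exists_pow_nat_eq T (n := 2) (by norm_num)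
      exact ⟨τ, hτ.symm⟩
    have := hev τ
    simp only [Bf, Cf] at this
    linear_combination this / 4
  obtain ⟨h0, h1, h2, h3, h4⟩ := five_zero key
  intro x y
  simp only [Bf, Cf]
  linear_combination x ^ 4 * h0 + x ^ 3 * y * h1 + x ^ 2 * y ^ 2 * h2 + x * y ^ 3 * h3 + y ^ 4 * h4

theorem sol_inj (hp : b3 * ∏ i, σ i = b0) (h3 : b3 ≠ 0) (hσ0 : ∀ i, σ i ≠ 0)
    (hσ : Function.Injective fun i => σ i ^ 2) :
    Set.InjOn (fun e => (((Ge b3 σ e).coeff 2 - b1) / 2, ((Ge b3 σ e).coeff 4 - b2) / 2))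
      (SignSet : Set (Fin 6 → ℤˣ)) := by
  intro e he e' he' h
  simp only [Prod.mk.injEq] at h
  have h2 : (Ge b3 σ e).coeff 2 = (Ge b3 σ e').coeff 2 := by linear_combination 2 * h.1
  have h4 : (Ge b3 σ e).coeff 4 = (Ge b3 σ e').coeff 4 := by linear_combination 2 * h.2
  have he1 := (Finset.mem_filter.1 he).2
  have he2 := (Finset.mem_filter.1 he').2
  have h0 : (Ge b3 σ e).coeff 0 = (Ge b3 σ e').coeff 0 := by
    rw [Ge_coeff0 hp, Ge_coeff0 hp, he1.2, he2.2]
  have h6 : (Ge b3 σ e).coeff 6 = (Ge b3 σ e').coeff 6 := by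
    rw [Ge_coeff6, Ge_coeff6]
  have hroot : ∀ i, (Ge b3 σ e).eval (((e i : ℤ) : ℂ) * σ i) = 0 := fun i => by
    rw [Ge, eval_mul, eval_prod, Finset.prod_eq_zero (Finset.mem_univ i)] <;> simp
  have hroot' : ∀ x, (Ge b3 σ e').eval x = 0 → ∃ j, x = ((e' j : ℤ) : ℂ) * σ j := fun x hx => by
    rw [Ge, eval_mul, eval_prod, eval_C, mul_eq_zero, Finset.prod_eq_zero_iff] at hx
    obtain ⟨j, _, hj⟩ := hx.resolve_left h3
    refine ⟨j, ?_⟩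
    simpa [sub_eq_zero] using hj
  have hsq : ∀ u : ℤˣ, ((u : ℤ) : ℂ) ^ 2 = 1 := fun u => by
    rcases unit_cast u with h | h <;> rw [h] <;> norm_num
  have hdich : (∀ τ, (Ge b3 σ e).eval τ = (Ge b3 σ e').eval τ) ∨
      (∀ τ, (Ge b3 σ e).eval τ = (Ge b3 σ e').eval (-τ)) := by
    have hO : (C ((Ge b3 σ e).coeff 1) * X + C ((Ge b3 σ e).coeff 3) * X ^ 3
        + C ((Ge b3 σ e).coeff 5) * X ^ 5) ^ 2 = (C ((Ge b3 σ e').coeff 1) * X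
        + C ((Ge b3 σ e').coeff 3) * X ^ 3 + C ((Ge b3 σ e').coeff 5) * X ^ 5) ^ 2 := by
      apply Polynomial.funext
      intro τ
      have h7 := (Ge_eval b3 σ e τ).trans (Ge_eval b3 σ e' τ).symm
      simp only [eval_seven (Ge_natDegree b3 σ _), h0, h2, h4, h6] at h7
      simp only [eval_pow, eval_add, eval_mul, eval_C, eval_X]
      linear_combination -h7
    rcases sq_eq_sq_iff_eq_or_eq_neg.1 hO with h | h
    · left
      intro τ
      have := congrArg (eval τ) h
      simp only [eval_pow, eval_add, eval_mul, eval_C, eval_X] at this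
      simp only [eval_seven (Ge_natDegree b3 σ _), h0, h2, h4, h6]
      linear_combination this
    · right
      intro τ
      have := congrArg (eval τ) h
      simp only [eval_pow, eval_add, eval_mul, eval_C, eval_X, eval_neg] at this
      simp only [eval_seven (Ge_natDegree b3 σ _), h0, h2, h4, h6]
      linear_combination this
  rcases hdich with hd | hd
  · funext i
    obtain ⟨j, hj⟩ := hroot' _ ((hd _).symm.trans (hroot i))
    have : i = j := hσ (by
      have h8 := congrArg (· ^ 2) hj
      simp only [mul_pow, hsq, one_mul] at h8
      exact h8)
    subst this
    have h9 := mul_right_cancel₀ (hσ0 i) hj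
    exact Units.ext (by exact_mod_cast h9)
  · exfalso
    obtain ⟨j, hj⟩ := hroot' _ ((hd _).symm.trans (hroot 0))
    have : 0 = j := hσ (by
      have h8 := congrArg (· ^ 2) hj
      simp only [neg_sq, mul_pow, hsq, one_mul] at h8
      exact h8)
    subst this
    rw [he1.1, he2.1] at hj
    apply hσ0 0
    simp at hj
    linear_combination (-1/2) * hj

theorem sol_surj (hp : b3 * ∏ i, σ i = b0) (hb0 : b0 ≠ 0) (hσ0 : ∀ i, σ i ≠ 0)
    (hσ : Function.Injective fun i => σ i ^ 2)
    (hD : ∀ T, Bf b0 b1 b2 b3 1 T ^ 2 - 4 * T * Cf c0 c1 c2 c3 c4 1 T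
      = b3 ^ 2 * ∏ i, (T - σ i ^ 2)) {a b : ℂ} (h : (a, b) ∈ Sol b0 b1 b2 b3 c0 c1 c2 c3 c4) :
    ∃ e ∈ SignSet, (((Ge b3 σ e).coeff 2 - b1) / 2, ((Ge b3 σ e).coeff 4 - b2) / 2) = (a, b) := by
  obtain ⟨s0, s1, s2, h⟩ := h
  simp only at h
  have hsq : ∀ u : ℤˣ, ((u : ℤ) : ℂ) ^ 2 = 1 := fun u => by
    rcases unit_cast u with h | h <;> rw [h] <;> norm_num
  -- the polynomial attached to a solution and a sign
  let G : ℂ → ℂ[X] := fun κ => C b0 + C (-2 * κ * s0) * X + C (b1 + 2 * a) * X ^ 2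
    + C (-2 * κ * s1) * X ^ 3 + C (b2 + 2 * b) * X ^ 4 + C (-2 * κ * s2) * X ^ 5 + C b3 * X ^ 6
  have hGdeg : ∀ κ, (G κ).natDegree ≤ 6 := fun κ => by
    simp only [G]; compute_degree
  have hGev : ∀ κ τ, (G κ).eval τ = b0 + (-2 * κ * s0) * τ + (b1 + 2 * a) * τ ^ 2
    + (-2 * κ * s1) * τ ^ 3 + (b2 + 2 * b) * τ ^ 4 + (-2 * κ * s2) * τ ^ 5 + b3 * τ ^ 6 := by
    intro κ τ; simp [G]
  have hG0 : ∀ κ, (G κ).coeff 0 = b0 := fun κ => by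
    simp [G, coeff_X, coeff_C, coeff_X_pow, -map_mul, -map_add, -map_neg, coeff_C_mul]
  have hG2 : ∀ κ, (G κ).coeff 2 = b1 + 2 * a := fun κ => by
    simp [G, coeff_X, coeff_C, coeff_X_pow, -map_mul, -map_add, -map_neg, coeff_C_mul]
  have hG4 : ∀ κ, (G κ).coeff 4 = b2 + 2 * b := fun κ => by
    simp [G, coeff_X, coeff_C, coeff_X_pow, -map_mul, -map_add, -map_neg, coeff_C_mul]
  have hG6 : ∀ κ, (G κ).coeff 6 = b3 := fun κ => by
    simp [G, coeff_X, coeff_C, coeff_X_pow, -map_mul, -map_add, -map_neg, coeff_C_mul]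
  have hprod : ∀ κ, κ ^ 2 = 1 → ∀ τ, (G κ).eval τ * (G κ).eval (-τ)
      = b3 ^ 2 * ∏ i, (τ ^ 2 - σ i ^ 2) := by
    intro κ hκ τ
    rw [← hD, hGev, hGev]
    have := h 1 (τ ^ 2)
    simp only [Bf, Cf] at this ⊢
    linear_combination 4 * τ ^ 2 * this - 4 * τ ^ 2 * (s0 + s1 * τ ^ 2 + s2 * τ ^ 4) ^ 2 * hκ
  have hroot : ∀ κ, κ ^ 2 = 1 → ∀ i, ∃ u : ℤˣ, (G κ).eval (((u : ℤ) : ℂ) * σ i) = 0 := by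
    intro κ hκ i
    have := hprod κ hκ (σ i)
    rw [Finset.prod_eq_zero (Finset.mem_univ i) (sub_self _), mul_zero, mul_eq_zero] at this
    rcases this with h | h
    · exact ⟨1, by simpa using h⟩
    · exact ⟨-1, by simpa using h⟩
  have hfin : ∀ κ, κ ^ 2 = 1 → (G κ).eval (σ 0) = 0 → ∃ e ∈ SignSet,
      (((Ge b3 σ e).coeff 2 - b1) / 2, ((Ge b3 σ e).coeff 4 - b2) / 2) = (a, b) := by
    intro κ hκ hκ0
    choose e he using hroot κ hκ
    have hupd : ∀ i, (G κ).eval (((Function.update e 0 1 i : ℤˣ) : ℤ) * σ i) = 0 := by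
      intro i
      by_cases hi : i = 0
      · subst hi; simpa using hκ0
      · rw [Function.update_of_ne hi]; exact he i
    set e' := Function.update e 0 1 with he'
    have hG : G κ = Ge b3 σ e' := by
      refine signs (hGdeg κ) (hG6 κ) _ ?_ hupd
      intro i j hij
      apply hσ
      have h8 := congrArg (· ^ 2) hij
      simp only [mul_pow, hsq, one_mul] at h8
      exact h8
    refine ⟨e', ?_, ?_⟩
    · refine Finset.mem_filter.2 ⟨Finset.mem_univ _, by simp [he'], ?_⟩
      have h1 := Ge_coeff0 hp e'
      rw [← hG, hG0] at h1
      have h2 : (((∏ i, e' i : ℤˣ) : ℤ) : ℂ) = 1 := by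
        apply mul_right_cancel₀ hb0
        rw [← h1, one_mul]
      exact Units.ext (Int.cast_injective (α := ℂ) (by rw [h2]; simp))
    · rw [← hG, hG2, hG4]
      ext <;> simp
  obtain ⟨u, hu⟩ := hroot 1 (by norm_num) 0
  rcases Int.units_eq_one_or u with rfl | rfl
  · exact hfin 1 (by norm_num) (by simpa using hu)
  · refine hfin (-1) (by norm_num) ?_
    rw [hGev] at hu ⊢
    simp at hu
    linear_combination hu

theorem sol_count_aux (hp : b3 * ∏ i, σ i = b0) (hb0 : b0 ≠ 0) (h3 : b3 ≠ 0) (hσ0 : ∀ i, σ i ≠ 0)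
    (hσ : Function.Injective fun i => σ i ^ 2)
    (hD : ∀ T, Bf b0 b1 b2 b3 1 T ^ 2 - 4 * T * Cf c0 c1 c2 c3 c4 1 T
      = b3 ^ 2 * ∏ i, (T - σ i ^ 2)) :
    (Sol b0 b1 b2 b3 c0 c1 c2 c3 c4).Finite ∧ (Sol b0 b1 b2 b3 c0 c1 c2 c3 c4).ncard = 16 := by
  have : Sol b0 b1 b2 b3 c0 c1 c2 c3 c4 =
      (fun e => (((Ge b3 σ e).coeff 2 - b1) / 2, ((Ge b3 σ e).coeff 4 - b2) / 2)) ''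
      (SignSet : Set (Fin 6 → ℤˣ)) := by
    ext ⟨a, b⟩
    constructor
    · intro h
      obtain ⟨e, he, h⟩ := sol_surj hp hb0 hσ0 hσ hD h
      exact ⟨e, he, h⟩
    · rintro ⟨e, he, h⟩
      rw [← h]
      exact sol_mem hp hD he
  rw [this]
  refine ⟨SignSet.finite_toSet.image _, ?_⟩
  rw [(sol_inj hp h3 hσ0 hσ).ncard_image, Set.ncard_coe_finset, card_SignSet]

end core


section core2
variable {b0 b1 b2 b3 c0 c1 c2 c3 c4 : ℂ}

theorem sol_count (hb0 : b0 ≠ 0) (hb3 : b3 ≠ 0)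
    (hsing : ∀ w t k0 k1 k2 e0 e1 e2 : ℂ, b0 = -t * k0 → b1 = k0 - t * k1 - 2 * w →
      b2 = k1 - t * k2 → b3 = k2 → c0 = t ^ 2 * e0 + w * t * k0 →
      c1 = w ^ 2 - w * (k0 - t * k1) - 2 * t * e0 + t ^ 2 * e1 →
      c2 = -w * (k1 - t * k2) + e0 - 2 * t * e1 + t ^ 2 * e2 →
      c3 = -w * k2 + e1 - 2 * t * e2 → c4 = e2 → False) :
    (Sol b0 b1 b2 b3 c0 c1 c2 c3 c4).Finite ∧ (Sol b0 b1 b2 b3 c0 c1 c2 c3 c4).ncard = 16 := by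
  let Bp : ℂ[X] := C b0 + C b1 * X + C b2 * X ^ 2 + C b3 * X ^ 3
  let Cp : ℂ[X] := C c0 + C c1 * X + C c2 * X ^ 2 + C c3 * X ^ 3 + C c4 * X ^ 4
  let Dp : ℂ[X] := Bp ^ 2 - C 4 * X * Cp
  have hDev : ∀ T, Dp.eval T = Bf b0 b1 b2 b3 1 T ^ 2 - 4 * T * Cf c0 c1 c2 c3 c4 1 T := by
    intro T
    simp [Dp, Bp, Cp, Bf, Cf]
  have hDder : ∀ T, (derivative Dp).eval T = 2 * (b0 + b1 * T + b2 * T ^ 2 + b3 * T ^ 3) *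
      (b1 + 2 * b2 * T + 3 * b3 * T ^ 2)
      - 4 * (c0 + 2 * c1 * T + 3 * c2 * T ^ 2 + 4 * c3 * T ^ 3 + 5 * c4 * T ^ 4) := by
    intro T
    simp [Dp, Bp, Cp, derivative_pow]
    ring
  have hD6 : Dp.coeff 6 = b3 ^ 2 := by
    have : Dp = C (b0 ^ 2) + C (2 * b0 * b1 - 4 * c0) * X
        + C (b1 ^ 2 + 2 * b0 * b2 - 4 * c1) * X ^ 2
        + C (2 * b0 * b3 + 2 * b1 * b2 - 4 * c2) * X ^ 3
        + C (b2 ^ 2 + 2 * b1 * b3 - 4 * c3) * X ^ 4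
        + C (2 * b2 * b3 - 4 * c4) * X ^ 5 + C (b3 ^ 2) * X ^ 6 := by
      apply Polynomial.funext
      intro T
      simp [Dp, Bp, Cp]
      ring
    rw [this]
    simp [coeff_X, coeff_C, coeff_X_pow, -map_mul, -map_add, -map_neg, -map_sub, -map_pow,
      coeff_C_mul]
  have hDdeg : Dp.natDegree = 6 := by
    apply natDegree_eq_of_le_of_coeff_ne_zero
    · simp only [Dp, Bp, Cp]; compute_degree
    · rw [hD6]; exact pow_ne_zero _ hb3
  have hD0 : Dp ≠ 0 := by
    intro h; rw [h] at hDdeg; simp at hDdeg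
  have hnodup : Dp.roots.Nodup := by
    rw [Multiset.nodup_iff_count_le_one]
    intro t
    rw [count_roots]
    by_contra hlt
    push Not at hlt
    obtain ⟨h1, h2⟩ := (one_lt_rootMultiplicity_iff_isRoot hD0).1 hlt
    rw [IsRoot.def] at h1 h2
    rw [hDev] at h1
    rw [hDder] at h2
    simp only [Bf, Cf] at h1
    have ht : t ≠ 0 := by
      rintro rfl
      apply hb0
      simpa using h1
    obtain ⟨w, hw⟩ : ∃ w, b0 + b1 * t + b2 * t ^ 2 + b3 * t ^ 3 + 2 * t * w = 0 :=
      ⟨-(b0 + b1 * t + b2 * t ^ 2 + b3 * t ^ 3) / (2 * t), by field_simp; ring⟩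
    -- value and derivative of the translated constant term
    have hC : (c0 + w * b0) + (c1 + w * b1 + w ^ 2) * t + (c2 + w * b2) * t ^ 2
        + (c3 + w * b3) * t ^ 3 + c4 * t ^ 4 = 0 := by
      have : 4 * t * ((c0 + w * b0) + (c1 + w * b1 + w ^ 2) * t + (c2 + w * b2) * t ^ 2
        + (c3 + w * b3) * t ^ 3 + c4 * t ^ 4) = 0 := by
        linear_combination -h1 +
          (b0 + b1 * t + b2 * t ^ 2 + b3 * t ^ 3 + 2 * t * w) * hw
      exact (mul_eq_zero.1 this).resolve_left (by simp [ht])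
    have hC' : (c1 + w * b1 + w ^ 2) + 2 * (c2 + w * b2) * t
        + 3 * (c3 + w * b3) * t ^ 2 + 4 * c4 * t ^ 3 = 0 := by
      have : 4 * t * ((c1 + w * b1 + w ^ 2) + 2 * (c2 + w * b2) * t
        + 3 * (c3 + w * b3) * t ^ 2 + 4 * c4 * t ^ 3) = 0 := by
        linear_combination -h2 - 4 * hC +
          2 * (b1 + 2 * b2 * t + 3 * b3 * t ^ 2 + 2 * w) * hw
      exact (mul_eq_zero.1 this).resolve_left (by simp [ht])
    refine hsing w t (b1 + 2 * w + t * (b2 + t * b3)) (b2 + t * b3) b3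
      ((c2 + w * b2) - t ^ 2 * c4 + 2 * t * ((c3 + w * b3) + 2 * t * c4))
      ((c3 + w * b3) + 2 * t * c4) c4 ?_ ?_ ?_ rfl ?_ ?_ ?_ ?_ rfl
    · linear_combination hw
    · ring
    · ring
    · linear_combination hC - t * hC' - w * hw
    · linear_combination hC'
    · ring
    · ring
  have hcard : Multiset.card Dp.roots = 6 := by
    rw [← hDdeg]; exact (IsAlgClosed.splits Dp).natDegree_eq_card_roots.symm
  have hfact : Dp = C (b3 ^ 2) * (Dp.roots.map fun a => X - C a).prod := by
    have := (IsAlgClosed.splits Dp).eq_prod_roots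
    rwa [leadingCoeff, hDdeg, hD6] at this
  have hfc : Dp.roots.toFinset.card = 6 := by
    rw [Multiset.toFinset_card_of_nodup hnodup, hcard]
  let eqv := Dp.roots.toFinset.equivFinOfCardEq hfc
  let ρ : Fin 6 → ℂ := fun i => (eqv.symm i : ℂ)
  have hρinj : Function.Injective ρ := Subtype.val_injective.comp eqv.symm.injective
  have hprod : ∀ T, Dp.eval T = b3 ^ 2 * ∏ i, (T - ρ i) := by
    intro T
    have h1 : (Dp.roots.map fun a => X - C a).prod = ∏ a ∈ Dp.roots.toFinset, (X - C a) := by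
      rw [Finset.prod, Multiset.toFinset_val, hnodup.dedup]
    have h2 : ∏ i, (T - ρ i) = ∏ a ∈ Dp.roots.toFinset, (T - a) := by
      rw [← Finset.prod_coe_sort Dp.roots.toFinset (fun a => T - a)]
      exact Fintype.prod_equiv eqv.symm _ _ (fun i => rfl)
    conv_lhs => rw [hfact]
    rw [h1, eval_mul, eval_prod, h2]
    simp
  have hsq : ∀ i, ∃ z : ℂ, z ^ 2 = ρ i := fun i => IsAlgClosed.exists_pow_nat_eq _ (by norm_num)
  choose σ hσ using hsq
  have hρ0 : b3 ^ 2 * ∏ i, ρ i = b0 ^ 2 := by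
    have h := hprod 0
    rw [hDev] at h
    simp [Bf, Cf, Fin.prod_univ_six] at h
    rw [h, Fin.prod_univ_six]
  have hfinal : ∀ σ : Fin 6 → ℂ, (∀ i, σ i ^ 2 = ρ i) → b3 * ∏ i, σ i = b0 →
      (Sol b0 b1 b2 b3 c0 c1 c2 c3 c4).Finite ∧
        (Sol b0 b1 b2 b3 c0 c1 c2 c3 c4).ncard = 16 := by
    intro σ hσ hp
    refine sol_count_aux hp hb0 hb3 ?_ ?_ ?_
    · intro i hi
      apply hb0
      rw [← hp, Finset.prod_eq_zero (Finset.mem_univ i) hi, mul_zero]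
    · intro i j hij
      simp only [hσ] at hij
      exact hρinj hij
    · intro T
      simp only [hσ]
      rw [← hDev, hprod]
  have hpm : (b3 * ∏ i, σ i) ^ 2 = b0 ^ 2 := by
    rw [mul_pow, ← Finset.prod_pow, ← hρ0]
    simp only [hσ]
  rcases sq_eq_sq_iff_eq_or_eq_neg.1 hpm with h | h
  · exact hfinal σ hσ h
  · refine hfinal (fun i => if i = 0 then -σ 0 else σ i) ?_ ?_
    · intro i
      by_cases hi : i = 0
      · subst hi; simp [hσ]
      · simp [hi, hσ]
    · rw [Fin.prod_univ_six] at h ⊢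
      simp
      linear_combination -h

end core2

section geometry

def qf (b0 b1 b2 b3 c0 c1 c2 c3 c4 x y z : ℂ) : ℂ :=
  x * y * z ^ 2 + Bf b0 b1 b2 b3 x y * z + Cf c0 c1 c2 c3 c4 x y

/-- The derivative of `qf` at `v` in direction `w`. -/
def dqf (b0 b1 b2 b3 c0 c1 c2 c3 c4 v0 v1 v2 w0 w1 w2 : ℂ) : ℂ :=
  w0 * v1 * v2 ^ 2 + v0 * w1 * v2 ^ 2 + 2 * v0 * v1 * v2 * w2
    + (3 * b0 * v0 ^ 2 * w0 + b1 * (2 * v0 * w0 * v1 + v0 ^ 2 * w1)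
      + b2 * (w0 * v1 ^ 2 + 2 * v0 * v1 * w1) + 3 * b3 * v1 ^ 2 * w1) * v2
    + Bf b0 b1 b2 b3 v0 v1 * w2
    + 4 * c0 * v0 ^ 3 * w0 + c1 * (3 * v0 ^ 2 * w0 * v1 + v0 ^ 3 * w1)
    + c2 * (2 * v0 * w0 * v1 ^ 2 + 2 * v0 ^ 2 * v1 * w1)
    + c3 * (w0 * v1 ^ 3 + 3 * v0 * v1 ^ 2 * w1) + 4 * c4 * v1 ^ 3 * w1

theorem qf_expand (b0 b1 b2 b3 c0 c1 c2 c3 c4 v0 v1 v2 w0 w1 w2 : ℂ) :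
    ∃ p2 : ℂ, ∀ s t : ℂ,
      qf b0 b1 b2 b3 c0 c1 c2 c3 c4 (s * v0 + t * w0) (s * v1 + t * w1) (s * v2 + t * w2) =
      qf b0 b1 b2 b3 c0 c1 c2 c3 c4 v0 v1 v2 * s ^ 4
      + dqf b0 b1 b2 b3 c0 c1 c2 c3 c4 v0 v1 v2 w0 w1 w2 * s ^ 3 * t
      + p2 * s ^ 2 * t ^ 2
      + dqf b0 b1 b2 b3 c0 c1 c2 c3 c4 w0 w1 w2 v0 v1 v2 * s * t ^ 3
      + qf b0 b1 b2 b3 c0 c1 c2 c3 c4 w0 w1 w2 * t ^ 4 := by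
  refine ⟨qf b0 b1 b2 b3 c0 c1 c2 c3 c4 (v0 + w0) (v1 + w1) (v2 + w2)
    - qf b0 b1 b2 b3 c0 c1 c2 c3 c4 v0 v1 v2
    - dqf b0 b1 b2 b3 c0 c1 c2 c3 c4 v0 v1 v2 w0 w1 w2
    - dqf b0 b1 b2 b3 c0 c1 c2 c3 c4 w0 w1 w2 v0 v1 v2
    - qf b0 b1 b2 b3 c0 c1 c2 c3 c4 w0 w1 w2, fun s t => ?_⟩
  simp only [qf, dqf, Bf, Cf]
  ring

theorem eval_linePoly (F : MvPolynomial (Fin 3) ℂ) (v w : Fin 3 → ℂ) (t : ℂ) :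
    (linePoly F v w).eval t = MvPolynomial.eval (v + t • w) F := by
  rw [linePoly, MvPolynomial.aeval_def, ← coe_evalRingHom, MvPolynomial.hom_eval₂,
    MvPolynomial.eval, MvPolynomial.coe_eval₂Hom]
  congr 1
  · ext <;> simp
  · funext i
    simp only [coe_evalRingHom, eval_add, eval_mul, eval_X, eval_C, Pi.add_apply, Pi.smul_apply,
      smul_eq_mul]

variable {b0 b1 b2 b3 c0 c1 c2 c3 c4 : ℂ}

theorem contact_iff {F : MvPolynomial (Fin 3) ℂ} {g : (Fin 3 → ℂ) ≃ₗ[ℂ] (Fin 3 → ℂ)}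
    (hF : ∀ x y z, MvPolynomial.eval (g ![x, y, z]) F = qf b0 b1 b2 b3 c0 c1 c2 c3 c4 x y z)
    (v0 v1 v2 w0 w1 w2 : ℂ) :
    ContactLE F (g ![v0, v1, v2]) (g ![w0, w1, w2]) 2 ↔
      qf b0 b1 b2 b3 c0 c1 c2 c3 c4 v0 v1 v2 = 0 ∧
      dqf b0 b1 b2 b3 c0 c1 c2 c3 c4 v0 v1 v2 w0 w1 w2 = 0 := by
  obtain ⟨p2, hp⟩ := qf_expand b0 b1 b2 b3 c0 c1 c2 c3 c4 v0 v1 v2 w0 w1 w2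
  have : linePoly F (g ![v0, v1, v2]) (g ![w0, w1, w2]) =
      C (qf b0 b1 b2 b3 c0 c1 c2 c3 c4 v0 v1 v2)
      + C (dqf b0 b1 b2 b3 c0 c1 c2 c3 c4 v0 v1 v2 w0 w1 w2) * X + C p2 * X ^ 2
      + C (dqf b0 b1 b2 b3 c0 c1 c2 c3 c4 w0 w1 w2 v0 v1 v2) * X ^ 3
      + C (qf b0 b1 b2 b3 c0 c1 c2 c3 c4 w0 w1 w2) * X ^ 4 := by
    apply Polynomial.funext
    intro t
    rw [eval_linePoly, ← map_smul, ← map_add]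
    have h1 := hp 1 t
    rw [← hF] at h1
    have h2 : (![v0, v1, v2] + t • ![w0, w1, w2] : Fin 3 → ℂ) =
        ![1 * v0 + t * w0, 1 * v1 + t * w1, 1 * v2 + t * w2] := by
      ext i; fin_cases i <;> simp
    rw [h2, h1]
    simp
  rw [ContactLE, X_pow_dvd_iff, this]
  constructor
  · intro h
    have h0 := h 0 (by norm_num)
    have h1 := h 1 (by norm_num)
    simp [coeff_X, coeff_C, coeff_X_pow] at h0 h1
    exact ⟨h0, h1⟩
  · rintro ⟨h0, h1⟩ d hd
    rw [h0, h1]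
    interval_cases d <;> simp [coeff_X, coeff_C, coeff_X_pow]

def Wab (g : (Fin 3 → ℂ) ≃ₗ[ℂ] (Fin 3 → ℂ)) (p : ℂ × ℂ) : Submodule ℂ (Fin 3 → ℂ) :=
  Submodule.span ℂ {g ![1, 0, p.1], g ![0, 1, p.2]}

theorem mem_Wab (g : (Fin 3 → ℂ) ≃ₗ[ℂ] (Fin 3 → ℂ)) (p : ℂ × ℂ) (x y z : ℂ) :
    g ![x, y, z] ∈ Wab g p ↔ z = p.1 * x + p.2 * y := by
  rw [Wab, Submodule.mem_span_pair]
  constructor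
  · rintro ⟨s, t, h⟩
    rw [← map_smul, ← map_smul, ← map_add] at h
    have h' := g.injective h
    have h0 := congrFun h' 0
    have h1 := congrFun h' 1
    have h2 := congrFun h' 2
    simp at h0 h1 h2
    rw [← h0, ← h1, ← h2]; ring
  · intro h
    refine ⟨x, y, ?_⟩
    rw [← map_smul, ← map_smul, ← map_add]
    congr 1
    ext i; fin_cases i <;> simp [h]
    ring

theorem Wab_inj (g : (Fin 3 → ℂ) ≃ₗ[ℂ] (Fin 3 → ℂ)) : Function.Injective (Wab g) := by
  intro p p' h
  have h1 := (mem_Wab g p 1 0 p.1).2 (by ring)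
  have h2 := (mem_Wab g p 0 1 p.2).2 (by ring)
  rw [h, mem_Wab] at h1 h2
  ext
  · simpa using h1
  · simpa using h2

theorem indep_iff (g : (Fin 3 → ℂ) ≃ₗ[ℂ] (Fin 3 → ℂ)) (v w : Fin 3 → ℂ) :
    LinearIndependent ℂ ![g v, g w] ↔ ∀ s t : ℂ, s • v + t • w = 0 → s = 0 ∧ t = 0 := by
  rw [LinearIndependent.pair_iff]
  simp only [← map_smul, ← map_add, LinearEquiv.map_eq_zero_iff]

theorem finrank_Wab (g : (Fin 3 → ℂ) ≃ₗ[ℂ] (Fin 3 → ℂ)) (p : ℂ × ℂ) :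
    Module.finrank ℂ (Wab g p) = 2 := by
  have h : LinearIndependent ℂ ![g ![1, 0, p.1], g ![0, 1, p.2]] := by
    rw [indep_iff]
    intro s t h
    have h0 := congrFun h 0
    have h1 := congrFun h 1
    simp at h0 h1
    exact ⟨h0, h1⟩
  have := finrank_span_eq_card h
  have hs : Set.range ![g ![1, 0, p.1], g ![0, 1, p.2]] = {g ![1, 0, p.1], g ![0, 1, p.2]} := by
    ext u
    simp only [Set.mem_range, Fin.exists_fin_two, Set.mem_insert_iff, Set.mem_singleton_iff]
    constructor
    · rintro (h | h)
      · exact Or.inl h.symm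
      · exact Or.inr h.symm
    · rintro (h | h)
      · exact Or.inl h.symm
      · exact Or.inr h.symm
  rw [hs] at this
  exact this

theorem exists_vec (v : Fin 3 → ℂ) : ∃ x y z, v = ![x, y, z] :=
  ⟨v 0, v 1, v 2, by ext i; fin_cases i <;> rfl⟩

theorem quad_zeros {s0 s1 s2 : ℂ} (h : s1 ^ 2 - 4 * s0 * s2 ≠ 0) :
    ∃ v0 v1 w0 w1 : ℂ, v0 * w1 - v1 * w0 ≠ 0 ∧ s0 * v0 ^ 2 + s1 * v0 * v1 + s2 * v1 ^ 2 = 0 ∧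
      s0 * w0 ^ 2 + s1 * w0 * w1 + s2 * w1 ^ 2 = 0 := by
  by_cases hs : s0 = 0
  · subst hs
    have : s1 ≠ 0 := by rintro rfl; simp at h
    exact ⟨1, 0, -s2, s1, by simpa using this, by ring, by ring⟩
  · obtain ⟨d, hd⟩ := IsAlgClosed.exists_pow_nat_eq (s1 ^ 2 - 4 * s0 * s2) (n := 2) (by norm_num)
    have hd0 : d ≠ 0 := by rintro rfl; apply h; rw [← hd]; norm_num
    refine ⟨-s1 + d, 2 * s0, -s1 - d, 2 * s0, ?_, ?_, ?_⟩
    · have : (-s1 + d) * (2 * s0) - 2 * s0 * (-s1 - d) = 4 * s0 * d := by ring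
      rw [this]; simp [hs, hd0]
    · linear_combination s0 * hd
    · linear_combination s0 * hd

theorem quad_square {s0 s1 s2 : ℂ} (h : s1 ^ 2 - 4 * s0 * s2 = 0) :
    ∃ m0 m1 : ℂ, ∀ x y : ℂ, s0 * x ^ 2 + s1 * x * y + s2 * y ^ 2 = (m0 * x + m1 * y) ^ 2 := by
  by_cases hs : s0 = 0
  · subst hs
    have : s1 = 0 := by simpa using h
    subst this
    obtain ⟨m, hm⟩ := IsAlgClosed.exists_pow_nat_eq s2 (n := 2) (by norm_num)
    exact ⟨0, m, fun x y => by rw [← hm]; ring⟩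
  · obtain ⟨m, hm⟩ := IsAlgClosed.exists_pow_nat_eq s0 (n := 2) (by norm_num)
    have hm0 : m ≠ 0 := by rintro rfl; apply hs; rw [← hm]; norm_num
    refine ⟨m, s1 / (2 * m), fun x y => ?_⟩
    field_simp
    linear_combination (-4 * m ^ 2 * x ^ 2) * hm - y ^ 2 * h + 4 * s2 * y ^ 2 * hm

theorem bitangent_sets {F : MvPolynomial (Fin 3) ℂ} {g : (Fin 3 → ℂ) ≃ₗ[ℂ] (Fin 3 → ℂ)}
    {q : Fin 3 → ℂ} (hg : g ![0, 0, 1] = q)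
    (hF : ∀ x y z, MvPolynomial.eval (g ![x, y, z]) F = qf b0 b1 b2 b3 c0 c1 c2 c3 c4 x y z)
    (hb0 : b0 ≠ 0) (hb3 : b3 ≠ 0)
    (hyper : ∀ a b m0 m1 : ℂ, ¬ ∀ x y : ℂ,
      qf b0 b1 b2 b3 c0 c1 c2 c3 c4 x y (a * x + b * y) = (m0 * x + m1 * y) ^ 4) :
    properBitangentLines F q = Wab g '' Sol b0 b1 b2 b3 c0 c1 c2 c3 c4 := by
  subst hg
  ext W
  constructor
  · rintro ⟨hW, v, w, hvW, hwW, hvw, hvq, hwq, hcv, hcw⟩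
    obtain ⟨v, rfl⟩ := g.surjective v
    obtain ⟨w, rfl⟩ := g.surjective w
    obtain ⟨v0, v1, v2, rfl⟩ := exists_vec v
    obtain ⟨w0, w1, w2, rfl⟩ := exists_vec w
    rw [contact_iff hF] at hcv hcw
    obtain ⟨p2, hp⟩ := qf_expand b0 b1 b2 b3 c0 c1 c2 c3 c4 v0 v1 v2 w0 w1 w2
    simp only [hcv.1, hcv.2, hcw.1, hcw.2, zero_mul, zero_add, add_zero] at hp
    have hvw' := (indep_iff _ _ _).1 hvw
    have hvq' := (indep_iff _ _ _).1 hvq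
    have hwq' := (indep_iff _ _ _).1 hwq
    have hv01 : v0 ≠ 0 ∨ v1 ≠ 0 := by
      by_contra hcon
      push Not at hcon
      have := hvq' 1 (-v2) (by ext i; fin_cases i <;> simp [hcon])
      simp at this
    have hw01 : w0 ≠ 0 ∨ w1 ≠ 0 := by
      by_contra hcon
      push Not at hcon
      have := hwq' 1 (-w2) (by ext i; fin_cases i <;> simp [hcon])
      simp at this
    by_cases hdet : v0 * w1 - v1 * w0 = 0
    · exfalso
      obtain ⟨k, hk0, hk1⟩ : ∃ k, w0 = k * v0 ∧ w1 = k * v1 := by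
        rcases hv01 with h | h
        · refine ⟨w0 / v0, by field_simp, ?_⟩
          field_simp
          linear_combination hdet
        · refine ⟨w1 / v1, ?_, by field_simp⟩
          field_simp
          linear_combination -hdet
      have hk : k ≠ 0 := by
        rintro rfl
        simp at hk0 hk1
        simp [hk0, hk1] at hw01
      have hz : w2 - k * v2 ≠ 0 := by
        intro hz
        have := hvw' (-k) 1 (by
          ext i; fin_cases i <;> simp [hk0, hk1]
          linear_combination hz)
        simp at this
      have hp20 : p2 = 0 := by
        have := hp (-k) 1
        rw [hk0, hk1] at this
        simp [qf, Bf, Cf, hk] at this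
        exact this
      have hall : ∀ z, qf b0 b1 b2 b3 c0 c1 c2 c3 c4 v0 v1 z = 0 := by
        intro z
        have h := hp (1 - k * ((z - v2) / (w2 - k * v2))) ((z - v2) / (w2 - k * v2))
        rw [hp20, zero_mul, zero_mul] at h
        rw [← h]
        congr 1
        · rw [hk0]; ring
        · rw [hk1]; ring
        · field_simp; ring
      have h0 := hall 0
      have h1 := hall 1
      have h2 := hall (-1)
      simp only [qf] at h0 h1 h2
      have hA : v0 * v1 = 0 := by linear_combination (h1 + h2 - 2 * h0) / 2
      have hB : Bf b0 b1 b2 b3 v0 v1 = 0 := by linear_combination (h1 - h2) / 2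
      rcases mul_eq_zero.1 hA with h | h
      · simp [Bf, h, hb3] at hB
        simp [h, hB] at hv01
      · simp [Bf, h, hb0] at hB
        simp [h, hB] at hv01
    · obtain ⟨a, b, ha, hb⟩ : ∃ a b, v2 = a * v0 + b * v1 ∧ w2 = a * w0 + b * w1 := by
        refine ⟨(v2 * w1 - w2 * v1) / (v0 * w1 - v1 * w0),
          (v0 * w2 - w0 * v2) / (v0 * w1 - v1 * w0), ?_, ?_⟩
        · rw [div_mul_eq_mul_div, div_mul_eq_mul_div, ← add_div, eq_div_iff hdet]; ring
        · rw [div_mul_eq_mul_div, div_mul_eq_mul_div, ← add_div, eq_div_iff hdet]; ring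
      refine ⟨(a, b), ?_, ?_⟩
      · obtain ⟨m, hm⟩ := IsAlgClosed.exists_pow_nat_eq p2 (n := 2) (by norm_num)
        set δ := v0 * w1 - v1 * w0 with hδ
        refine ⟨m / δ ^ 2 * (-w1 * v1), m / δ ^ 2 * (w1 * v0 + w0 * v1), m / δ ^ 2 * (-w0 * v0),
          fun x y => ?_⟩
        have h := hp ((x * w1 - y * w0) / δ) ((y * v0 - x * v1) / δ)
        have e0 : (x * w1 - y * w0) / δ * v0 + (y * v0 - x * v1) / δ * w0 = x := by
          field_simp; rw [hδ]; ring
        have e1 : (x * w1 - y * w0) / δ * v1 + (y * v0 - x * v1) / δ * w1 = y := by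
          field_simp; rw [hδ]; ring
        have e2 : (x * w1 - y * w0) / δ * v2 + (y * v0 - x * v1) / δ * w2 = a * x + b * y := by
          rw [ha, hb]
          linear_combination a * e0 + b * e1
        rw [e0, e1, e2, ← hm] at h
        simp only [qf] at h
        rw [h]
        field_simp
        ring
      · symm
        have hle : ∀ V : Submodule ℂ (Fin 3 → ℂ), Module.finrank ℂ V = 2 →
            g ![v0, v1, v2] ∈ V → g ![w0, w1, w2] ∈ V →
            V = Submodule.span ℂ (Set.range ![g ![v0, v1, v2], g ![w0, w1, w2]]) := by
          intro V hV h1 h2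
          symm
          apply Submodule.eq_of_le_of_finrank_eq
          · rw [Submodule.span_le]
            rintro _ ⟨i, rfl⟩
            fin_cases i
            · exact h1
            · exact h2
          · rw [hV, finrank_span_eq_card hvw]; simp
        rw [hle W hW hvW hwW, ← hle _ (finrank_Wab g (a, b)) ((mem_Wab _ _ _ _ _).2 ha)
          ((mem_Wab _ _ _ _ _).2 hb)]
  · rintro ⟨⟨a, b⟩, ⟨s0, s1, s2, hS⟩, rfl⟩
    simp only at hS
    refine ⟨finrank_Wab _ _, ?_⟩
    have hdisc : s1 ^ 2 - 4 * s0 * s2 ≠ 0 := by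
      intro h
      obtain ⟨m0, m1, hm⟩ := quad_square h
      apply hyper a b m0 m1
      intro x y
      rw [qf, hS, hm]; ring
    obtain ⟨v0, v1, w0, w1, hdet, hv, hw⟩ := quad_zeros hdisc
    have hx : ∀ v0 v1 w0 w1, v0 * w1 - v1 * w0 ≠ 0 → ∀ v2 w2 : ℂ,
        LinearIndependent ℂ ![g ![v0, v1, v2], g ![w0, w1, w2]] := by
      intro v0 v1 w0 w1 hdet v2 w2
      rw [indep_iff]
      intro s t h
      have h0 := congrFun h 0
      have h1 := congrFun h 1
      simp at h0 h1
      constructor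
      · refine (mul_eq_zero.1 (?_ : s * (v0 * w1 - v1 * w0) = 0)).resolve_right hdet
        linear_combination w1 * h0 - w0 * h1
      · refine (mul_eq_zero.1 (?_ : t * (v0 * w1 - v1 * w0) = 0)).resolve_right hdet
        linear_combination v0 * h1 - v1 * h0
    have hxq : ∀ v0 v1 v2 : ℂ, (v0 ≠ 0 ∨ v1 ≠ 0) →
        LinearIndependent ℂ ![g ![v0, v1, v2], g ![0, 0, 1]] := by
      intro v0 v1 v2 hv
      rw [indep_iff]
      intro s t h
      have h0 := congrFun h 0
      have h1 := congrFun h 1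
      have h2 := congrFun h 2
      simp at h0 h1 h2
      have hs : s = 0 := by tauto
      refine ⟨hs, ?_⟩
      simpa [hs] using h2
    have hcontact : ∀ v0 v1 w0 w1 : ℂ, s0 * v0 ^ 2 + s1 * v0 * v1 + s2 * v1 ^ 2 = 0 →
        s0 * w0 ^ 2 + s1 * w0 * w1 + s2 * w1 ^ 2 = 0 →
        ContactLE F (g ![v0, v1, a * v0 + b * v1]) (g ![w0, w1, a * w0 + b * w1]) 2 := by
      intro v0 v1 w0 w1 hv hw
      refine ⟨C ((2 * s0 * v0 * w0 + s1 * (v0 * w1 + v1 * w0) + 2 * s2 * v1 * w1) ^ 2), ?_⟩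
      apply Polynomial.funext
      intro t
      rw [eval_linePoly, ← map_smul, ← map_add]
      have h2 : (![v0, v1, a * v0 + b * v1] + t • ![w0, w1, a * w0 + b * w1] : Fin 3 → ℂ) =
        ![v0 + t * w0, v1 + t * w1, a * (v0 + t * w0) + b * (v1 + t * w1)] := by
        ext i; fin_cases i <;> simp
        ring
      rw [h2, hF, qf, hS]
      have : s0 * (v0 + t * w0) ^ 2 + s1 * (v0 + t * w0) * (v1 + t * w1)
          + s2 * (v1 + t * w1) ^ 2 =
          t * (2 * s0 * v0 * w0 + s1 * (v0 * w1 + v1 * w0) + 2 * s2 * v1 * w1) := by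
        linear_combination hv + t ^ 2 * hw
      rw [this]
      simp only [eval_mul, eval_pow, eval_X, eval_C]
      ring
    refine ⟨g ![v0, v1, a * v0 + b * v1], g ![w0, w1, a * w0 + b * w1],
      (mem_Wab _ _ _ _ _).2 rfl, (mem_Wab _ _ _ _ _).2 rfl, hx _ _ _ _ hdet _ _,
      hxq _ _ _ ?_, hxq _ _ _ ?_, hcontact _ _ _ _ hv hw, hcontact _ _ _ _ hw hv⟩
    · by_contra hcon
      push Not at hcon
      simp [hcon] at hdet
    · by_contra hcon
      push Not at hcon
      simp [hcon] at hdet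

end geometry

section coordinates

/-- Linear change of variables. -/
def lsub (g : (Fin 3 → ℂ) →ₗ[ℂ] (Fin 3 → ℂ)) : MvPolynomial (Fin 3) ℂ →ₐ[ℂ] MvPolynomial (Fin 3) ℂ :=
  MvPolynomial.aeval fun i => ∑ j, MvPolynomial.C (g (Pi.single j 1) i) * MvPolynomial.X j

theorem g_expand (g : (Fin 3 → ℂ) →ₗ[ℂ] (Fin 3 → ℂ)) (v : Fin 3 → ℂ) (i : Fin 3) :
    g v i = ∑ j, g (Pi.single j 1) i * v j := by
  conv_lhs => rw [pi_eq_sum_univ' v]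
  rw [map_sum, Finset.sum_apply]
  refine Finset.sum_congr rfl fun j _ => ?_
  rw [map_smul, Pi.smul_apply, smul_eq_mul, mul_comm]

theorem eval_lsub (g : (Fin 3 → ℂ) →ₗ[ℂ] (Fin 3 → ℂ)) (F : MvPolynomial (Fin 3) ℂ)
    (v : Fin 3 → ℂ) : MvPolynomial.eval v (lsub g F) = MvPolynomial.eval (g v) F := by
  induction F using MvPolynomial.induction_on with
  | C a => simp [lsub]
  | add p q hp hq => rw [map_add, map_add, map_add, hp, hq]
  | mul_X p i hp =>
    rw [map_mul, map_mul, map_mul, hp, MvPolynomial.eval_X, g_expand]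
    simp [lsub]

theorem lsub_homog (g : (Fin 3 → ℂ) →ₗ[ℂ] (Fin 3 → ℂ)) {F : MvPolynomial (Fin 3) ℂ} {n : ℕ}
    (hF : F.IsHomogeneous n) : (lsub g F).IsHomogeneous n := by
  have := hF.aeval (fun i => ∑ j, MvPolynomial.C (g (Pi.single j 1) i) * MvPolynomial.X j)
    (n := 1) (fun i => MvPolynomial.IsHomogeneous.sum _ _ _ fun j _ => by
      simpa using (MvPolynomial.isHomogeneous_C (Fin 3) (g (Pi.single j 1) i)).mul
        (MvPolynomial.isHomogeneous_X ℂ j))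
  rw [one_mul] at this
  exact this

theorem pderiv_lsub (g : (Fin 3 → ℂ) →ₗ[ℂ] (Fin 3 → ℂ)) (F : MvPolynomial (Fin 3) ℂ)
    (v : Fin 3 → ℂ) (i : Fin 3) :
    MvPolynomial.eval v (MvPolynomial.pderiv i (lsub g F)) =
      ∑ j, g (Pi.single i 1) j * MvPolynomial.eval (g v) (MvPolynomial.pderiv j F) := by
  induction F using MvPolynomial.induction_on with
  | C a => simp [lsub]
  | add p q hp hq =>
    simp only [map_add, hp, hq, mul_add, Finset.sum_add_distrib]
  | mul_X p k hp =>
    have hX : lsub g (MvPolynomial.X k) =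
        ∑ j, MvPolynomial.C (g (Pi.single j 1) k) * MvPolynomial.X j := by simp [lsub]
    have h1 : MvPolynomial.eval v (MvPolynomial.pderiv i (lsub g (MvPolynomial.X k))) =
        g (Pi.single i 1) k := by
      rw [hX]
      simp [MvPolynomial.pderiv_X, Pi.single_apply, apply_ite (MvPolynomial.eval v)]
    rw [map_mul, MvPolynomial.pderiv_mul, map_add, map_mul, map_mul, hp, h1, eval_lsub, eval_lsub]
    simp only [MvPolynomial.pderiv_mul, map_add, map_mul, MvPolynomial.eval_X,
      MvPolynomial.pderiv_X, mul_add, Finset.sum_add_distrib]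
    congr 1
    · rw [Finset.sum_mul]
      exact Finset.sum_congr rfl fun j _ => by ring
    · simp [Pi.single_apply, apply_ite (MvPolynomial.eval (g v))]
      ring

/-- exponent vector -/
def mon (i j k : ℕ) : Fin 3 →₀ ℕ := Finsupp.equivFunOnFinite.symm ![i, j, k]

def pairs : Finset (ℕ × ℕ) := (Finset.range 5 ×ˢ Finset.range 5).filter fun p => p.1 + p.2 ≤ 4

def monS : Finset (Fin 3 →₀ ℕ) := pairs.image fun p => mon p.1 p.2 (4 - p.1 - p.2)

theorem support_monS {F : MvPolynomial (Fin 3) ℂ} (hF : F.IsHomogeneous 4) : F.support ⊆ monS := by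
  intro d hd
  have h := hF (MvPolynomial.mem_support_iff.1 hd)
  rw [Finsupp.weight_apply, Finsupp.sum_fintype _ _ (by simp)] at h
  simp [Fin.sum_univ_three] at h
  refine Finset.mem_image.2 ⟨(d 0, d 1), ?_, ?_⟩
  · simp [pairs]; omega
  · ext i
    fin_cases i <;> simp [mon]
    omega

theorem as_monS {F : MvPolynomial (Fin 3) ℂ} (hF : F.IsHomogeneous 4) :
    F = ∑ d ∈ monS, MvPolynomial.monomial d (MvPolynomial.coeff d F) := by
  conv_lhs => rw [F.as_sum]
  refine Finset.sum_subset (support_monS hF) fun d _ hd => ?_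
  rw [MvPolynomial.notMem_support_iff.1 hd, MvPolynomial.monomial_zero]

theorem as_explicit {F : MvPolynomial (Fin 3) ℂ} (hF : F.IsHomogeneous 4) :
    F = ∑ p ∈ pairs, MvPolynomial.C (MvPolynomial.coeff (mon p.1 p.2 (4 - p.1 - p.2)) F) *
      (MvPolynomial.X 0 ^ p.1 * MvPolynomial.X 1 ^ p.2 * MvPolynomial.X 2 ^ (4 - p.1 - p.2)) := by
  conv_lhs => rw [as_monS hF]
  rw [monS, Finset.sum_image]
  · refine Finset.sum_congr rfl fun p _ => ?_
    rw [MvPolynomial.monomial_eq, Finsupp.prod_fintype _ _ (by simp)]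
    simp [Fin.prod_univ_three, mon]
  · intro p _ p' _ h
    have h0 := DFunLike.congr_fun h 0
    have h1 := DFunLike.congr_fun h 1
    simp [mon] at h0 h1
    exact Prod.ext h0 h1

theorem pairs_eq : pairs = {(0, 0), (0, 1), (0, 2), (0, 3), (0, 4), (1, 0), (1, 1), (1, 2), (1, 3),
    (2, 0), (2, 1), (2, 2), (3, 0), (3, 1), (4, 0)} := by decide

/-- General quartic with a double point at `[0:0:1]`. -/
def gen (c : Fin 12 → ℂ) (x y z : ℂ) : ℂ :=
  (c 0 * x ^ 2 + c 1 * x * y + c 2 * y ^ 2) * z ^ 2 + Bf (c 3) (c 4) (c 5) (c 6) x y * z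
    + Cf (c 7) (c 8) (c 9) (c 10) (c 11) x y

def midx : Fin 12 → (Fin 3 →₀ ℕ) := ![mon 2 0 2, mon 1 1 2, mon 0 2 2,
  mon 3 0 1, mon 2 1 1, mon 1 2 1, mon 0 3 1,
  mon 4 0 0, mon 3 1 0, mon 2 2 0, mon 1 3 0, mon 0 4 0]

theorem nodal_form {H : MvPolynomial (Fin 3) ℂ} (hH : H.IsHomogeneous 4)
    (hp : ∀ i, MvPolynomial.eval ![0, 0, 1] (MvPolynomial.pderiv i H) = 0) (x y z : ℂ) :
    MvPolynomial.eval ![x, y, z] H = gen (fun j => MvPolynomial.coeff (midx j) H) x y z := by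
  have h := as_explicit hH
  rw [pairs_eq] at h
  simp at h
  have h0 := hp 0
  have h1 := hp 1
  have h2 := hp 2
  rw [h] at h0 h1 h2
  simp [MvPolynomial.pderiv_X, Pi.single_apply] at h0 h1 h2
  conv_lhs => rw [h]
  simp [h0, h1, h2, gen, Bf, Cf, midx]
  ring

theorem five_zero' {p0 p1 p2 p3 p4 : ℂ}
    (h : ∀ T : ℂ, (p0 + p1 * T + p2 * T ^ 2 + p3 * T ^ 3 + p4 * T ^ 4) = 0) :
    p0 = 0 ∧ p1 = 0 ∧ p2 = 0 ∧ p3 = 0 ∧ p4 = 0 :=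
  five_zero fun T => by rw [h T, mul_zero]

theorem gen_inj {c c' : Fin 12 → ℂ} (h : ∀ x y z, gen c x y z = gen c' x y z) : c = c' := by
  have hA := five_zero' (p0 := c 0 - c' 0) (p1 := c 1 - c' 1) (p2 := c 2 - c' 2) (p3 := 0)
    (p4 := 0) (fun T => by
      have h0 := h 1 T 0
      have h1 := h 1 T 1
      have h2 := h 1 T (-1)
      simp only [gen, Bf, Cf] at h0 h1 h2
      linear_combination (h1 + h2 - 2 * h0) / 2)
  have hB := five_zero' (p0 := c 3 - c' 3) (p1 := c 4 - c' 4) (p2 := c 5 - c' 5)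
    (p3 := c 6 - c' 6) (p4 := 0) (fun T => by
      have h1 := h 1 T 1
      have h2 := h 1 T (-1)
      simp only [gen, Bf, Cf] at h1 h2
      linear_combination (h1 - h2) / 2)
  have hC := five_zero' (p0 := c 7 - c' 7) (p1 := c 8 - c' 8) (p2 := c 9 - c' 9)
    (p3 := c 10 - c' 10) (p4 := c 11 - c' 11) (fun T => by
      have h0 := h 1 T 0
      simp only [gen, Bf, Cf] at h0
      linear_combination h0)
  simp only [sub_eq_zero] at hA hB hC
  funext i
  fin_cases i <;> simp [hA, hB, hC]

/-- The quartic form with given coefficients. -/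
def genPoly (c : Fin 12 → ℂ) : MvPolynomial (Fin 3) ℂ :=
  ∑ j, MvPolynomial.monomial (midx j) (c j)

theorem genPoly_homog (c : Fin 12 → ℂ) : (genPoly c).IsHomogeneous 4 := by
  refine MvPolynomial.IsHomogeneous.sum _ _ _ fun j _ => ?_
  apply MvPolynomial.isHomogeneous_monomial
  rw [Finsupp.degree_eq_sum]
  fin_cases j <;> simp [midx, mon, Fin.sum_univ_three]

theorem midx_inj : Function.Injective midx := by
  intro i j h
  have h0 := DFunLike.congr_fun h 0
  have h1 := DFunLike.congr_fun h 1
  revert h0 h1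
  clear h
  simp only [midx, mon]
  revert i j
  decide

theorem genPoly_coeff (c : Fin 12 → ℂ) : (fun j => MvPolynomial.coeff (midx j) (genPoly c)) = c := by
  funext j
  simp [genPoly, MvPolynomial.coeff_sum, MvPolynomial.coeff_monomial, midx_inj.eq_iff]

theorem genPoly_pderiv (c : Fin 12 → ℂ) (i : Fin 3) :
    MvPolynomial.eval ![0, 0, 1] (MvPolynomial.pderiv i (genPoly c)) = 0 := by
  rw [genPoly, map_sum, map_sum]
  refine Finset.sum_eq_zero fun j _ => ?_
  rw [MvPolynomial.pderiv_monomial, MvPolynomial.eval_monomial, Finsupp.prod_fintype _ _ (by simp)]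
  fin_cases j <;> fin_cases i <;> simp [midx, mon, Fin.prod_univ_three]

theorem exists_coords {q : Fin 3 → ℂ} (hq : q ≠ 0) :
    ∃ g : (Fin 3 → ℂ) ≃ₗ[ℂ] (Fin 3 → ℂ), g ![0, 0, 1] = q := by
  have he : (![0, 0, 1] : Fin 3 → ℂ) ≠ 0 := fun h => by simpa using congrFun h 2
  let e := LinearEquiv.toSpanNonzeroSingleton ℂ (Fin 3 → ℂ) ![0, 0, 1] he
  let f := e.symm.trans (LinearEquiv.toSpanNonzeroSingleton ℂ (Fin 3 → ℂ) q hq)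
  obtain ⟨g, hg⟩ := Submodule.exists_linearEquiv_restrict_eq f
  refine ⟨g, ?_⟩
  have h := hg (e 1)
  have h1 : ((f (e 1) : _) : Fin 3 → ℂ) = q := by
    simp [f]
  have h2 : ((e 1 : _) : Fin 3 → ℂ) = ![0, 0, 1] := by
    simp [e]
  rw [h1, h2] at h
  exact h.symm

/-- Coefficients after a linear change of variables are polynomial in the coefficients. -/
theorem coeff_poly (g : (Fin 3 → ℂ) →ₗ[ℂ] (Fin 3 → ℂ)) (m : Fin 3 →₀ ℕ) :
    ∃ P : MvPolynomial (Fin 3 →₀ ℕ) ℂ, ∀ F : MvPolynomial (Fin 3) ℂ, F.IsHomogeneous 4 →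
      MvPolynomial.eval (coeffs1 F) P = MvPolynomial.coeff m (lsub g F) := by
  refine ⟨∑ d ∈ monS, MvPolynomial.C (MvPolynomial.coeff m (lsub g (MvPolynomial.monomial d 1))) *
    MvPolynomial.X d, fun F hF => ?_⟩
  conv_rhs => rw [as_monS hF]
  rw [map_sum, map_sum, MvPolynomial.coeff_sum]
  refine Finset.sum_congr rfl fun d _ => ?_
  have : MvPolynomial.monomial d (MvPolynomial.coeff d F) =
      MvPolynomial.coeff d F • (MvPolynomial.monomial d 1 : MvPolynomial (Fin 3) ℂ) := by
    rw [MvPolynomial.smul_monomial, smul_eq_mul, mul_one]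
  rw [this, map_smul, MvPolynomial.coeff_smul]
  simp [coeffs1, mul_comm]

end coordinates

section assembly

/-- Coefficients of a nodal quartic in terms of its normal form. -/
def Tn {R : Type} [CommRing R] (α r s b0 b1 b2 b3 c0 c1 c2 c3 c4 : R) : Fin 12 → R :=
  let p := α
  let q := -(α * r)
  let u : R := 1
  let v := -s
  ![α, -(α * (r + s)), α * r * s,
    b0 * p ^ 3 + b1 * p ^ 2 * u + b2 * p * u ^ 2 + b3 * u ^ 3,
    3 * b0 * p ^ 2 * q + b1 * (p ^ 2 * v + 2 * p * q * u) + b2 * (2 * p * u * v + q * u ^ 2)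
      + 3 * b3 * u ^ 2 * v,
    3 * b0 * p * q ^ 2 + b1 * (2 * p * q * v + q ^ 2 * u) + b2 * (p * v ^ 2 + 2 * q * u * v)
      + 3 * b3 * u * v ^ 2,
    b0 * q ^ 3 + b1 * q ^ 2 * v + b2 * q * v ^ 2 + b3 * v ^ 3,
    c0 * p ^ 4 + c1 * p ^ 3 * u + c2 * p ^ 2 * u ^ 2 + c3 * p * u ^ 3 + c4 * u ^ 4,
    4 * c0 * p ^ 3 * q + c1 * (p ^ 3 * v + 3 * p ^ 2 * q * u)
      + c2 * (2 * p ^ 2 * u * v + 2 * p * q * u ^ 2) + c3 * (3 * p * u ^ 2 * v + q * u ^ 3)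
      + 4 * c4 * u ^ 3 * v,
    6 * c0 * p ^ 2 * q ^ 2 + c1 * (3 * p ^ 2 * q * v + 3 * p * q ^ 2 * u)
      + c2 * (p ^ 2 * v ^ 2 + 4 * p * q * u * v + q ^ 2 * u ^ 2)
      + c3 * (3 * p * u * v ^ 2 + 3 * q * u ^ 2 * v) + 6 * c4 * u ^ 2 * v ^ 2,
    4 * c0 * p * q ^ 3 + c1 * (3 * p * q ^ 2 * v + q ^ 3 * u)
      + c2 * (2 * p * q * v ^ 2 + 2 * q ^ 2 * u * v) + c3 * (p * v ^ 3 + 3 * q * u * v ^ 2)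
      + 4 * c4 * u * v ^ 3,
    c0 * q ^ 4 + c1 * q ^ 3 * v + c2 * q ^ 2 * v ^ 2 + c3 * q * v ^ 3 + c4 * v ^ 4]

theorem Tn_map {R S : Type} [CommRing R] [CommRing S] (f : R →+* S)
    (α r s b0 b1 b2 b3 c0 c1 c2 c3 c4 : R) :
    (fun i => f (Tn α r s b0 b1 b2 b3 c0 c1 c2 c3 c4 i)) =
      Tn (f α) (f r) (f s) (f b0) (f b1) (f b2) (f b3) (f c0) (f c1) (f c2) (f c3) (f c4) := by
  funext i
  fin_cases i <;> simp [Tn, map_ofNat]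

theorem gen_Tn (α r s b0 b1 b2 b3 c0 c1 c2 c3 c4 x y z : ℂ) :
    gen (Tn α r s b0 b1 b2 b3 c0 c1 c2 c3 c4) x y z =
      qf b0 b1 b2 b3 c0 c1 c2 c3 c4 (α * (x - r * y)) (x - s * y) z := by
  simp [gen, Tn, qf, Bf, Cf]
  ring

theorem Bf_sub (b0 b1 b2 b3 p q u v : ℂ) : ∃ d0 d1 d2 d3 : ℂ, ∀ x y,
    Bf b0 b1 b2 b3 (p * x + q * y) (u * x + v * y) = Bf d0 d1 d2 d3 x y :=
  ⟨b0 * p ^ 3 + b1 * p ^ 2 * u + b2 * p * u ^ 2 + b3 * u ^ 3,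
    3 * b0 * p ^ 2 * q + b1 * (p ^ 2 * v + 2 * p * q * u) + b2 * (2 * p * u * v + q * u ^ 2)
      + 3 * b3 * u ^ 2 * v,
    3 * b0 * p * q ^ 2 + b1 * (2 * p * q * v + q ^ 2 * u) + b2 * (p * v ^ 2 + 2 * q * u * v)
      + 3 * b3 * u * v ^ 2,
    b0 * q ^ 3 + b1 * q ^ 2 * v + b2 * q * v ^ 2 + b3 * v ^ 3, fun x y => by
      simp only [Bf]; ring⟩

theorem Cf_sub (c0 c1 c2 c3 c4 p q u v : ℂ) : ∃ d0 d1 d2 d3 d4 : ℂ, ∀ x y,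
    Cf c0 c1 c2 c3 c4 (p * x + q * y) (u * x + v * y) = Cf d0 d1 d2 d3 d4 x y :=
  ⟨c0 * p ^ 4 + c1 * p ^ 3 * u + c2 * p ^ 2 * u ^ 2 + c3 * p * u ^ 3 + c4 * u ^ 4,
    4 * c0 * p ^ 3 * q + c1 * (p ^ 3 * v + 3 * p ^ 2 * q * u)
      + c2 * (2 * p ^ 2 * u * v + 2 * p * q * u ^ 2) + c3 * (3 * p * u ^ 2 * v + q * u ^ 3)
      + 4 * c4 * u ^ 3 * v,
    6 * c0 * p ^ 2 * q ^ 2 + c1 * (3 * p ^ 2 * q * v + 3 * p * q ^ 2 * u)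
      + c2 * (p ^ 2 * v ^ 2 + 4 * p * q * u * v + q ^ 2 * u ^ 2)
      + c3 * (3 * p * u * v ^ 2 + 3 * q * u ^ 2 * v) + 6 * c4 * u ^ 2 * v ^ 2,
    4 * c0 * p * q ^ 3 + c1 * (3 * p * q ^ 2 * v + q ^ 3 * u)
      + c2 * (2 * p * q * v ^ 2 + 2 * q ^ 2 * u * v) + c3 * (p * v ^ 3 + 3 * q * u * v ^ 2)
      + 4 * c4 * u * v ^ 3,
    c0 * q ^ 4 + c1 * q ^ 3 * v + c2 * q ^ 2 * v ^ 2 + c3 * q * v ^ 3 + c4 * v ^ 4, fun x y => by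
      simp only [Cf]; ring⟩

theorem normal_form {c : Fin 12 → ℂ} (h0 : c 0 ≠ 0) (hd : c 1 ^ 2 - 4 * c 0 * c 2 ≠ 0) :
    ∃ α r s b0 b1 b2 b3 c0 c1 c2 c3 c4 : ℂ, α ≠ 0 ∧ s - r ≠ 0 ∧
      c = Tn α r s b0 b1 b2 b3 c0 c1 c2 c3 c4 := by
  obtain ⟨δ, hδ⟩ := IsAlgClosed.exists_pow_nat_eq (c 1 ^ 2 - 4 * c 0 * c 2) (n := 2) (by norm_num)
  have hδ0 : δ ≠ 0 := fun h => hd (by rw [← hδ, h]; ring)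
  obtain ⟨α, hα⟩ : ∃ α, α = c 0 := ⟨_, rfl⟩
  obtain ⟨r, hr⟩ : ∃ r, r = (-c 1 - δ) / (2 * c 0) := ⟨_, rfl⟩
  obtain ⟨s, hs⟩ : ∃ s, s = (-c 1 + δ) / (2 * c 0) := ⟨_, rfl⟩
  have hα0 : α ≠ 0 := hα ▸ h0
  have hsr : s - r ≠ 0 := by
    have : s - r = δ / c 0 := by rw [hs, hr]; field_simp; ring
    rw [this]
    exact div_ne_zero hδ0 h0
  have e1 : c 1 = -(α * (r + s)) := by rw [hα, hr, hs]; field_simp; ring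
  have e2 : c 2 = α * r * s := by
    rw [hα, hr, hs]; field_simp
    linear_combination hδ
  obtain ⟨b0, b1, b2, b3, hb⟩ := Bf_sub (c 3) (c 4) (c 5) (c 6) (s / (α * (s - r)))
    (1 - s / (s - r)) (1 / (α * (s - r))) (-1 / (s - r))
  obtain ⟨c0, c1, c2, c3, c4, hc⟩ := Cf_sub (c 7) (c 8) (c 9) (c 10) (c 11) (s / (α * (s - r)))
    (1 - s / (s - r)) (1 / (α * (s - r))) (-1 / (s - r))
  refine ⟨α, r, s, b0, b1, b2, b3, c0, c1, c2, c3, c4, hα0, hsr, gen_inj fun x y z => ?_⟩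
  rw [gen_Tn, qf, ← hb, ← hc]
  have hx : s / (α * (s - r)) * (α * (x - r * y)) + (1 - s / (s - r)) * (x - s * y) = x := by
    field_simp; ring
  have hy : 1 / (α * (s - r)) * (α * (x - r * y)) + -1 / (s - r) * (x - s * y) = y := by
    field_simp; ring
  rw [hx, hy, gen, e1, e2, ← hα]
  ring

/-- The change of coordinates splitting the tangent cone. -/
def Neq (α r s : ℂ) (hα : α ≠ 0) (hs : s - r ≠ 0) : (Fin 3 → ℂ) ≃ₗ[ℂ] (Fin 3 → ℂ) where
  toFun v := ![α * (v 0 - r * v 1), v 0 - s * v 1, v 2]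
  invFun v := ![v 1 + s * ((v 0 / α - v 1) / (s - r)), (v 0 / α - v 1) / (s - r), v 2]
  map_add' v w := by
    ext i; fin_cases i <;> simp <;> ring
  map_smul' a v := by
    ext i; fin_cases i <;> simp <;> ring
  left_inv v := by
    ext i; fin_cases i <;> simp <;> field_simp <;> ring
  right_inv v := by
    ext i; fin_cases i <;> simp <;> field_simp <;> ring

theorem bad_poly1 : ∃ P : MvPolynomial (Fin 12) ℂ, P ≠ 0 ∧
    ∀ α r s b1 b2 b3 c0 c1 c2 c3 c4 : ℂ,
      MvPolynomial.eval (Tn α r s 0 b1 b2 b3 c0 c1 c2 c3 c4) P = 0 := by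
  obtain ⟨P, hP, h⟩ := alg_dep (Tn (MvPolynomial.X 0) (MvPolynomial.X 1) (MvPolynomial.X 2) 0
    (MvPolynomial.X 3) (MvPolynomial.X 4) (MvPolynomial.X 5) (MvPolynomial.X 6)
    (MvPolynomial.X 7) (MvPolynomial.X 8) (MvPolynomial.X 9) (MvPolynomial.X 10))
  refine ⟨P, hP, fun α r s b1 b2 b3 c0 c1 c2 c3 c4 => ?_⟩
  have h1 := h ![α, r, s, b1, b2, b3, c0, c1, c2, c3, c4]
  rw [Tn_map] at h1
  simpa using h1

theorem bad_poly2 : ∃ P : MvPolynomial (Fin 12) ℂ, P ≠ 0 ∧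
    ∀ α r s b0 b1 b2 c0 c1 c2 c3 c4 : ℂ,
      MvPolynomial.eval (Tn α r s b0 b1 b2 0 c0 c1 c2 c3 c4) P = 0 := by
  obtain ⟨P, hP, h⟩ := alg_dep (Tn (MvPolynomial.X 0) (MvPolynomial.X 1) (MvPolynomial.X 2)
    (MvPolynomial.X 3) (MvPolynomial.X 4) (MvPolynomial.X 5) 0 (MvPolynomial.X 6)
    (MvPolynomial.X 7) (MvPolynomial.X 8) (MvPolynomial.X 9) (MvPolynomial.X 10))
  refine ⟨P, hP, fun α r s b0 b1 b2 c0 c1 c2 c3 c4 => ?_⟩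
  have h1 := h ![α, r, s, b0, b1, b2, c0, c1, c2, c3, c4]
  rw [Tn_map] at h1
  simpa using h1

/-- The family of normal forms with a further singular point. -/
def sing_fam {R : Type} [CommRing R] (α r s w t k0 k1 k2 e0 e1 e2 : R) : Fin 12 → R :=
  Tn α r s (-t * k0) (k0 - t * k1 - 2 * w) (k1 - t * k2) k2 (t ^ 2 * e0 + w * t * k0)
    (w ^ 2 - w * (k0 - t * k1) - 2 * t * e0 + t ^ 2 * e1)
    (-w * (k1 - t * k2) + e0 - 2 * t * e1 + t ^ 2 * e2) (-w * k2 + e1 - 2 * t * e2) e2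

theorem bad_poly3 : ∃ P : MvPolynomial (Fin 12) ℂ, P ≠ 0 ∧
    ∀ α r s w t k0 k1 k2 e0 e1 e2 : ℂ,
      MvPolynomial.eval (sing_fam α r s w t k0 k1 k2 e0 e1 e2) P = 0 := by
  obtain ⟨P, hP, h⟩ := alg_dep (sing_fam (MvPolynomial.X 0) (MvPolynomial.X 1) (MvPolynomial.X 2)
    (MvPolynomial.X 3) (MvPolynomial.X 4) (MvPolynomial.X 5) (MvPolynomial.X 6)
    (MvPolynomial.X 7) (MvPolynomial.X 8) (MvPolynomial.X 9) (MvPolynomial.X 10))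
  refine ⟨P, hP, fun α r s w t k0 k1 k2 e0 e1 e2 => ?_⟩
  have h1 := h ![α, r, s, w, t, k0, k1, k2, e0, e1, e2]
  rw [sing_fam, Tn_map] at h1
  rw [sing_fam]
  simpa using h1

/-- The family of normal forms with a hyperflex. -/
def hyp_fam {R : Type} [CommRing R] (α r s a b m0 m1 b0 b1 b2 b3 : R) : Fin 12 → R :=
  Tn α r s b0 b1 b2 b3 (m0 ^ 4 - b0 * a) (4 * m0 ^ 3 * m1 - a ^ 2 - b0 * b - b1 * a)
    (6 * m0 ^ 2 * m1 ^ 2 - 2 * a * b - b1 * b - b2 * a)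
    (4 * m0 * m1 ^ 3 - b ^ 2 - b2 * b - b3 * a) (m1 ^ 4 - b3 * b)

theorem bad_poly4 : ∃ P : MvPolynomial (Fin 12) ℂ, P ≠ 0 ∧
    ∀ α r s a b m0 m1 b0 b1 b2 b3 : ℂ,
      MvPolynomial.eval (hyp_fam α r s a b m0 m1 b0 b1 b2 b3) P = 0 := by
  obtain ⟨P, hP, h⟩ := alg_dep (hyp_fam (MvPolynomial.X 0) (MvPolynomial.X 1) (MvPolynomial.X 2)
    (MvPolynomial.X 3) (MvPolynomial.X 4) (MvPolynomial.X 5) (MvPolynomial.X 6)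
    (MvPolynomial.X 7) (MvPolynomial.X 8) (MvPolynomial.X 9) (MvPolynomial.X 10))
  refine ⟨P, hP, fun α r s a b m0 m1 b0 b1 b2 b3 => ?_⟩
  have h1 := h ![α, r, s, a, b, m0, m1, b0, b1, b2, b3]
  rw [hyp_fam, Tn_map] at h1
  rw [hyp_fam]
  simpa using h1

/-- The genericity polynomial in the coefficients of the normalised form. -/
theorem good_poly : ∃ P : MvPolynomial (Fin 12) ℂ, P ≠ 0 ∧ ∀ c, MvPolynomial.eval c P ≠ 0 →
    c 0 ≠ 0 ∧ ∃ α r s b0 b1 b2 b3 c0 c1 c2 c3 c4 : ℂ, α ≠ 0 ∧ s - r ≠ 0 ∧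
      c = Tn α r s b0 b1 b2 b3 c0 c1 c2 c3 c4 ∧ b0 ≠ 0 ∧ b3 ≠ 0 ∧
      ((Sol b0 b1 b2 b3 c0 c1 c2 c3 c4).Finite ∧ (Sol b0 b1 b2 b3 c0 c1 c2 c3 c4).ncard = 16) ∧
      (∀ a b m0 m1 : ℂ, ¬ ∀ x y : ℂ,
        qf b0 b1 b2 b3 c0 c1 c2 c3 c4 x y (a * x + b * y) = (m0 * x + m1 * y) ^ 4) := by
  obtain ⟨P1, hP1, h1⟩ := bad_poly1
  obtain ⟨P2, hP2, h2⟩ := bad_poly2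
  obtain ⟨P3, hP3, h3⟩ := bad_poly3
  obtain ⟨P4, hP4, h4⟩ := bad_poly4
  have hX : (MvPolynomial.X 1 ^ 2 - 4 * MvPolynomial.X 0 * MvPolynomial.X 2 :
      MvPolynomial (Fin 12) ℂ) ≠ 0 := by
    intro h
    have := congrArg (MvPolynomial.eval (Pi.single 1 1)) h
    simp at this
  refine ⟨MvPolynomial.X 0 * (MvPolynomial.X 1 ^ 2 - 4 * MvPolynomial.X 0 * MvPolynomial.X 2) *
    P1 * P2 * P3 * P4, by
      simp only [mul_ne_zero_iff]
      exact ⟨⟨⟨⟨⟨MvPolynomial.X_ne_zero _, hX⟩, hP1⟩, hP2⟩, hP3⟩, hP4⟩, fun c hc => ?_⟩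
  simp only [map_mul, mul_ne_zero_iff] at hc
  obtain ⟨⟨⟨⟨⟨g0, gX⟩, g1⟩, g2⟩, g3⟩, g4⟩ := hc
  have g0' : c 0 ≠ 0 := by simpa using g0
  obtain ⟨α, r, s, b0, b1, b2, b3, c0, c1, c2, c3, c4, hα, hs, rfl⟩ :=
    normal_form g0' (by simpa using gX)
  have hb0 : b0 ≠ 0 := by
    rintro rfl
    exact g1 (h1 _ _ _ _ _ _ _ _ _ _ _)
  have hb3 : b3 ≠ 0 := by
    rintro rfl
    exact g2 (h2 _ _ _ _ _ _ _ _ _ _ _)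
  refine ⟨g0', α, r, s, b0, b1, b2, b3, c0, c1, c2, c3, c4, hα, hs, rfl, hb0, hb3,
    sol_count hb0 hb3 ?_, ?_⟩
  · intro w t k0 k1 k2 e0 e1 e2 f1 f2 f3 f4 f5 f6 f7 f8 f9
    refine g3 ?_
    rw [f1, f2, f3, f4, f5, f6, f7, f8, f9]
    exact h3 α r s w t k0 k1 k2 e0 e1 e2
  · intro a b m0 m1 h
    refine g4 ?_
    obtain ⟨f0, f1, f2, f3, f4⟩ := five_zero' (p0 := c0 - (m0 ^ 4 - b0 * a))
      (p1 := c1 - (4 * m0 ^ 3 * m1 - a ^ 2 - b0 * b - b1 * a))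
      (p2 := c2 - (6 * m0 ^ 2 * m1 ^ 2 - 2 * a * b - b1 * b - b2 * a))
      (p3 := c3 - (4 * m0 * m1 ^ 3 - b ^ 2 - b2 * b - b3 * a))
      (p4 := c4 - (m1 ^ 4 - b3 * b)) (fun T => by
        have := h 1 T
        simp only [qf, Bf, Cf] at this
        linear_combination this)
    rw [sub_eq_zero] at f0 f1 f2 f3 f4
    rw [f0, f1, f2, f3, f4]
    exact h4 α r s a b m0 m1 b0 b1 b2 b3

theorem eval_aeval' (e : (Fin 3 →₀ ℕ) → ℂ) (P : Fin 12 → MvPolynomial (Fin 3 →₀ ℕ) ℂ)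
    (G : MvPolynomial (Fin 12) ℂ) : MvPolynomial.eval e (MvPolynomial.aeval P G) =
      MvPolynomial.eval (fun j => MvPolynomial.eval e (P j)) G := by
  induction G using MvPolynomial.induction_on with
  | C a => simp
  | add p q hp hq => rw [map_add, map_add, map_add, hp, hq]
  | mul_X p i hp => rw [map_mul, map_mul, map_mul, hp]; simp

theorem main_aux (q : Fin 3 → ℂ) (hq : q ≠ 0) :
    ∃ Q : MvPolynomial (Fin 3 →₀ ℕ) ℂ,
      (∃ F : MvPolynomial (Fin 3) ℂ, F.IsHomogeneous 4 ∧ F ≠ 0 ∧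
          (∀ i : Fin 3, MvPolynomial.eval q (MvPolynomial.pderiv i F) = 0) ∧
          MvPolynomial.eval (coeffs1 F) Q ≠ 0) ∧
      ∀ F : MvPolynomial (Fin 3) ℂ, F.IsHomogeneous 4 → F ≠ 0 →
        (∀ i : Fin 3, MvPolynomial.eval q (MvPolynomial.pderiv i F) = 0) →
        MvPolynomial.eval (coeffs1 F) Q ≠ 0 →
          (properBitangentLines F q).Finite ∧ (properBitangentLines F q).ncard = 16 := by
  obtain ⟨g, hg⟩ := exists_coords hq
  obtain ⟨G, hG, hgood⟩ := good_poly
  choose P hP using fun j : Fin 12 => coeff_poly g.toLinearMap (midx j)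
  have hQ : ∀ F : MvPolynomial (Fin 3) ℂ, F.IsHomogeneous 4 →
      MvPolynomial.eval (coeffs1 F) (MvPolynomial.aeval P G) =
      MvPolynomial.eval (fun j => MvPolynomial.coeff (midx j) (lsub g.toLinearMap F)) G := by
    intro F hF
    have : (fun j => MvPolynomial.coeff (midx j) (lsub g.toLinearMap F)) =
        fun j => MvPolynomial.eval (coeffs1 F) (P j) := by
      funext j; rw [hP j F hF]
    rw [this]
    exact eval_aeval' _ _ _
  refine ⟨MvPolynomial.aeval P G, ?_, fun F hF _ hp hne => ?_⟩
  · obtain ⟨c, hc⟩ : ∃ c, MvPolynomial.eval c G ≠ 0 := by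
      by_contra! h
      exact hG (MvPolynomial.funext fun c => by rw [h c, map_zero])
    have hF : (lsub g.symm.toLinearMap (genPoly c)).IsHomogeneous 4 :=
      lsub_homog _ (genPoly_homog c)
    have hl : lsub g.toLinearMap (lsub g.symm.toLinearMap (genPoly c)) = genPoly c := by
      refine MvPolynomial.funext fun v => ?_
      rw [eval_lsub, eval_lsub]
      simp
    refine ⟨_, hF, ?_, ?_, ?_⟩
    · intro h
      rw [h, map_zero] at hl
      have h2 := congrFun (genPoly_coeff c) 0
      rw [← hl] at h2
      exact (hgood c hc).1 (by simpa using h2.symm)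
    · intro i
      rw [pderiv_lsub]
      refine Finset.sum_eq_zero fun j _ => ?_
      have : g.symm.toLinearMap q = ![0, 0, 1] := by rw [← hg]; simp
      rw [this, genPoly_pderiv, mul_zero]
    · rw [hQ _ hF, hl, genPoly_coeff]
      exact hc
  · rw [hQ F hF] at hne
    obtain ⟨_, α, r, s, b0, b1, b2, b3, c0, c1, c2, c3, c4, hα, hs, hc, hb0, hb3, ⟨hfin, hcard⟩,
      hyper⟩ := hgood _ hne
    have hnf := nodal_form (lsub_homog g.toLinearMap hF) (fun i => by
      rw [pderiv_lsub]
      refine Finset.sum_eq_zero fun j _ => ?_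
      have : g.toLinearMap ![0, 0, 1] = q := hg
      rw [this, hp, mul_zero])
    rw [hc] at hnf
    let N := Neq α r s hα hs
    have hg' : (N.symm.trans g) ![0, 0, 1] = q := by
      have : N.symm ![0, 0, 1] = ![0, 0, 1] := by
        rw [LinearEquiv.symm_apply_eq]
        simp [N, Neq]
      rw [LinearEquiv.trans_apply, this, hg]
    have hF' : ∀ x y z, MvPolynomial.eval ((N.symm.trans g) ![x, y, z]) F =
        qf b0 b1 b2 b3 c0 c1 c2 c3 c4 x y z := by
      intro x y z
      obtain ⟨x', y', z', hv⟩ := exists_vec (N.symm ![x, y, z])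
      have hv2 : ![x, y, z] = N ![x', y', z'] := by rw [← hv]; simp
      have e0 : x = α * (x' - r * y') := by simpa [N, Neq] using congrFun hv2 0
      have e1 : y = x' - s * y' := by simpa [N, Neq] using congrFun hv2 1
      have e2 : z = z' := by simpa [N, Neq] using congrFun hv2 2
      rw [LinearEquiv.trans_apply, hv]
      have := hnf x' y' z'
      rw [eval_lsub, gen_Tn, ← e0, ← e1, ← e2] at this
      exact e2 ▸ this
    rw [bitangent_sets hg' hF' hb0 hb3 hyper]
    refine ⟨hfin.image _, ?_⟩
    rw [Set.ncard_image_of_injective _ (Wab_inj _), hcard]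

end assembly

end helpers

/-- Fix a point `[q] ∈ ℙ²`.  A general quartic plane curve singular at `[q]` (i.e. the
zero locus of a general degree-4 form all of whose first partial derivatives vanish
at `q`) has exactly 16 lines tangent to it at two distinct points, both different
from `[q]`. -/
theorem proper_bitangents_of_general_nodal_quartic (q : Fin 3 → ℂ) (hq : q ≠ 0) :
    ∃ Q : MvPolynomial (Fin 3 →₀ ℕ) ℂ,
      (∃ F : MvPolynomial (Fin 3) ℂ, F.IsHomogeneous 4 ∧ F ≠ 0 ∧
          (∀ i : Fin 3, MvPolynomial.eval q (MvPolynomial.pderiv i F) = 0) ∧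
          MvPolynomial.eval (coeffs1 F) Q ≠ 0) ∧
      ∀ F : MvPolynomial (Fin 3) ℂ, F.IsHomogeneous 4 → F ≠ 0 →
        (∀ i : Fin 3, MvPolynomial.eval q (MvPolynomial.pderiv i F) = 0) →
        MvPolynomial.eval (coeffs1 F) Q ≠ 0 →
          (properBitangentLines F q).Finite ∧ (properBitangentLines F q).ncard = 16 := by
  exact main_aux q hq
end
end

section
/- Let d ≥ 3 be an integer. For a general pencil of plane curves of degree d over ℂ and a general line H ⊂ ℙ², the number of points p ∈ H such that the unique member C of the pencil through p is smooth at p and the tangent line to C at p has contact order at least 3 with C at p (i.e., p is a flex point of C) is exactly 6d − 6. -/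
noncomputable section

/-- The set of points `p` of `ℙ²` lying on the line `{h·y = 0}` such that the unique
member `C` of the pencil spanned by `F` and `G` passing through `p` is smooth at `p`
and the tangent line to `C` at `p` has contact order at least 3 with `C` at `p`,
i.e. `p` is a flex point of `C`.  (The tangent line at `p = [v]` is spanned by `v`
and any vector `w`, independent from `v`, annihilated by the gradient of `C` at `v`.) -/
def flexPointsOnLine (F G : MvPolynomial (Fin 3) ℂ) (h : Fin 3 → ℂ) :
    Set (Projectivization ℂ (Fin 3 → ℂ)) :=
  {p | (∑ i, h i * p.rep i) = 0 ∧
    ∃ c : Projectivization ℂ (Fin 2 → ℂ),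
      MvPolynomial.eval p.rep (pencilMember F G c) = 0 ∧
      (∀ c' : Projectivization ℂ (Fin 2 → ℂ),
        MvPolynomial.eval p.rep (pencilMember F G c') = 0 → c' = c) ∧
      (∃ i : Fin 3, MvPolynomial.eval p.rep (MvPolynomial.pderiv i (pencilMember F G c)) ≠ 0) ∧
      (∃ w : Fin 3 → ℂ, LinearIndependent ℂ ![p.rep, w] ∧
        (∑ i, MvPolynomial.eval p.rep (MvPolynomial.pderiv i (pencilMember F G c)) * w i) = 0 ∧
        ContactLE (pencilMember F G c) p.rep w 3)}


open MvPolynomial in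
def hM {A : Type*} [CommRing A] (F G : MvPolynomial (Fin 3) A) (i j : Fin 3) :
    MvPolynomial (Fin 3) A :=
  G * pderiv i (pderiv j F) - F * pderiv i (pderiv j G)

open MvPolynomial in
def hG {A : Type*} [CommRing A] (F G : MvPolynomial (Fin 3) A) (i : Fin 3) :
    MvPolynomial (Fin 3) A :=
  G * pderiv i F - F * pderiv i G

def hD {A : Type*} [CommRing A] (F G : MvPolynomial (Fin 3) A) : MvPolynomial (Fin 3) A :=
  (Matrix.of (hM F G)).det

def lineG {A : Type*} [CommRing A] (D : MvPolynomial (Fin 3) A) (a b : Fin 3 → A) :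
    Polynomial A :=
  MvPolynomial.aeval (fun i => Polynomial.C (a i) + Polynomial.X * Polynomial.C (b i)) D

def pA {A : Type*} [CommRing A] (h : Fin 3 → A) : Fin 3 → A := ![h 2, 0, - h 0]
def pB {A : Type*} [CommRing A] (h : Fin 3 → A) : Fin 3 → A := ![0, h 2, - h 1]

def flexP {A : Type*} [CommRing A] (F G : MvPolynomial (Fin 3) A) (h : Fin 3 → A) :
    Polynomial A := lineG (hD F G) (pA h) (pB h)

section naturality
variable {A B : Type*} [CommRing A] [CommRing B] (φ : A →+* B)

lemma map_hM (F G : MvPolynomial (Fin 3) A) (i j : Fin 3) :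
    MvPolynomial.map φ (hM F G i j) = hM (MvPolynomial.map φ F) (MvPolynomial.map φ G) i j := by
  simp [hM, MvPolynomial.pderiv_map]

lemma map_hD (F G : MvPolynomial (Fin 3) A) :
    MvPolynomial.map φ (hD F G) = hD (MvPolynomial.map φ F) (MvPolynomial.map φ G) := by
  rw [hD, hD, RingHom.map_det]
  congr 1
  ext1 i j
  simp [map_hM]

lemma map_lineG (D : MvPolynomial (Fin 3) A) (a b : Fin 3 → A) :
    (lineG D a b).map φ = lineG (MvPolynomial.map φ D) (φ ∘ a) (φ ∘ b) := by
  unfold lineG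
  induction D using MvPolynomial.induction_on with
  | C r => simp
  | add p q hp hq => simp [-Polynomial.X_mul_C, hp, hq]
  | mul_X p i hp => simp [-Polynomial.X_mul_C, hp]

lemma map_flexP (F G : MvPolynomial (Fin 3) A) (h : Fin 3 → A) :
    (flexP F G h).map φ = flexP (MvPolynomial.map φ F) (MvPolynomial.map φ G) (φ ∘ h) := by
  unfold flexP
  rw [map_lineG, map_hD]
  congr 1 <;> ext1 i <;> fin_cases i <;> simp [pA, pB]
end naturality

lemma eval_lineG (D : MvPolynomial (Fin 3) ℂ) (a b : Fin 3 → ℂ) (t : ℂ) :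
    (lineG D a b).eval t = MvPolynomial.eval (fun i => a i + t * b i) D := by
  unfold lineG
  induction D using MvPolynomial.induction_on with
  | C r => simp
  | add p q hp hq => simp [-Polynomial.X_mul_C, hp, hq]
  | mul_X p i hp => simp [-Polynomial.X_mul_C, hp]

lemma lineG_coeff {D : MvPolynomial (Fin 3) ℂ} {N : ℕ} (hD : D.IsHomogeneous N) (a b : Fin 3 → ℂ) :
    (lineG D a b).natDegree ≤ N ∧ (lineG D a b).coeff N = MvPolynomial.eval b D := by
  have hlin : ∀ i, (Polynomial.C (a i) + Polynomial.X * Polynomial.C (b i)).natDegree ≤ 1 := by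
    intro i; compute_degree
  have key : ∀ m : Fin 3 →₀ ℕ, m.degree = N →
      (lineG (MvPolynomial.monomial m (D.coeff m)) a b).natDegree ≤ N ∧
      (lineG (MvPolynomial.monomial m (D.coeff m)) a b).coeff N =
        MvPolynomial.eval b (MvPolynomial.monomial m (D.coeff m)) := by
    intro m hm
    have hm' : m 0 + m 1 + m 2 = N := by
      rw [← hm, Finsupp.degree_eq_sum, Fin.sum_univ_three]
    have hp : ∀ i, ((Polynomial.C (a i) + Polynomial.X * Polynomial.C (b i)) ^ m i).natDegree ≤ m i := by
      intro i; simpa using Polynomial.natDegree_pow_le_of_le (m i) (hlin i)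
    have hc : ∀ i, ((Polynomial.C (a i) + Polynomial.X * Polynomial.C (b i)) ^ m i).coeff (m i)
        = b i ^ m i := by
      intro i
      have := Polynomial.coeff_pow_of_natDegree_le (m := m i) (hlin i)
      simpa using this
    have e : lineG (MvPolynomial.monomial m (D.coeff m)) a b = Polynomial.C (D.coeff m) *
        ((Polynomial.C (a 0) + Polynomial.X * Polynomial.C (b 0)) ^ m 0 *
        (Polynomial.C (a 1) + Polynomial.X * Polynomial.C (b 1)) ^ m 1 *
        (Polynomial.C (a 2) + Polynomial.X * Polynomial.C (b 2)) ^ m 2) := by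
      rw [lineG, MvPolynomial.aeval_monomial, Finsupp.prod_fintype _ _ (by simp),
        Fin.prod_univ_three]
      rfl
    have e2 : MvPolynomial.eval b (MvPolynomial.monomial m (D.coeff m)) = D.coeff m *
        (b 0 ^ m 0 * b 1 ^ m 1 * b 2 ^ m 2) := by
      rw [MvPolynomial.eval_monomial, Finsupp.prod_fintype _ _ (by simp),
        Fin.prod_univ_three]
    have h01 := Polynomial.natDegree_mul_le_of_le (hp 0) (hp 1)
    rw [e, e2, ← hm']
    refine ⟨(Polynomial.natDegree_C_mul_le _ _).trans
      (Polynomial.natDegree_mul_le_of_le h01 (hp 2)), ?_⟩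
    rw [Polynomial.coeff_C_mul, Polynomial.coeff_mul_add_eq_of_natDegree_le h01 (hp 2),
      Polynomial.coeff_mul_add_eq_of_natDegree_le (hp 0) (hp 1), hc, hc, hc]
  have hs : lineG D a b = ∑ m ∈ D.support, lineG (MvPolynomial.monomial m (D.coeff m)) a b := by
    conv_lhs => rw [D.as_sum]
    simp only [lineG, map_sum]
  have hdeg : ∀ m ∈ D.support, m.degree = N := by
    intro m hm
    have := hD (MvPolynomial.mem_support_iff.mp hm)
    rw [Finsupp.degree_eq_weight_one (R := ℕ)]
    exact this
  constructor
  · rw [hs]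
    exact Polynomial.natDegree_sum_le_of_forall_le _ _ fun m hm => (key m (hdeg m hm)).1
  · rw [hs, Polynomial.finsetSum_coeff]
    conv_rhs => rw [D.as_sum, map_sum]
    exact Finset.sum_congr rfl fun m hm => (key m (hdeg m hm)).2

lemma hM_homog {F G : MvPolynomial (Fin 3) ℂ} {d : ℕ} (hd : 3 ≤ d) (hF : F.IsHomogeneous d)
    (hG : G.IsHomogeneous d) (i j : Fin 3) : (hM F G i j).IsHomogeneous (2 * (d - 1)) := by
  have e : 2 * (d - 1) = d + (d - 1 - 1) := by omega
  rw [e]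
  exact (hG.mul hF.pderiv.pderiv).sub (hF.mul hG.pderiv.pderiv)

lemma hD_homog {F G : MvPolynomial (Fin 3) ℂ} {d : ℕ} (hd : 3 ≤ d) (hF : F.IsHomogeneous d)
    (hG : G.IsHomogeneous d) : (hD F G).IsHomogeneous (6 * (d - 1)) := by
  have e : 6 * (d - 1) = 2 * (d - 1) + 2 * (d - 1) + 2 * (d - 1) := by omega
  have k := hM_homog hd hF hG
  rw [hD, Matrix.det_fin_three, e]
  simp only [Matrix.of_apply]
  have m := fun a b c a' b' c' => ((k a a').mul (k b b')).mul (k c c')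
  exact (((((m _ _ _ _ _ _).sub (m _ _ _ _ _ _)).sub (m _ _ _ _ _ _)).add
    (m _ _ _ _ _ _)).add (m _ _ _ _ _ _)).sub (m _ _ _ _ _ _)

lemma det_identity {R : Type*} [CommRing R] (m00 m01 m02 m11 m12 m22 x y z n g0 g1 g2 : R)
    (e0 : x * m00 + y * m01 + z * m02 = n * g0)
    (e1 : x * m01 + y * m11 + z * m12 = n * g1)
    (e2 : x * m02 + y * m12 + z * m22 = n * g2)
    (e : x * g0 + y * g1 + z * g2 = 0) :
    x ^ 2 * (m00 * m11 * m22 - m00 * m12 * m12 - m01 * m01 * m22 + m01 * m12 * m02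
      + m02 * m01 * m12 - m02 * m11 * m02) =
      - n ^ 2 * (g1 ^ 2 * m22 - 2 * g1 * g2 * m12 + g2 ^ 2 * m11) := by
  have h1 : x * m01 = n * g1 - y * m11 - z * m12 := by linear_combination e1
  have h2 : x * m02 = n * g2 - y * m12 - z * m22 := by linear_combination e2
  have h0 : x ^ 2 * m00 = - n * (y * g1 + z * g2) - y * (n * g1 - y * m11 - z * m12)
      - z * (n * g2 - y * m12 - z * m22) := by
    linear_combination x * e0 + n * e - y * e1 - z * e2
  calc _ = (x ^ 2 * m00) * (m11 * m22 - m12 * m12) - (x * m01) * ((x * m01) * m22 - m12 * (x * m02))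
        + (x * m02) * ((x * m01) * m12 - m11 * (x * m02)) := by ring
    _ = _ := by rw [h0, h1, h2]; ring

lemma pderiv_pderiv_comm' {A : Type*} [CommRing A] (F : MvPolynomial (Fin 3) A) (i j : Fin 3) :
    MvPolynomial.pderiv i (MvPolynomial.pderiv j F) =
      MvPolynomial.pderiv j (MvPolynomial.pderiv i F) := by
  have h : ⁅(MvPolynomial.pderiv i : Derivation A (MvPolynomial (Fin 3) A) (MvPolynomial (Fin 3) A)),
      (MvPolynomial.pderiv j : Derivation A (MvPolynomial (Fin 3) A) (MvPolynomial (Fin 3) A))⁆ = 0 := by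
    apply MvPolynomial.derivation_ext
    intro k
    rw [Derivation.commutator_apply]
    simp [MvPolynomial.pderiv_X, Pi.single_apply]
    split_ifs <;> simp
  have := congrArg (fun D => D F) h
  rw [Derivation.commutator_apply] at this
  simpa [sub_eq_zero] using this

lemma hM_symm {A : Type*} [CommRing A] (F G : MvPolynomial (Fin 3) A) (i j : Fin 3) :
    hM F G i j = hM F G j i := by
  simp only [hM]
  rw [pderiv_pderiv_comm' F i j, pderiv_pderiv_comm' G i j]

/-- Euler for second derivatives -/
lemma euler2 {F : MvPolynomial (Fin 3) ℂ} {d : ℕ} (hd : 3 ≤ d) (hF : F.IsHomogeneous d)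
    (i : Fin 3) : ∑ j, MvPolynomial.X j * MvPolynomial.pderiv i (MvPolynomial.pderiv j F) =
      ((d : MvPolynomial (Fin 3) ℂ) - 1) * MvPolynomial.pderiv i F := by
  have := (hF.pderiv (i := i)).sum_X_mul_pderiv
  rw [nsmul_eq_mul, Nat.cast_sub (by omega)] at this
  rw [← Nat.cast_one, ← this]
  exact Finset.sum_congr rfl fun j _ => by rw [pderiv_pderiv_comm' F i j]

lemma euler_hM {F G : MvPolynomial (Fin 3) ℂ} {d : ℕ} (hd : 3 ≤ d) (hF : F.IsHomogeneous d)
    (hG' : G.IsHomogeneous d) (i : Fin 3) :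
    ∑ j, MvPolynomial.X j * hM F G i j = ((d : MvPolynomial (Fin 3) ℂ) - 1) * hG F G i := by
  have h1 := euler2 hd hF i
  have h2 := euler2 hd hG' i
  simp only [Fin.sum_univ_three, hM, hG] at *
  linear_combination G * h1 - F * h2

lemma euler_hG {F G : MvPolynomial (Fin 3) ℂ} {d : ℕ} (hF : F.IsHomogeneous d)
    (hG' : G.IsHomogeneous d) :
    ∑ i, MvPolynomial.X i * hG F G i = 0 := by
  have h1 := hF.sum_X_mul_pderiv
  have h2 := hG'.sum_X_mul_pderiv
  simp only [Fin.sum_univ_three, hG, nsmul_eq_mul] at *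
  linear_combination G * h1 - F * h2

lemma hD_identity {F G : MvPolynomial (Fin 3) ℂ} {d : ℕ} (hd : 3 ≤ d) (hF : F.IsHomogeneous d)
    (hG' : G.IsHomogeneous d) :
    MvPolynomial.X 0 ^ 2 * hD F G = - ((d : MvPolynomial (Fin 3) ℂ) - 1) ^ 2 *
      (hG F G 1 ^ 2 * hM F G 2 2 - 2 * hG F G 1 * hG F G 2 * hM F G 1 2 +
        hG F G 2 ^ 2 * hM F G 1 1) := by
  have e0 := euler_hM hd hF hG' 0
  have e1 := euler_hM hd hF hG' 1
  have e2 := euler_hM hd hF hG' 2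
  have e := euler_hG hF hG'
  simp only [Fin.sum_univ_three] at e0 e1 e2 e
  rw [hM_symm F G 1 0] at e1
  rw [hM_symm F G 2 0, hM_symm F G 2 1] at e2
  rw [← det_identity _ _ _ _ _ _ _ _ _ _ _ _ _ e0 e1 e2 e, hD, Matrix.det_fin_three]
  simp only [Matrix.of_apply]
  rw [hM_symm F G 1 0, hM_symm F G 2 0, hM_symm F G 2 1]

/-- the second-order contact data -/
lemma linePoly_eq (F : MvPolynomial (Fin 3) ℂ) (v w : Fin 3 → ℂ) : linePoly F v w = lineG F v w := rfl

lemma derivative_lineG (F : MvPolynomial (Fin 3) ℂ) (v w : Fin 3 → ℂ) :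
    Polynomial.derivative (lineG F v w) =
      ∑ i, Polynomial.C (w i) * lineG (MvPolynomial.pderiv i F) v w := by
  unfold lineG
  induction F using MvPolynomial.induction_on with
  | C r => simp
  | add p q hp hq =>
    simp only [map_add, hp, hq, mul_add, Finset.sum_add_distrib]
  | mul_X p k hp =>
    set L : MvPolynomial (Fin 3) ℂ →ₐ[ℂ] Polynomial ℂ :=
      MvPolynomial.aeval (fun i => Polynomial.C (v i) + Polynomial.X * Polynomial.C (w i)) with hL
    have hX : L (MvPolynomial.X k) = Polynomial.C (v k) + Polynomial.X * Polynomial.C (w k) := by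
      rw [hL, MvPolynomial.aeval_X]
    have hX' : Polynomial.derivative (L (MvPolynomial.X k)) = Polynomial.C (w k) := by
      rw [hX]; simp [-Polynomial.X_mul_C]
    have h2 : ∑ i, Polynomial.C (w i) * (L (MvPolynomial.pderiv i (MvPolynomial.X k))) =
        Polynomial.C (w k) := by
      rw [Finset.sum_eq_single k]
      · simp
      · intro b _ hb
        rw [MvPolynomial.pderiv_X_of_ne hb.symm]; simp
      · simp
    calc _ = Polynomial.derivative (L p) * L (MvPolynomial.X k) + L p * Polynomial.C (w k) := by
          rw [map_mul, Polynomial.derivative_mul, hX']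
      _ = ∑ i, (Polynomial.C (w i) * L (MvPolynomial.pderiv i p) * L (MvPolynomial.X k) +
            L p * (Polynomial.C (w i) * (L (MvPolynomial.pderiv i (MvPolynomial.X k))))) := by
          rw [Finset.sum_add_distrib, ← Finset.mul_sum, h2, hp, Finset.sum_mul]
      _ = _ := by
          refine Finset.sum_congr rfl fun i _ => ?_
          rw [MvPolynomial.pderiv_mul, map_add, map_mul, map_mul]; ring

lemma coeff0_lineG (F : MvPolynomial (Fin 3) ℂ) (v w : Fin 3 → ℂ) :
    (lineG F v w).coeff 0 = MvPolynomial.eval v F := by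
  rw [Polynomial.coeff_zero_eq_eval_zero, eval_lineG]; simp

lemma coeff1_lineG (F : MvPolynomial (Fin 3) ℂ) (v w : Fin 3 → ℂ) :
    (lineG F v w).coeff 1 = ∑ i, w i * MvPolynomial.eval v (MvPolynomial.pderiv i F) := by
  have h : (Polynomial.derivative (lineG F v w)).coeff 0 = (lineG F v w).coeff 1 := by
    rw [Polynomial.coeff_derivative]; simp
  rw [← h, derivative_lineG, Polynomial.finsetSum_coeff]
  simp only [Polynomial.coeff_C_mul, coeff0_lineG]

lemma coeff2_lineG (F : MvPolynomial (Fin 3) ℂ) (v w : Fin 3 → ℂ) :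
    2 * (lineG F v w).coeff 2 = ∑ i, w i * ∑ j, w j *
      MvPolynomial.eval v (MvPolynomial.pderiv j (MvPolynomial.pderiv i F)) := by
  have h : (Polynomial.derivative (lineG F v w)).coeff 1 = 2 * (lineG F v w).coeff 2 := by
    rw [Polynomial.coeff_derivative]; norm_num; ring
  rw [← h, derivative_lineG, Polynomial.finsetSum_coeff]
  simp only [Polynomial.coeff_C_mul, coeff1_lineG]

lemma contact3_iff (F : MvPolynomial (Fin 3) ℂ) (v w : Fin 3 → ℂ) :
    ContactLE F v w 3 ↔ MvPolynomial.eval v F = 0 ∧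
      ∑ i, w i * MvPolynomial.eval v (MvPolynomial.pderiv i F) = 0 ∧
      ∑ i, w i * ∑ j, w j *
        MvPolynomial.eval v (MvPolynomial.pderiv j (MvPolynomial.pderiv i F)) = 0 := by
  rw [ContactLE, linePoly_eq, Polynomial.X_pow_dvd_iff, ← coeff2_lineG, ← coeff1_lineG,
    ← coeff0_lineG F v w]
  constructor
  · intro h
    simp [h 0, h 1, h 2]
  · rintro ⟨h0, h1, h2⟩ k hk
    interval_cases k
    · exact h0
    · exact h1
    · simpa using h2

def hess (F : MvPolynomial (Fin 3) ℂ) (v : Fin 3 → ℂ) : Matrix (Fin 3) (Fin 3) ℂ :=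
  Matrix.of fun i j => MvPolynomial.eval v (MvPolynomial.pderiv i (MvPolynomial.pderiv j F))

open MvPolynomial in
lemma flex_imp {K : MvPolynomial (Fin 3) ℂ} {d : ℕ} (hd : 3 ≤ d) (hK : K.IsHomogeneous d)
    {v w : Fin 3 → ℂ} (hlin : LinearIndependent ℂ ![v, w]) (h : ContactLE K v w 3) :
    (hess K v).det = 0 := by
  rw [contact3_iff] at h
  obtain ⟨h0, h1, h2⟩ := h
  have e0 := congrArg (eval v) (euler2 hd hK 0)
  have e1 := congrArg (eval v) (euler2 hd hK 1)
  have e2 := congrArg (eval v) (euler2 hd hK 2)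
  have e := congrArg (eval v) hK.sum_X_mul_pderiv
  rw [← crossProduct_ne_zero_iff_linearIndependent] at hlin
  simp only [Fin.sum_univ_three, map_add, map_mul, eval_X, map_sub, map_natCast, map_one,
    nsmul_eq_mul, h0, mul_zero] at e0 e1 e2 e h1 h2
  rw [pderiv_pderiv_comm' K 1 0] at e1 h2
  rw [pderiv_pderiv_comm' K 2 0, pderiv_pderiv_comm' K 2 1] at e2 h2
  simp only [hess, Matrix.det_fin_three, Matrix.of_apply]
  rw [pderiv_pderiv_comm' K 1 0, pderiv_pderiv_comm' K 2 0, pderiv_pderiv_comm' K 2 1]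
  generalize eval v (pderiv 0 (pderiv 0 K)) = m00 at *
  generalize eval v (pderiv 0 (pderiv 1 K)) = m01 at *
  generalize eval v (pderiv 0 (pderiv 2 K)) = m02 at *
  generalize eval v (pderiv 1 (pderiv 1 K)) = m11 at *
  generalize eval v (pderiv 1 (pderiv 2 K)) = m12 at *
  generalize eval v (pderiv 2 (pderiv 2 K)) = m22 at *
  generalize eval v (pderiv 0 K) = g0 at *
  generalize eval v (pderiv 1 K) = g1 at *
  generalize eval v (pderiv 2 K) = g2 at *
  generalize ((d : ℂ) - 1) = n at *
  by_contra hdet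
  apply hlin
  set H : Matrix (Fin 3) (Fin 3) ℂ := !![m00, m01, m02; m01, m11, m12; m02, m12, m22] with hH
  have hHdet : H.det ≠ 0 := by
    rw [hH, Matrix.det_fin_three]; simpa using hdet
  -- a block-determinant identity in every direction u
  have key : ∀ u : Fin 3 → ℂ, Matrix.det (R := ℂ) (!![u 0, u 1, u 2; v 0, v 1, v 2; w 0, w 1, w 2]) = 0 := by
    intro u
    set M : Matrix (Fin 3) (Fin 3) ℂ := !![u 0, u 1, u 2; v 0, v 1, v 2; w 0, w 1, w 2] with hM
    have hz : (M * H * M.transpose).det = 0 := by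
      have b11 : (M * H * M.transpose) 1 1 = 0 := by
        simp [hM, hH, Matrix.mul_apply, Fin.sum_univ_three]
        linear_combination v 0 * e0 + v 1 * e1 + v 2 * e2 + n * e
      have b12 : (M * H * M.transpose) 1 2 = 0 := by
        simp [hM, hH, Matrix.mul_apply, Fin.sum_univ_three]
        linear_combination w 0 * e0 + w 1 * e1 + w 2 * e2 + n * h1
      have b21 : (M * H * M.transpose) 2 1 = 0 := by
        simp [hM, hH, Matrix.mul_apply, Fin.sum_univ_three]
        linear_combination w 0 * e0 + w 1 * e1 + w 2 * e2 + n * h1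
      have b22 : (M * H * M.transpose) 2 2 = 0 := by
        simp [hM, hH, Matrix.mul_apply, Fin.sum_univ_three]
        linear_combination h2
      rw [Matrix.det_fin_three, b11, b12, b21, b22]; ring
    rw [Matrix.det_mul, Matrix.det_mul, Matrix.det_transpose] at hz
    by_contra hne
    exact (mul_ne_zero (mul_ne_zero hne hHdet) hne) hz
  have k0 := key ![1, 0, 0]
  have k1 := key ![0, 1, 0]
  have k2 := key ![0, 0, 1]
  simp [Matrix.det_fin_three] at k0 k1 k2
  rw [cross_apply]
  ext i
  fin_cases i
  · simp; linear_combination k0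
  · simp; linear_combination k1
  · simp; linear_combination k2

open MvPolynomial in
lemma imp_flex {K : MvPolynomial (Fin 3) ℂ} {d : ℕ} (hd : 3 ≤ d) (hK : K.IsHomogeneous d)
    {v : Fin 3 → ℂ} (h0 : eval v K = 0) (hdet : (hess K v).det = 0)
    (hg : ∃ i, eval v (pderiv i K) ≠ 0) :
    ∃ w : Fin 3 → ℂ, LinearIndependent ℂ ![v, w] ∧
        (∑ i, eval v (pderiv i K) * w i) = 0 ∧ ContactLE K v w 3 := by
  obtain ⟨w, hw, hHw⟩ := Matrix.exists_mulVec_eq_zero_iff.mpr hdet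
  have hn : (d : ℂ) - 1 ≠ 0 := by
    have : (1 : ℂ) ≠ d := by exact_mod_cast (by omega : 1 ≠ d)
    exact sub_ne_zero.mpr this.symm
  have eu : ∀ i, ∑ j, v j * eval v (pderiv i (pderiv j K)) = ((d : ℂ) - 1) * eval v (pderiv i K) := by
    intro i
    have := congrArg (eval v) (euler2 hd hK i)
    simpa using this
  have hrow : ∀ i, ∑ j, eval v (pderiv i (pderiv j K)) * w j = 0 := by
    intro i
    have := congrFun hHw i
    simpa [hess, Matrix.mulVec, dotProduct] using this
  have hgw : ∑ i, eval v (pderiv i K) * w i = 0 := by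
    apply mul_left_cancel₀ hn
    rw [Finset.mul_sum, mul_zero]
    calc _ = ∑ i, ∑ j, v j * (eval v (pderiv j (pderiv i K)) * w i) := by
          refine Finset.sum_congr rfl fun i _ => ?_
          rw [← mul_assoc, ← eu, Finset.sum_mul]
          exact Finset.sum_congr rfl fun j _ => by rw [pderiv_pderiv_comm' K i j]; ring
      _ = ∑ j, v j * ∑ i, (eval v (pderiv j (pderiv i K)) * w i) := by
          rw [Finset.sum_comm]; simp only [Finset.mul_sum]
      _ = 0 := by simp [hrow]
  refine ⟨w, ?_, hgw, ?_⟩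
  · rw [LinearIndependent.pair_iff]
    intro s t hst
    have hs : s = 0 := by
      obtain ⟨i, hi⟩ := hg
      have h1 : s * (((d : ℂ) - 1) * eval v (pderiv i K)) = 0 := by
        rw [← eu]
        calc _ = ∑ j, eval v (pderiv i (pderiv j K)) * (s • v + t • w) j
              - t * ∑ j, eval v (pderiv i (pderiv j K)) * w j := by
              rw [Finset.mul_sum, Finset.mul_sum, ← Finset.sum_sub_distrib]
              exact Finset.sum_congr rfl fun j _ => by simp; ring
          _ = 0 := by rw [hst, hrow]; simp
      rcases mul_eq_zero.mp h1 with h | h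
      · exact h
      · exact absurd h (mul_ne_zero hn hi)
    subst hs
    refine ⟨rfl, ?_⟩
    simpa [hw] using hst
  · rw [contact3_iff]
    refine ⟨h0, ?_, ?_⟩
    · rw [← hgw]; exact Finset.sum_congr rfl fun i _ => mul_comm _ _
    · refine Finset.sum_eq_zero fun i _ => ?_
      rw [mul_eq_zero]; right
      rw [← hrow i]
      exact Finset.sum_congr rfl fun j _ => by rw [pderiv_pderiv_comm' K j i, mul_comm]

lemma homog_eval_smul {D : MvPolynomial (Fin 3) ℂ} {N : ℕ} (hD : D.IsHomogeneous N)
    (s : ℂ) (x : Fin 3 → ℂ) : MvPolynomial.eval (s • x) D = s ^ N * MvPolynomial.eval x D := by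
  have h1 := (lineG_coeff hD 0 (s • x)).2
  rw [← h1]
  have h2 := (lineG_coeff hD 0 x).2
  rw [← h2]
  have h : lineG D 0 (s • x) = (lineG D 0 x).comp (Polynomial.C s * Polynomial.X) := by
    unfold lineG
    clear h1 h2 hD
    induction D using MvPolynomial.induction_on with
    | C r => simp
    | add p q hp hq => rw [map_add, map_add, Polynomial.add_comp, hp, hq]
    | mul_X p i hp =>
      rw [map_mul, map_mul, Polynomial.mul_comp, hp]
      simp [-Polynomial.X_mul_C]
      left; ring
  rw [h, Polynomial.comp_C_mul_X_coeff, mul_comm]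

lemma hG_homog {F G : MvPolynomial (Fin 3) ℂ} {d : ℕ} (hF : F.IsHomogeneous d)
    (hG' : G.IsHomogeneous d) (i : Fin 3) : (hG F G i).IsHomogeneous (d + (d - 1)) :=
  (hG'.mul hF.pderiv).sub (hF.mul hG'.pderiv)

lemma eval_hD (F G : MvPolynomial (Fin 3) ℂ) (v : Fin 3 → ℂ) (c : Fin 2 → ℂ) (s : ℂ)
    (h0 : MvPolynomial.eval v G = s * c 0) (h1 : - MvPolynomial.eval v F = s * c 1) :
    MvPolynomial.eval v (hD F G) = s ^ 3 * (hess (c 0 • F + c 1 • G) v).det := by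
  have e : (MvPolynomial.eval v).mapMatrix (Matrix.of (hM F G)) =
      s • hess (c 0 • F + c 1 • G) v := by
    ext i j
    simp only [hM, hess, RingHom.mapMatrix_apply, Matrix.map_apply, Matrix.of_apply,
      Matrix.smul_apply, map_sub, map_mul, map_add, Derivation.map_smul, MvPolynomial.smul_eval, smul_eq_mul]
    linear_combination (MvPolynomial.eval v) (MvPolynomial.pderiv i (MvPolynomial.pderiv j F)) * h0
      + (MvPolynomial.eval v) (MvPolynomial.pderiv i (MvPolynomial.pderiv j G)) * h1
  rw [hD, RingHom.map_det, e, Matrix.det_smul]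
  simp

lemma exists_scalar {c : Fin 2 → ℂ} (hc : c ≠ 0) {x y : ℂ} (h : c 0 * x + c 1 * y = 0) :
    ∃ s, y = s * c 0 ∧ -x = s * c 1 := by
  by_cases h0 : c 0 = 0
  · have h1 : c 1 ≠ 0 := by
      intro h1; apply hc; ext i; fin_cases i <;> simp [h0, h1]
    refine ⟨-x / c 1, ?_, by field_simp⟩
    rw [h0] at h ⊢
    simpa [h1] using h
  · refine ⟨y / c 0, by field_simp, ?_⟩
    field_simp
    linear_combination -h

lemma pencil_homog {F G : MvPolynomial (Fin 3) ℂ} {d : ℕ} (hF : F.IsHomogeneous d)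
    (hG' : G.IsHomogeneous d) (a b : ℂ) : (a • F + b • G).IsHomogeneous d := by
  have := ((MvPolynomial.homogeneousSubmodule (Fin 3) ℂ d).smul_mem a hF)
  have h2 := ((MvPolynomial.homogeneousSubmodule (Fin 3) ℂ d).smul_mem b hG')
  exact (MvPolynomial.homogeneousSubmodule (Fin 3) ℂ d).add_mem this h2

lemma flex_eval_zero {F G : MvPolynomial (Fin 3) ℂ} {h : Fin 3 → ℂ} {d : ℕ} (hd : 3 ≤ d)
    (hF : F.IsHomogeneous d) (hG' : G.IsHomogeneous d)
    {p : Projectivization ℂ (Fin 3 → ℂ)} (hp : p ∈ flexPointsOnLine F G h) :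
    MvPolynomial.eval p.rep (hD F G) = 0 := by
  obtain ⟨-, c, hc0, -, -, w, hw, -, hcon⟩ := hp
  have hdet := flex_imp hd (pencil_homog hF hG' _ _) hw hcon
  have hc1 : c.rep 0 * MvPolynomial.eval p.rep F + c.rep 1 * MvPolynomial.eval p.rep G = 0 := by
    simpa [pencilMember] using hc0
  obtain ⟨s, h0, h1⟩ := exists_scalar c.rep_nonzero hc1
  rw [eval_hD F G p.rep c.rep s h0 h1, hdet, mul_zero]

lemma mem_flex {F G : MvPolynomial (Fin 3) ℂ} {h : Fin 3 → ℂ} {d : ℕ} (hd : 3 ≤ d)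
    (hF : F.IsHomogeneous d) (hG' : G.IsHomogeneous d)
    {p : Projectivization ℂ (Fin 3 → ℂ)} (hp : ∑ i, h i * p.rep i = 0)
    (hz : MvPolynomial.eval p.rep (hD F G) = 0)
    (hg : ∃ i, MvPolynomial.eval p.rep (hG F G i) ≠ 0) : p ∈ flexPointsOnLine F G h := by
  set v := p.rep with hv
  set c0 : Fin 2 → ℂ := ![MvPolynomial.eval v G, - MvPolynomial.eval v F] with hc0
  have hc0n : c0 ≠ 0 := by
    intro hzero
    have a0 := congrFun hzero 0
    have a1 := congrFun hzero 1
    simp [hc0] at a0 a1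
    obtain ⟨i, hi⟩ := hg
    apply hi
    simp [hG, a0, a1]
  obtain ⟨a, ha⟩ := Projectivization.exists_smul_eq_mk_rep ℂ c0 hc0n
  set c := Projectivization.mk ℂ c0 hc0n with hc
  have ha0 : c.rep 0 = a * MvPolynomial.eval v G := by
    rw [← ha]; simp [hc0, Units.smul_def]
  have ha1 : c.rep 1 = - (a * MvPolynomial.eval v F) := by
    rw [← ha]; simp [hc0, Units.smul_def]
  have hane : (a : ℂ) ≠ 0 := a.ne_zero
  have hK0 : MvPolynomial.eval v (pencilMember F G c) = 0 := by
    simp [pencilMember, ha0, ha1]; ring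
  have hKg : ∃ i, MvPolynomial.eval v (MvPolynomial.pderiv i (pencilMember F G c)) ≠ 0 := by
    obtain ⟨i, hi⟩ := hg
    refine ⟨i, ?_⟩
    have : MvPolynomial.eval v (MvPolynomial.pderiv i (pencilMember F G c)) =
        a * MvPolynomial.eval v (hG F G i) := by
      simp [pencilMember, ha0, ha1, hG]; ring
    rw [this]
    exact mul_ne_zero hane hi
  have hdet : (hess (pencilMember F G c) v).det = 0 := by
    have := eval_hD F G v c.rep (a : ℂ)⁻¹ (by rw [ha0]; field_simp) (by rw [ha1]; field_simp)
    rw [hz] at this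
    rcases mul_eq_zero.mp this.symm with h | h
    · exact absurd h (by simp)
    · exact h
  refine ⟨hp, c, hK0, ?_, hKg, imp_flex hd (pencil_homog hF hG' _ _) hK0 hdet hKg⟩
  intro c' hc'
  have hc1 : c'.rep 0 * MvPolynomial.eval v F + c'.rep 1 * MvPolynomial.eval v G = 0 := by
    simpa [pencilMember] using hc'
  obtain ⟨s, h0, h1⟩ := exists_scalar c'.rep_nonzero hc1
  rw [← c'.mk_rep, hc]
  symm
  rw [Projectivization.mk_eq_mk_iff']
  refine ⟨s, ?_⟩
  ext i
  fin_cases i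
  · simp [hc0, h0]
  · simp [hc0, h1]

def ptv (h : Fin 3 → ℂ) (t : ℂ) : Fin 3 → ℂ := fun i => pA h i + t * pB h i

lemma ptv_ne {h : Fin 3 → ℂ} (h2 : h 2 ≠ 0) (t : ℂ) : ptv h t ≠ 0 := by
  intro e
  have := congrFun e 0
  simp [ptv, pA, pB, h2] at this

lemma flexP_hG_ne {F G : MvPolynomial (Fin 3) ℂ} {h : Fin 3 → ℂ} {d : ℕ} (hd : 3 ≤ d)
    (hF : F.IsHomogeneous d) (hG' : G.IsHomogeneous d) (h2 : h 2 ≠ 0)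
    (hsep : (flexP F G h).Separable) {t : ℂ} (ht : (flexP F G h).eval t = 0) :
    ∃ i, MvPolynomial.eval (ptv h t) (hG F G i) ≠ 0 := by
  by_contra hcon
  push Not at hcon
  have hder : (flexP F G h).derivative.eval t ≠ 0 := by
    have := hsep.eval₂_derivative_ne_zero (RingHom.id ℂ) (x := t) (by simpa using ht)
    simpa using this
  have id := congrArg (fun D => lineG D (pA h) (pB h)) (hD_identity hd hF hG')
  have g1 : (lineG (hG F G 1) (pA h) (pB h)).eval t = 0 := by rw [eval_lineG]; exact hcon 1
  have g2 : (lineG (hG F G 2) (pA h) (pB h)).eval t = 0 := by rw [eval_lineG]; exact hcon 2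
  have hmul : ∀ D E : MvPolynomial (Fin 3) ℂ, lineG (D * E) (pA h) (pB h) =
      lineG D (pA h) (pB h) * lineG E (pA h) (pB h) := fun D E => by simp only [lineG, map_mul]
  have hadd : ∀ D E : MvPolynomial (Fin 3) ℂ, lineG (D + E) (pA h) (pB h) =
      lineG D (pA h) (pB h) + lineG E (pA h) (pB h) := fun D E => by simp only [lineG, map_add]
  have hsub : ∀ D E : MvPolynomial (Fin 3) ℂ, lineG (D - E) (pA h) (pB h) =
      lineG D (pA h) (pB h) - lineG E (pA h) (pB h) := fun D E => by simp only [lineG, map_sub]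
  have hX : lineG (MvPolynomial.X 0 : MvPolynomial (Fin 3) ℂ) (pA h) (pB h) =
      Polynomial.C (h 2) := by simp [lineG, pA, pB]
  simp only [pow_two, hmul, hadd, hsub, hX] at id
  have id2 := congrArg (fun P => (Polynomial.derivative P).eval t) id
  simp only [Polynomial.derivative_mul, Polynomial.derivative_add, Polynomial.derivative_sub,
    Polynomial.eval_add, Polynomial.eval_mul, Polynomial.eval_sub, g1, g2,
    Polynomial.derivative_C, Polynomial.eval_C, Polynomial.eval_zero] at id2
  apply hder
  have : h 2 * h 2 * (flexP F G h).derivative.eval t = 0 := by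
    unfold flexP
    linear_combination id2
  simpa [h2] using this

theorem flex_count {F G : MvPolynomial (Fin 3) ℂ} {h : Fin 3 → ℂ} {d : ℕ} (hd : 3 ≤ d)
    (hF : F.IsHomogeneous d) (hG' : G.IsHomogeneous d) (h2 : h 2 ≠ 0)
    (hlead : (flexP F G h).coeff (6 * (d - 1)) ≠ 0)
    (hsep : (flexP F G h).Separable) :
    (flexPointsOnLine F G h).Finite ∧
            ((flexPointsOnLine F G h).ncard : ℤ) = 6 * (d : ℤ) - 6 := by
  have hDh := hD_homog hd hF hG'
  obtain ⟨hdeg, hco⟩ := lineG_coeff hDh (pA h) (pB h)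
  change (flexP F G h).natDegree ≤ _ at hdeg
  change (flexP F G h).coeff _ = _ at hco
  have hnat : (flexP F G h).natDegree = 6 * (d - 1) :=
    le_antisymm hdeg (Polynomial.le_natDegree_of_ne_zero hlead)
  rw [hco] at hlead
  have heval : ∀ t, (flexP F G h).eval t = MvPolynomial.eval (ptv h t) (hD F G) :=
    fun t => eval_lineG _ _ _ _
  let φ : ℂ → Projectivization ℂ (Fin 3 → ℂ) := fun t => Projectivization.mk ℂ (ptv h t) (ptv_ne h2 t)
  have hφ : Function.Injective φ := by
    intro s t hst
    obtain ⟨a, ha⟩ := (Projectivization.mk_eq_mk_iff' ℂ _ _ _ _).mp hst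
    have e0 := congrFun ha 0
    have e1 := congrFun ha 1
    simp [ptv, pA, pB, h2] at e0 e1
    rw [e0] at e1
    simpa [h2] using e1.symm
  have hP0 : flexP F G h ≠ 0 := hsep.ne_zero
  have hset : flexPointsOnLine F G h = φ '' ((flexP F G h).roots.toFinset : Set ℂ) := by
    ext p
    simp only [Set.mem_image, Finset.mem_coe, Multiset.mem_toFinset, Polynomial.mem_roots hP0,
      Polynomial.IsRoot.def]
    constructor
    · intro hp
      have hz := flex_eval_zero hd hF hG' hp
      have hl := hp.1
      rw [Fin.sum_univ_three] at hl
      set r := p.rep with hr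
      have hr0 : r 0 ≠ 0 := by
        intro hr0
        have hb : r = (r 1 / h 2) • pB h := by
          ext i
          fin_cases i
          · simp [pB, hr0]
          · simp [pB]; field_simp
          · simp [pB]; rw [hr0] at hl; field_simp; linear_combination hl
        rw [hb, homog_eval_smul hDh] at hz
        rcases mul_eq_zero.mp hz with hz | hz
        · have : r 1 / h 2 = 0 := (pow_eq_zero_iff (by omega)).mp hz
          rw [this, zero_smul] at hb
          exact p.rep_nonzero hb
        · exact hlead hz
      have hb : r = (r 0 / h 2) • ptv h (r 1 / r 0) := by
        ext i
        fin_cases i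
        · simp [ptv, pA, pB]; field_simp
        · simp [ptv, pA, pB]; field_simp
        · simp [ptv, pA, pB]; field_simp; linear_combination hl
      refine ⟨r 1 / r 0, ?_, ?_⟩
      · rw [heval]
        rw [hb, homog_eval_smul hDh] at hz
        rcases mul_eq_zero.mp hz with hz | hz
        · exact absurd hz (pow_ne_zero _ (div_ne_zero hr0 h2))
        · exact hz
      · rw [← p.mk_rep]
        symm
        rw [Projectivization.mk_eq_mk_iff']
        exact ⟨_, hb.symm⟩
    · rintro ⟨t, ht, rfl⟩
      obtain ⟨a, ha⟩ := Projectivization.exists_smul_eq_mk_rep ℂ (ptv h t) (ptv_ne h2 t)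
      have ha' : (φ t).rep = (a : ℂ) • ptv h t := by rw [← ha]; rfl
      apply mem_flex hd hF hG'
      · rw [ha', Fin.sum_univ_three]
        simp [ptv, pA, pB]; ring
      · rw [ha', homog_eval_smul hDh, ← heval, ht, mul_zero]
      · obtain ⟨i, hi⟩ := flexP_hG_ne hd hF hG' h2 hsep ht
        refine ⟨i, ?_⟩
        rw [ha', homog_eval_smul (hG_homog hF hG' i)]
        exact mul_ne_zero (pow_ne_zero _ a.ne_zero) hi
  rw [hset]
  refine ⟨(Finset.finite_toSet _).image _, ?_⟩
  rw [Set.ncard_image_of_injective _ hφ, Set.ncard_coe_finset,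
    Multiset.toFinset_card_of_nodup (Polynomial.nodup_roots hsep),
    ← (IsAlgClosed.splits (flexP F G h)).natDegree_eq_card_roots, hnat]
  push_cast [Nat.cast_sub (show 1 ≤ d by omega)]
  ring

/-- Universal form. -/
def univF (d : ℕ) (e : (Fin 3 →₀ ℕ) → ((Fin 3 →₀ ℕ) ⊕ (Fin 3 →₀ ℕ)) ⊕ Fin 3) :
    MvPolynomial (Fin 3) (MvPolynomial (((Fin 3 →₀ ℕ) ⊕ (Fin 3 →₀ ℕ)) ⊕ Fin 3) ℂ) :=
  ∑ m ∈ Finset.finsuppAntidiag Finset.univ d, MvPolynomial.monomial m (MvPolynomial.X (e m))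

lemma map_univF {d : ℕ} (e : (Fin 3 →₀ ℕ) → ((Fin 3 →₀ ℕ) ⊕ (Fin 3 →₀ ℕ)) ⊕ Fin 3)
    (x : ((Fin 3 →₀ ℕ) ⊕ (Fin 3 →₀ ℕ)) ⊕ Fin 3 → ℂ) {F : MvPolynomial (Fin 3) ℂ}
    (hF : F.IsHomogeneous d) (hx : ∀ m, x (e m) = F.coeff m) :
    MvPolynomial.map (MvPolynomial.eval x) (univF d e) = F := by
  ext m
  simp only [univF, map_sum, MvPolynomial.map_monomial, MvPolynomial.eval_X, hx,
    MvPolynomial.coeff_sum, MvPolynomial.coeff_monomial]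
  rw [Finset.sum_ite_eq']
  split_ifs with hm
  · rfl
  · by_contra hne
    apply hm
    have := hF (Ne.symm hne)
    rw [Finset.mem_finsuppAntidiag]
    refine ⟨?_, by simp⟩
    have h2 : m.degree = d := by
      rw [Finsupp.degree_eq_weight_one (R := ℕ)]; exact this
    rw [← h2, Finsupp.degree_eq_sum]

def univQ (d : ℕ) : MvPolynomial (((Fin 3 →₀ ℕ) ⊕ (Fin 3 →₀ ℕ)) ⊕ Fin 3) ℂ :=
  let P := flexP (univF d fun m => Sum.inl (Sum.inl m)) (univF d fun m => Sum.inl (Sum.inr m))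
    (fun i => MvPolynomial.X (Sum.inr i))
  MvPolynomial.X (Sum.inr 2) * P.coeff (6 * (d - 1)) *
    Polynomial.resultant P (Polynomial.derivative P) (6 * (d - 1)) (6 * (d - 1) - 1)

lemma eval_univQ {d : ℕ} (hd : 3 ≤ d) {F G : MvPolynomial (Fin 3) ℂ} (h : Fin 3 → ℂ)
    (hF : F.IsHomogeneous d) (hG' : G.IsHomogeneous d) :
    MvPolynomial.eval (Sum.elim (coeffs2 F G) h) (univQ d) ≠ 0 ↔
      h 2 ≠ 0 ∧ (flexP F G h).coeff (6 * (d - 1)) ≠ 0 ∧ (flexP F G h).Separable := by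
  have hP : (flexP (univF d fun m => Sum.inl (Sum.inl m)) (univF d fun m => Sum.inl (Sum.inr m))
    (fun i => MvPolynomial.X (Sum.inr i))).map (MvPolynomial.eval (Sum.elim (coeffs2 F G) h)) =
      flexP F G h := by
    rw [map_flexP, map_univF _ _ hF, map_univF _ _ hG']
    · congr 1
      ext i; simp
    · intro m; simp [coeffs2]
    · intro m; simp [coeffs2]
  rw [univQ]
  simp only [map_mul, MvPolynomial.eval_X, Sum.elim_inr]
  rw [← Polynomial.resultant_map_map, ← Polynomial.derivative_map, ← Polynomial.coeff_map, hP,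
    mul_ne_zero_iff, mul_ne_zero_iff, and_assoc]
  refine and_congr_right fun _ => and_congr_right fun hlead => ?_
  have hdeg := (lineG_coeff (hD_homog hd hF hG') (pA h) (pB h)).1
  change (flexP F G h).natDegree ≤ _ at hdeg
  have hnat : (flexP F G h).natDegree = 6 * (d - 1) :=
    le_antisymm hdeg (Polynomial.le_natDegree_of_ne_zero hlead)
  have hnat' : (Polynomial.derivative (flexP F G h)).natDegree = 6 * (d - 1) - 1 := by
    rw [Polynomial.natDegree_derivative, hnat]
  have h0 : flexP F G h ≠ 0 := by rintro h0; simp [h0] at hlead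
  rw [← hnat', ← hnat, Ne, Polynomial.resultant_eq_zero_iff, Polynomial.separable_def]
  simp [h0]

lemma bertini {D E : Polynomial ℂ} {N : ℕ} (hN : 0 < N) (hE : E.natDegree = N)
    (hco : ∀ t, E.eval t = 0 → D.eval t ≠ 0) :
    ∃ l : ℂ, (D + Polynomial.C l * E).coeff N ≠ 0 ∧ (D + Polynomial.C l * E).Separable := by
  have hE0 : E ≠ 0 := by rintro rfl; simp at hE; omega
  have hcop : IsCoprime E D := by
    rw [Polynomial.isCoprime_iff_aeval_ne_zero_of_isAlgClosed ℂ ℂ]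
    intro t
    by_cases ht : E.eval t = 0
    · right; simpa using hco t ht
    · left; simpa using ht
  set W := Polynomial.derivative D * E - D * Polynomial.derivative E with hW
  have hW0 : W ≠ 0 := by
    intro h0
    have h1 : E ∣ D * Polynomial.derivative E := by
      refine ⟨Polynomial.derivative D, ?_⟩
      linear_combination hW - h0
    have h2 := hcop.dvd_of_dvd_mul_left h1
    have h3 : Polynomial.derivative E = 0 := by
      apply Polynomial.eq_zero_of_dvd_of_natDegree_lt h2
      exact Polynomial.natDegree_derivative_lt (by omega)
    have := Polynomial.derivative_eq_zero.mp h3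
    omega
  obtain ⟨l, hl⟩ := Infinite.exists_notMem_finset
    (insert (- D.coeff N / E.coeff N) (W.roots.toFinset.image fun t => - D.eval t / E.eval t))
  simp only [Finset.mem_insert, Finset.mem_image, Multiset.mem_toFinset, not_or, not_exists,
    not_and] at hl
  obtain ⟨hl1, hl2⟩ := hl
  have hEN : E.coeff N ≠ 0 := by
    rw [← hE]; simpa using hE0
  refine ⟨l, ?_, ?_⟩
  · intro h
    apply hl1
    rw [Polynomial.coeff_add, Polynomial.coeff_C_mul] at h
    field_simp
    linear_combination h
  · rw [Polynomial.separable_def, Polynomial.isCoprime_iff_aeval_ne_zero_of_isAlgClosed ℂ ℂ]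
    intro t
    by_contra hcon
    push Not at hcon
    obtain ⟨h1, h2⟩ := hcon
    simp at h1 h2
    have hEt : E.eval t ≠ 0 := by
      intro h
      rw [h, mul_zero, add_zero] at h1
      exact hco t h h1
    apply hl2 t
    · rw [Polynomial.mem_roots hW0, Polynomial.IsRoot.def, hW]
      simp only [Polynomial.eval_sub, Polynomial.eval_mul]
      linear_combination E.eval t * h2 - (Polynomial.derivative E).eval t * h1
    · field_simp
      linear_combination -h1

section witness
open MvPolynomial

def wF (k : ℕ) : MvPolynomial (Fin 3) ℂ :=
  X 1 ^ (k + 3) + C Complex.I * (X 1 * X 0 ^ (k + 2)) + X 2 * (X 0 ^ (k + 2) + X 1 * X 0 ^ (k + 1))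

def bet (k : ℕ) : ℂ := - Complex.I * ((k + 3) / (k + 1))

def wG (k : ℕ) (l : ℂ) : MvPolynomial (Fin 3) ℂ :=
  C (bet k) * (X 0 * X 1 ^ (k + 2)) + X 0 ^ (k + 3) + C l * (X 2 ^ 2 * X 1 ^ (k + 1))

lemma wF_homog (k : ℕ) : (wF k).IsHomogeneous (k + 3) := by
  have hX : ∀ (i : Fin 3) (n : ℕ), ((X i : MvPolynomial (Fin 3) ℂ) ^ n).IsHomogeneous n :=
    fun i n => isHomogeneous_X_pow i n
  have h1 := hX 1 (k + 3)
  have h2 := (isHomogeneous_C (Fin 3) Complex.I).mul ((isHomogeneous_X ℂ (1 : Fin 3)).mul (hX 0 (k + 2)))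
  have h3 := (isHomogeneous_X ℂ (2 : Fin 3)).mul
    ((hX 0 (k + 2)).add ((show 1 + (k + 1) = k + 2 by ring) ▸
      (isHomogeneous_X ℂ (1 : Fin 3)).mul (hX 0 (k + 1))))
  rw [show 0 + (1 + (k + 2)) = k + 3 by ring] at h2
  rw [show 1 + (k + 2) = k + 3 by ring] at h3
  exact (h1.add h2).add h3

lemma wG_homog (k : ℕ) (l : ℂ) : (wG k l).IsHomogeneous (k + 3) := by
  have hX : ∀ (i : Fin 3) (n : ℕ), ((X i : MvPolynomial (Fin 3) ℂ) ^ n).IsHomogeneous n :=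
    fun i n => isHomogeneous_X_pow i n
  have h2 := (isHomogeneous_C (Fin 3) (bet k)).mul ((isHomogeneous_X ℂ (0 : Fin 3)).mul (hX 1 (k + 2)))
  have h3 := (isHomogeneous_C (Fin 3) l).mul ((hX 2 2).mul (hX 1 (k + 1)))
  rw [show 0 + (1 + (k + 2)) = k + 3 by ring] at h2
  rw [show 0 + (2 + (k + 1)) = k + 3 by ring] at h3
  exact (h2.add (hX 0 (k + 3))).add h3

lemma w_indep (k : ℕ) (l : ℂ) : LinearIndependent ℂ ![wF k, wG k l] := by
  rw [LinearIndependent.pair_iff]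
  intro s t hst
  have h1 := congrArg (eval ![1, 0, 0]) hst
  have h2 := congrArg (eval ![0, 1, 0]) hst
  simp [wF, wG] at h1 h2
  exact ⟨h2, h1⟩

/-- restriction to the line, u = t^(k+2) -/
def wg (k : ℕ) : Polynomial ℂ := Polynomial.C (bet k) * Polynomial.X ^ (k + 2) + 1
def wf (k : ℕ) : Polynomial ℂ :=
  Polynomial.X * (Polynomial.X ^ (k + 2) + Polynomial.C Complex.I)
def wW (k : ℕ) : Polynomial ℂ :=
  Polynomial.C (bet k) * (Polynomial.X ^ (k + 2)) ^ 2 + Polynomial.C Complex.I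

def wE (k : ℕ) : Polynomial ℂ :=
  Polynomial.C (2 * ((k : ℂ) + 2) ^ 2) * (wf k * Polynomial.X ^ (k + 1) * wW k ^ 2)

def wD (k : ℕ) : Polynomial ℂ :=
  Polynomial.C (((k : ℂ) + 2) ^ 2) * ((1 + Polynomial.X) * wg k ^ 2 * (2 * wW k -
    (1 + Polynomial.X) * Polynomial.C (2 * ((k : ℂ) + 2) * bet k) * Polynomial.X ^ (2 * k + 3)))

lemma bet_rel (k : ℕ) : Complex.I * bet k * (k + 1) = k + 3 := by
  have : (k : ℂ) + 1 ≠ 0 := by exact_mod_cast Nat.succ_ne_zero k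
  unfold bet
  field_simp
  simp

lemma lineG_alg (a b : Fin 3 → ℂ) (D E : MvPolynomial (Fin 3) ℂ) :
    lineG (D + E) a b = lineG D a b + lineG E a b ∧ lineG (D * E) a b = lineG D a b * lineG E a b ∧
    lineG (D - E) a b = lineG D a b - lineG E a b ∧ lineG (-D) a b = - lineG D a b := by
  simp only [lineG, map_add, map_mul, map_sub, map_neg, and_self]

lemma w_flexP (k : ℕ) (l : ℂ) :
    flexP (wF k) (wG k l) ![0, 0, 1] = wD k + Polynomial.C l * wE k := by
  have id := congrArg (fun D => lineG D (pA ![0, 0, 1]) (pB ![0, 0, 1]))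
    (hD_identity (d := k + 3) (by omega) (wF_homog k) (wG_homog k l))
  beta_reduce at id
  set A : Fin 3 → ℂ := pA ![0, 0, 1] with hA
  set B : Fin 3 → ℂ := pB ![0, 0, 1] with hB
  set Y : Polynomial ℂ := Polynomial.X with hY
  have hL : ∀ D : MvPolynomial (Fin 3) ℂ, lineG D A B = aeval (![1, Y, 0] : Fin 3 → Polynomial ℂ) D := by
    intro D
    unfold lineG
    congr 2
    ext1 i
    fin_cases i <;> simp [hA, hB, pA, pB, hY]
  have p3 : pderiv 1 (3 : MvPolynomial (Fin 3) ℂ) = 0 := by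
    rw [show (3 : MvPolynomial (Fin 3) ℂ) = C 3 from (map_ofNat C 3).symm, pderiv_C]
  have p2 : pderiv 1 (2 : MvPolynomial (Fin 3) ℂ) = 0 := by
    rw [show (2 : MvPolynomial (Fin 3) ℂ) = C 2 from (map_ofNat C 2).symm, pderiv_C]
  have c3 : Polynomial.C (3 : ℂ) = 3 := map_ofNat _ 3
  have c2 : Polynomial.C (2 : ℂ) = 2 := map_ofNat _ 2
  have eF : lineG (wF k) A B = wf k := by
    rw [hL]; simp [wF, wf]; ring
  have eG : lineG (wG k l) A B = wg k := by
    rw [hL]; simp [wG, wg, hY]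
  have eFy : lineG (pderiv 1 (wF k)) A B = (k + 3) * Y ^ (k + 2) + Polynomial.C Complex.I := by
    rw [hL]; simp [wF, pderiv_mul, pderiv_pow, pderiv_X, Pi.single_apply]
  have eFz : lineG (pderiv 2 (wF k)) A B = 1 + Y := by
    rw [hL]; simp [wF, pderiv_mul, pderiv_pow, pderiv_X, Pi.single_apply]
  have eGy : lineG (pderiv 1 (wG k l)) A B = Polynomial.C (bet k) * (k + 2) * Y ^ (k + 1) := by
    rw [hL]; simp [wG, pderiv_mul, pderiv_pow, pderiv_X, Pi.single_apply]; ring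
  have eGz : lineG (pderiv 2 (wG k l)) A B = 0 := by
    rw [hL]; simp [wG, pderiv_mul, pderiv_pow, pderiv_X, Pi.single_apply]
  have eFyy : lineG (pderiv 1 (pderiv 1 (wF k))) A B = (k + 3) * (k + 2) * Y ^ (k + 1) := by
    rw [hL]; simp [wF, pderiv_mul, pderiv_pow, pderiv_X, Pi.single_apply, p3, p2]; ring
  have eFyz : lineG (pderiv 1 (pderiv 2 (wF k))) A B = 1 := by
    rw [hL]; simp [wF, pderiv_mul, pderiv_pow, pderiv_X, Pi.single_apply]
  have eFzz : lineG (pderiv 2 (pderiv 2 (wF k))) A B = 0 := by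
    rw [hL]; simp [wF, pderiv_mul, pderiv_pow, pderiv_X, Pi.single_apply]
  have eGyy : lineG (pderiv 1 (pderiv 1 (wG k l))) A B =
      Polynomial.C (bet k) * (k + 2) * (k + 1) * Y ^ k := by
    rw [hL]; simp [wG, pderiv_mul, pderiv_pow, pderiv_X, Pi.single_apply, p3, p2]; ring
  have eGyz : lineG (pderiv 1 (pderiv 2 (wG k l))) A B = 0 := by
    rw [hL]; simp [wG, pderiv_mul, pderiv_pow, pderiv_X, Pi.single_apply]
  have eGzz : lineG (pderiv 2 (pderiv 2 (wG k l))) A B = 2 * Polynomial.C l * Y ^ (k + 1) := by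
    rw [hL]; simp [wG, pderiv_mul, pderiv_pow, pderiv_X, Pi.single_apply]; ring
  have hadd := fun D E => (lineG_alg A B D E).1
  have hmul := fun D E => (lineG_alg A B D E).2.1
  have hsub := fun D E => (lineG_alg A B D E).2.2.1
  have hneg := fun D => (lineG_alg A B D 0).2.2.2
  have hX0 : lineG (X 0 : MvPolynomial (Fin 3) ℂ) A B = 1 := by rw [hL]; simp
  have hnat : lineG (((k + 3 : ℕ) : MvPolynomial (Fin 3) ℂ)) A B = k + 3 := by rw [hL]; simp
  have h1 : lineG (1 : MvPolynomial (Fin 3) ℂ) A B = 1 := by rw [hL]; simp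
  have h2 : lineG (2 : MvPolynomial (Fin 3) ℂ) A B = 2 := by rw [hL]; simp
  simp only [pow_two, neg_mul, hadd, hmul, hsub, hneg, hX0, hnat, h1, h2, hM, hG, eF, eG, eFy, eFz, eGy,
    eGz, eFyy, eFyz, eFzz, eGyy, eGyz, eGzz] at id
  have rel : Polynomial.C Complex.I * Polynomial.C (bet k) * ((k : Polynomial ℂ) + 1) = k + 3 := by
    have := congrArg Polynomial.C (bet_rel k)
    simpa [c3] using this
  have hWid : wg k * ((k + 3) * Y ^ (k + 2) + Polynomial.C Complex.I) -
      wf k * (Polynomial.C (bet k) * (k + 2) * Y ^ (k + 1)) = wW k := by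
    unfold wg wf wW
    rw [← hY]
    linear_combination (- Y ^ (k + 2)) * rel
  have hW2 : wg k * ((k + 3) * (k + 2) * Y ^ (k + 1)) -
      wf k * (Polynomial.C (bet k) * (k + 2) * (k + 1) * Y ^ k) =
      2 * (k + 2) * Polynomial.C (bet k) * Y ^ (2 * k + 3) := by
    unfold wg wf
    rw [← hY]
    linear_combination (- (k + 2) * Y ^ (k + 1)) * rel
  rw [hWid, hW2] at id
  have hC : (Polynomial.C (2 * ((k : ℂ) + 2) * bet k)) = 2 * (k + 2) * Polynomial.C (bet k) := by
    simp [c2]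
  have hC2 : (Polynomial.C (((k : ℂ) + 2) ^ 2)) = ((k : Polynomial ℂ) + 2) ^ 2 := by
    simp [c2]
  have hC3 : (Polynomial.C (2 * ((k : ℂ) + 2) ^ 2)) = 2 * ((k : Polynomial ℂ) + 2) ^ 2 := by
    simp [c2]
  unfold flexP wD wE
  rw [hC, hC2, hC3, ← hY]
  linear_combination id

lemma bet_ne (k : ℕ) : bet k ≠ 0 := by
  intro h
  have := bet_rel k
  rw [h] at this
  have h3 : (k : ℂ) + 3 ≠ 0 := by exact_mod_cast Nat.succ_ne_zero (k + 2)
  apply h3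
  rw [← this]; ring

lemma wE_natDegree (k : ℕ) : (wE k).natDegree = 6 * (k + 2) := by
  have hc : (2 * ((k : ℂ) + 2) ^ 2) ≠ 0 := by
    have h3 : (k : ℂ) + 2 ≠ 0 := by exact_mod_cast Nat.succ_ne_zero (k + 1)
    exact mul_ne_zero two_ne_zero (pow_ne_zero _ h3)
  have hb := bet_ne k
  have d1 : (Polynomial.X ^ (k + 2) + Polynomial.C Complex.I).natDegree = k + 2 :=
    Polynomial.natDegree_X_pow_add_C
  have n1 : (Polynomial.X ^ (k + 2) + Polynomial.C Complex.I : Polynomial ℂ) ≠ 0 :=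
    Polynomial.X_pow_add_C_ne_zero (by omega) _
  have d2 : (wW k).natDegree = 2 * (k + 2) := by
    unfold wW
    rw [← pow_mul, Polynomial.natDegree_add_C, Polynomial.natDegree_C_mul_X_pow _ _ hb]; ring
  have n2 : wW k ≠ 0 := by
    intro h; rw [h] at d2; simp at d2
  have nf : wf k ≠ 0 := mul_ne_zero Polynomial.X_ne_zero n1
  have df : (wf k).natDegree = k + 3 := by
    unfold wf
    rw [Polynomial.natDegree_mul Polynomial.X_ne_zero n1, d1, Polynomial.natDegree_X]; ring
  unfold wE
  rw [Polynomial.natDegree_C_mul hc, Polynomial.natDegree_mul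
    (mul_ne_zero nf (pow_ne_zero _ Polynomial.X_ne_zero)) (pow_ne_zero _ n2),
    Polynomial.natDegree_mul nf (pow_ne_zero _ Polynomial.X_ne_zero),
    Polynomial.natDegree_pow, Polynomial.natDegree_pow, Polynomial.natDegree_X, d2, df]
  ring

lemma real_pow_ne (r : ℝ) (n : ℕ) : (r : ℂ) ^ n ≠ - Complex.I := by
  intro h
  have := congrArg Complex.im h
  rw [← Complex.ofReal_pow, Complex.ofReal_im] at this
  simp at this

lemma w_coprime (k : ℕ) (t : ℂ) (hE : (wE k).eval t = 0) : (wD k).eval t ≠ 0 := by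
  have h1 : (k : ℂ) + 1 ≠ 0 := by exact_mod_cast Nat.succ_ne_zero k
  have h2 : (k : ℂ) + 2 ≠ 0 := by exact_mod_cast Nat.succ_ne_zero (k + 1)
  have hI := Complex.I_ne_zero
  have hII := Complex.I_mul_I
  have hb := bet_ne k
  have rel := bet_rel k
  have hnat : (k : ℂ) + 1 ≠ k + 3 := by
    intro h; norm_num at h
  have hu : t ^ (2 * k + 3) * t = (t ^ (k + 2)) ^ 2 := by ring
  have hut : t = 0 → t ^ (k + 2) = 0 := by rintro rfl; simp
  have h00 : t = 0 → t ^ (2 * k + 3) = 0 := by rintro rfl; simp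
  have hreal : ∀ r : ℝ, t = r → t ^ (k + 2) ≠ - Complex.I := by
    rintro r rfl; exact real_pow_ne r _
  have hm1 : t = -1 → (t ^ (k + 2)) ^ 2 = 1 := by
    rintro rfl; rw [← pow_mul, mul_comm, pow_mul]; simp
  have hX : t ^ (k + 1) = 0 → t = 0 := fun h => (pow_eq_zero_iff (by omega)).mp h
  simp only [wE, wf, wW, Polynomial.eval_mul, Polynomial.eval_C, Polynomial.eval_X,
    Polynomial.eval_add, Polynomial.eval_pow, mul_eq_zero, pow_eq_zero_iff two_ne_zero,
    OfNat.ofNat_ne_zero, h2, false_or] at hE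
  simp only [wD, wg, wW, Polynomial.eval_mul, Polynomial.eval_C, Polynomial.eval_X,
    Polynomial.eval_add, Polynomial.eval_sub, Polynomial.eval_pow, Polynomial.eval_one,
    Polynomial.eval_ofNat]
  generalize t ^ (k + 2) = u at *
  generalize t ^ (2 * k + 3) = z at *
  have split : u = 0 ∧ z = 0 ∧ t = 0 ∨ u = - Complex.I ∨ bet k * u ^ 2 = - Complex.I := by
    rcases hE with ((h | h) | h) | h
    · exact Or.inl ⟨hut h, h00 h, h⟩
    · right; left; linear_combination h
    · have := hX h
      exact Or.inl ⟨hut this, h00 this, this⟩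
    · right; right; linear_combination h
  refine mul_ne_zero (pow_ne_zero _ h2) (mul_ne_zero (mul_ne_zero ?_ (pow_ne_zero _ ?_)) ?_)
  · -- 1 + t ≠ 0
    intro h
    have ht : t = -1 := by linear_combination h
    rcases split with ⟨-, -, h0⟩ | h0 | h0
    · rw [h0] at ht; norm_num at ht
    · exact hreal (-1) (by rw [ht]; simp) h0
    · rw [hm1 ht, mul_one] at h0
      apply hnat
      rw [h0] at rel
      linear_combination rel + (k + 1) * hII
  · intro h
    rcases split with ⟨h0, -, -⟩ | h0 | h0
    · rw [h0] at h; simp at h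
    · rw [h0] at h
      apply hnat
      linear_combination rel + (k + 1) * h
    · have hu' : u = Complex.I := by linear_combination u * h - h0
      rw [hu'] at h
      apply h2
      linear_combination (-1 / 2 : ℂ) * rel + ((k : ℂ) + 1) / 2 * h
  · intro h
    rcases split with ⟨h0, hz, -⟩ | h0 | h0
    · rw [h0, hz] at h
      apply hI
      linear_combination h / 2
    · have hsq : (-Complex.I) ^ 2 = -1 := by rw [neg_sq, Complex.I_sq]
      rw [h0, hsq] at h hu
      have hkey : t * (k + 1) = - (k + 3) := by
        apply mul_left_cancel₀ h2
        linear_combination (t * Complex.I * (k + 1) / 2) * h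
          + (1 + t) * (k + 2) * bet k * Complex.I * (k + 1) * hu
          - (-t + (1 + t) * (k + 2)) * rel - t * (k + 1) * hII
      refine hreal (-((k + 3 : ℝ) / (k + 1))) ?_ h0
      push_cast
      field_simp
      linear_combination hkey
    · rw [h0] at h
      have h3 : (1 + t) * (2 * ((k : ℂ) + 2) * bet k) * z = 0 := by linear_combination -h
      have ht : 1 + t ≠ 0 := by
        intro h
        have ht : t = -1 := by linear_combination h
        rw [hm1 ht, mul_one] at h0
        apply hnat
        rw [h0] at rel
        linear_combination rel + (k + 1) * hII
      have hz : z = 0 := by simpa [ht, h2, hb] using h3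
      rw [hz, zero_mul] at hu
      rw [← hu, mul_zero] at h0
      apply hI
      linear_combination h0
end witness

theorem witness_exists (d : ℕ) (hd : 3 ≤ d) :
    ∃ (F G : MvPolynomial (Fin 3) ℂ) (h : Fin 3 → ℂ),
          F.IsHomogeneous d ∧ G.IsHomogeneous d ∧ LinearIndependent ℂ ![F, G] ∧ h ≠ 0 ∧
          MvPolynomial.eval (Sum.elim (coeffs2 F G) h) (univQ d) ≠ 0 := by
  obtain ⟨k, rfl⟩ : ∃ k, d = k + 3 := ⟨d - 3, by omega⟩
  obtain ⟨l, hl1, hl2⟩ := bertini (D := wD k) (by omega) (wE_natDegree k) (w_coprime k)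
  refine ⟨wF k, wG k l, ![0, 0, 1], wF_homog k, wG_homog k l, w_indep k l, ?_, ?_⟩
  · intro h
    have := congrFun h 2
    simp at this
  · rw [eval_univQ hd _ (wF_homog k) (wG_homog k l), w_flexP]
    exact ⟨by simp, hl1, hl2⟩

/-- For a general pencil of degree-`d` plane curves and a general line
`H = {h·y = 0} ⊂ ℙ²`, the number of points `p ∈ H` such that the unique member of the
pencil through `p` has a flex at `p` is exactly `6d − 6`. -/
theorem flex_points_on_general_line_count (d : ℕ) (hd : 3 ≤ d) :
    ∃ Q : MvPolynomial (((Fin 3 →₀ ℕ) ⊕ (Fin 3 →₀ ℕ)) ⊕ Fin 3) ℂ,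
      (∃ (F G : MvPolynomial (Fin 3) ℂ) (h : Fin 3 → ℂ),
          F.IsHomogeneous d ∧ G.IsHomogeneous d ∧ LinearIndependent ℂ ![F, G] ∧ h ≠ 0 ∧
          MvPolynomial.eval (Sum.elim (coeffs2 F G) h) Q ≠ 0) ∧
      ∀ (F G : MvPolynomial (Fin 3) ℂ) (h : Fin 3 → ℂ),
        F.IsHomogeneous d → G.IsHomogeneous d → LinearIndependent ℂ ![F, G] → h ≠ 0 →
        MvPolynomial.eval (Sum.elim (coeffs2 F G) h) Q ≠ 0 →
          (flexPointsOnLine F G h).Finite ∧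
            ((flexPointsOnLine F G h).ncard : ℤ) = 6 * (d : ℤ) - 6 := by
  refine ⟨univQ d, witness_exists d hd, ?_⟩
  intro F G h hF hG' _ _ hQ
  obtain ⟨h2, hlead, hsep⟩ := (eval_univQ hd h hF hG').mp hQ
  exact flex_count hd hF hG' h2 hlead hsep
end
end
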